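/- arXiv:2406.15868 — 2 statements merged into one kernel-verified Lean document; each statement's English description precedes it below -/
import Mathlib

section
/- Let k be an algebraically closed field and let S = V(f) ⊆ P³ be a smooth surface of degree d ≥ 3 containing a line L. Then the set of lines on S, distinct from L, that meet L has cardinality at most d³−3d²+4d−2. -/
open MvPolynomial

/-- `W` is a line (2-dimensional linear subspace of `k⁴`) lying on the surface `V(f) ⊆ P³`. -/
def IsLineOn {k : Type*} [Field k] (f : MvPolynomial (Fin 4) k)
    (W : Submodule k (Fin 4 → k)) : Prop :=
  Module.finrank k W = 2 ∧ ∀ v ∈ W, MvPolynomial.eval v f = 0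

/-- `f` is a nonzero homogeneous polynomial of degree `d` in `k[x,y,z,w]` such that `f` and its
four partial derivatives have no common zero in `k⁴ ∖ {0}`; i.e. `V(f) ⊆ P³` is a smooth
surface of degree `d`. -/
def IsSmoothSurface {k : Type*} [Field k] (f : MvPolynomial (Fin 4) k) (d : ℕ) : Prop :=
  f ≠ 0 ∧ f.IsHomogeneous d ∧
    ∀ v : Fin 4 → k, v ≠ 0 →
      ¬ (MvPolynomial.eval v f = 0 ∧
         ∀ i : Fin 4, MvPolynomial.eval v (MvPolynomial.pderiv i f) = 0)

/-- Chain rule for a derivation applied to the value of a multivariate polynomial. -/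
theorem derivation_aeval_eq_sum {k A σ : Type*} [CommRing k] [CommRing A] [Algebra k A] [Fintype σ]
    (D : Derivation k A A) (x : σ → A) (f : MvPolynomial σ k) :
    D (aeval x f) = ∑ i, aeval x (pderiv i f) * D (x i) := by
  classical
  induction f using MvPolynomial.induction_on with
  | C a => simp
  | add p q hp hq => simp [hp, hq, add_mul, Finset.sum_add_distrib]
  | mul_X p j hp =>
    simp only [map_mul, aeval_X, Derivation.leibniz, hp, smul_eq_mul, pderiv_X, map_add, add_mul,
      Finset.sum_add_distrib, Finset.mul_sum]
    congr 1
    · rw [Finset.sum_eq_single j] <;> simp +contextual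
    · exact Finset.sum_congr rfl fun i _ => by ring

/-- A property that is graded-multiplicative and additive holds for the value of a homogeneous
polynomial at arguments satisfying it in degree one. -/
theorem aeval_induction_of_isHomogeneous {k A σ : Type*} [CommRing k] [CommRing A]
    [Algebra k A] {P : ℕ → A → Prop} (h0 : ∀ n, P n 0) (hC : ∀ a : k, P 0 (algebraMap k A a))
    (hadd : ∀ n x y, P n x → P n y → P n (x + y))
    (hmul : ∀ m n x y, P m x → P n y → P (m + n) (x * y))
    {f : MvPolynomial σ k} {d : ℕ} (hf : f.IsHomogeneous d) {x : σ → A} (hx : ∀ i, P 1 (x i)) :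
    P d (aeval x f) := by
  classical
  have hpow : ∀ (i : σ) (n : ℕ), P n (x i ^ n) := by
    intro i n
    induction n with
    | zero => simpa using hC 1
    | succ n ih => rw [pow_succ]; exact hmul _ _ _ _ ih (hx i)
  have hprod : ∀ (s : Finset σ) (u : σ → ℕ), P (∑ i ∈ s, u i) (∏ i ∈ s, x i ^ u i) := by
    intro s u
    induction s using Finset.induction_on with
    | empty => simpa using hC 1
    | insert a s ha ih =>
      rw [Finset.sum_insert ha, Finset.prod_insert ha]
      exact hmul _ _ _ _ (hpow _ _) ih
  rw [f.as_sum, map_sum]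
  refine Finset.sum_induction _ (P d) (hadd d) (h0 d) fun u hu => ?_
  rw [aeval_monomial]
  have h1 : u.degree = d := by
    by_contra h
    exact (mem_support_iff.1 hu) (hf.coeff_eq_zero h)
  have h2 := hmul _ _ _ _ (hC (coeff u f)) (hprod u.support u)
  rw [zero_add] at h2
  rw [← h1]
  exact h2

open Polynomial in
theorem aeval_add_X_mul_of_isHomogeneous {k K σ : Type*} [CommRing k] [CommRing K]
    [Algebra k K] {f : MvPolynomial σ k} {d : ℕ} (hf : f.IsHomogeneous d) (x : σ → K[X])
    (v : σ → K) (hx : ∀ i, (x i).natDegree ≤ 1) (hv : ∀ i, (x i).coeff 1 = v i) :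
    (MvPolynomial.aeval x f).natDegree ≤ d ∧
      (MvPolynomial.aeval x f).coeff d = MvPolynomial.aeval v f := by
  have h := aeval_induction_of_isHomogeneous (A := K[X] × K)
    (P := fun n z => z.1.natDegree ≤ n ∧ z.1.coeff n = z.2)
    (by simp) (by simp [Polynomial.algebraMap_apply])
    (by rintro n x y ⟨hx, hx'⟩ ⟨hy, hy'⟩
        exact ⟨(natDegree_add_le _ _).trans (max_le hx hy), by simp [hx', hy']⟩)
    (by rintro m n x y ⟨hx, hx'⟩ ⟨hy, hy'⟩
        exact ⟨natDegree_mul_le.trans (add_le_add hx hy), by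
          simp [coeff_mul_add_eq_of_natDegree_le hx hy, hx', hy']⟩)
    hf (x := fun i => (x i, v i)) (fun i => ⟨hx i, hv i⟩)
  have h1 := comp_aeval_apply (fun i => (x i, v i)) (AlgHom.fst k K[X] K) f
  have h2 := comp_aeval_apply (fun i => (x i, v i)) (AlgHom.snd k K[X] K) f
  simp only [AlgHom.fst_apply, AlgHom.snd_apply] at h1 h2
  rw [← h1, ← h2]
  exact h

/-- Over an algebraically closed field, the absence of common zeros persists in every extension. -/
theorem exists_aeval_ne_zero_of_forall_eval {k K σ ι : Type*} [Field k] [IsAlgClosed k] [Field K]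
    [Algebra k K] [Finite σ] (g : ι → MvPolynomial σ k)
    (h : ∀ v : σ → k, v ≠ 0 → ∃ i, eval v (g i) ≠ 0) (v : σ → K) (hv : v ≠ 0) :
    ∃ i, aeval v (g i) ≠ 0 := by
  by_contra! H
  apply hv
  funext j
  have h1 : (X j : MvPolynomial σ k) ∈ (Ideal.span (Set.range g)).radical := by
    rw [← vanishingIdeal_zeroLocus_eq_radical (K := k), mem_vanishingIdeal_iff]
    intro x hx
    rw [zeroLocus_span] at hx
    by_cases hx0 : x = 0
    · simp [hx0]
    · obtain ⟨i, hi⟩ := h x hx0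
      exact absurd (hx (g i) ⟨i, rfl⟩) (by simpa [aeval_eq_eval] using hi)
  obtain ⟨n, hn⟩ := h1
  have h2 : Ideal.span (Set.range g) ≤ RingHom.ker (aeval v : MvPolynomial σ k →ₐ[k] K) := by
    rw [Ideal.span_le]
    rintro _ ⟨i, rfl⟩
    exact H i
  have h3 := h2 hn
  rw [RingHom.mem_ker, map_pow, aeval_X] at h3
  exact not_imp_not.1 (pow_ne_zero n) h3

theorem eq_zero_of_isCoprime_of_linear_relation {K : Type*} [Field K] {p q : Polynomial K}
    (h : IsCoprime p q) (hdeg : 2 ≤ p.natDegree ∨ 2 ≤ q.natDegree) {α β η : K}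
    (hrel : Polynomial.C α * Polynomial.X * p +
      (Polynomial.C β + Polynomial.C η * Polynomial.X) * q = 0) : α = 0 ∧ β = 0 ∧ η = 0 := by
  have hlin : ∀ u v : K, (Polynomial.C u + Polynomial.C v * Polynomial.X).natDegree ≤ 1 := by
    intro u v
    rw [add_comm]; exact Polynomial.natDegree_linear_le
  have hlin0 : Polynomial.C β + Polynomial.C η * Polynomial.X = 0 → β = 0 ∧ η = 0 := by
    intro h0
    have h1 := congrArg (Polynomial.coeff · 0) h0
    have h2 := congrArg (Polynomial.coeff · 1) h0
    simp [Polynomial.coeff_C] at h1 h2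
    exact ⟨h1, h2⟩
  have hp : p ∣ Polynomial.C β + Polynomial.C η * Polynomial.X :=
    h.dvd_of_dvd_mul_right ⟨-(Polynomial.C α * Polynomial.X), by linear_combination hrel⟩
  have hq : q ∣ Polynomial.C α * Polynomial.X :=
    h.symm.dvd_of_dvd_mul_right
      ⟨-(Polynomial.C β + Polynomial.C η * Polynomial.X), by linear_combination hrel⟩
  by_cases hα : α = 0
  · subst hα
    simp only [map_zero, zero_mul, zero_add, mul_eq_zero] at hrel
    refine ⟨rfl, hrel.elim hlin0 fun hq0 => ?_⟩
    rw [hq0, isCoprime_zero_right] at h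
    have h1 := Polynomial.natDegree_eq_zero_of_isUnit h
    simp [hq0, h1] at hdeg
  · exfalso
    have h1 : Polynomial.C α * Polynomial.X ≠ 0 := by simp [hα]
    have h2 := Polynomial.natDegree_le_of_dvd hq h1
    rw [Polynomial.natDegree_C_mul_X α hα] at h2
    have h3 : 2 ≤ p.natDegree := by lia
    have h4 : Polynomial.C β + Polynomial.C η * Polynomial.X = 0 := by
      by_contra h5
      have := Polynomial.natDegree_le_of_dvd hp h5
      have := hlin β η
      lia
    rw [h4, zero_mul, add_zero, mul_eq_zero] at hrel
    have h5 := hrel.resolve_left h1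
    simp [h5] at h3

theorem IsSmoothSurface.eq_zero_of_aeval {k K : Type*} [Field k] [IsAlgClosed k] [Field K]
    [Algebra k K] {f : MvPolynomial (Fin 4) k} {d : ℕ} (hf : IsSmoothSurface f d)
    (v : Fin 4 → K) (h : aeval v f = 0) (h' : ∀ i, aeval v (pderiv i f) = 0) : v = 0 := by
  by_contra hv
  obtain ⟨i, hi⟩ := exists_aeval_ne_zero_of_forall_eval
    (fun i : Option (Fin 4) => i.elim f fun i => pderiv i f)
    (by
      intro v hv
      by_contra! H
      exact hf.2.2 v hv ⟨H none, fun i => H (some i)⟩) v hv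
  cases i with
  | none => exact hi h
  | some i => exact hi (h' i)

/-- A smooth surface contains no positive-dimensional family of lines of the form considered here:
any derivation kills the parameters of such a line. -/
theorem IsSmoothSurface.derivation_eq_zero {k K : Type*} [Field k] [IsAlgClosed k] [Field K]
    [Algebra k K] {f : MvPolynomial (Fin 4) k} {d : ℕ} (hd : 3 ≤ d) (hf : IsSmoothSurface f d)
    (D : Derivation k K K) {a b t ρ : K} (hb : b ≠ 0) (hab : D t = 0 → D a = 0 ∧ D b = 0)
    (hΦ : aeval ![Polynomial.C b * Polynomial.X, -(Polynomial.C a * Polynomial.X),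
      Polynomial.C t + Polynomial.C ρ * Polynomial.X, 1] f = 0) : D t = 0 ∧ D ρ = 0 := by
  set P : Fin 4 → Polynomial K := ![Polynomial.C b * Polynomial.X,
    -(Polynomial.C a * Polynomial.X), Polynomial.C t + Polynomial.C ρ * Polynomial.X, 1] with hP
  let γ : Fin 4 → Polynomial K := fun i => aeval P (pderiv i f)
  have h2 : Polynomial.C b * γ 0 - Polynomial.C a * γ 1 + Polynomial.C ρ * γ 2 = 0 := by
    have := derivation_aeval_eq_sum
      ((Polynomial.derivative' : Derivation K (Polynomial K) (Polynomial K)).restrictScalars k) P f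
    rw [hΦ, map_zero, Fin.sum_univ_four] at this
    simp [hP, Polynomial.derivative'] at this
    simp only [γ, hP]
    linear_combination -this
  have h1 : γ 3 = -(Polynomial.C t * γ 2) := by
    have := congrArg (aeval P) hf.2.1.sum_X_mul_pderiv
    rw [map_nsmul, hΦ, smul_zero, Fin.sum_univ_four] at this
    simp [hP] at this
    simp only [γ, hP]
    simp only [γ, hP] at h2
    linear_combination this - Polynomial.X * h2
  have h3 : Polynomial.X * Polynomial.C (D b) * γ 0 - Polynomial.X * Polynomial.C (D a) * γ 1 +
      (Polynomial.C (D t) + Polynomial.X * Polynomial.C (D ρ)) * γ 2 = 0 := by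
    apply Polynomial.eq_zero_of_infinite_isRoot
    refine (Set.infinite_range_of_injective (algebraMap k K).injective).mono ?_
    rintro _ ⟨s, rfl⟩
    have e1 : ∀ g : MvPolynomial (Fin 4) k, aeval
        (fun i => (P i).eval (algebraMap k K s)) g = (aeval P g).eval (algebraMap k K s) := by
      intro g
      exact (comp_aeval_apply P
        ((Polynomial.aeval (R := K) (algebraMap k K s)).restrictScalars k) g).symm
    have := derivation_aeval_eq_sum D (fun i => (P i).eval (algebraMap k K s)) f
    rw [e1, hΦ, Polynomial.eval_zero, map_zero, Fin.sum_univ_four] at this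
    simp only [e1] at this
    simp [hP] at this
    simp only [Set.mem_ofPred_eq, Polynomial.IsRoot.def, γ, hP]
    simp
    linear_combination -this
  have hrel : Polynomial.C (D b * a - b * D a) * Polynomial.X * γ 1 +
      (Polynomial.C (b * D t) + Polynomial.C (b * D ρ - ρ * D b) * Polynomial.X) * γ 2 = 0 := by
    simp only [map_sub, map_mul]
    linear_combination Polynomial.C b * h3 - Polynomial.X * Polynomial.C (D b) * h2
  have hcop : IsCoprime (γ 1) (γ 2) := by
    rw [Polynomial.isCoprime_iff_aeval_ne_zero_of_isAlgClosed K (AlgebraicClosure K)]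
    intro x
    by_contra! hx
    have e1 : ∀ g : MvPolynomial (Fin 4) k, aeval
        (fun i => Polynomial.aeval x (P i)) g = Polynomial.aeval x (aeval P g) := by
      intro g
      exact (comp_aeval_apply P ((Polynomial.aeval (R := K) x).restrictScalars k) g).symm
    have hγ0 : Polynomial.aeval x (γ 0) = 0 := by
      have := congrArg (Polynomial.aeval x) h2
      simpa [hx.1, hx.2, hb] using this
    have hγ3 : Polynomial.aeval x (γ 3) = 0 := by
      rw [h1]; simp [hx.2]
    have h5 := hf.eq_zero_of_aeval (fun i => Polynomial.aeval x (P i))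
      (by rw [e1, hΦ, map_zero]) (by
        intro i
        rw [e1]
        fin_cases i
        exacts [hγ0, hx.1, hx.2, hγ3])
    simpa [hP] using congrFun h5 3
  have hPdeg : ∀ i, (P i).natDegree ≤ 1 := by
    intro i
    fin_cases i <;> simp [hP] <;> compute_degree
  have hPc : ∀ i, (P i).coeff 1 = ![b, -a, ρ, 0] i := by
    intro i
    fin_cases i <;> simp [hP, Polynomial.coeff_C, Polynomial.coeff_one]
  have htop : ∀ i, (γ i).coeff (d - 1) = aeval ![b, -a, ρ, 0] (pderiv i f) := fun i =>
    (aeval_add_X_mul_of_isHomogeneous hf.2.1.pderiv P _ hPdeg hPc).2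
  have hdeg : 2 ≤ (γ 1).natDegree ∨ 2 ≤ (γ 2).natDegree := by
    by_contra! H
    have c1 : (γ 1).coeff (d - 1) = 0 := Polynomial.coeff_eq_zero_of_natDegree_lt (by lia)
    have c2 : (γ 2).coeff (d - 1) = 0 := Polynomial.coeff_eq_zero_of_natDegree_lt (by lia)
    have c3 : (γ 3).coeff (d - 1) = 0 := by rw [h1]; simp [c2]
    have c0 : (γ 0).coeff (d - 1) = 0 := by
      have := congrArg (Polynomial.coeff · (d - 1)) h2
      simpa [c1, c2, hb] using this
    have h5 := hf.eq_zero_of_aeval ![b, -a, ρ, 0]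
      (by
        rw [← (aeval_add_X_mul_of_isHomogeneous hf.2.1 P _ hPdeg hPc).2, hΦ,
          Polynomial.coeff_zero])
      (by
        intro i
        rw [← htop]
        fin_cases i
        exacts [c0, c1, c2, c3])
    exact hb (by simpa using congrFun h5 0)
  obtain ⟨-, hβ, hη⟩ := eq_zero_of_isCoprime_of_linear_relation hcop hdeg hrel
  have ht : D t = 0 := (mul_eq_zero.1 hβ).resolve_left hb
  refine ⟨ht, ?_⟩
  simpa [(hab ht).2, hb] using hη

namespace Polynomial

theorem sum_pow_mul_sylvester {R : Type*} [CommRing R] (E G : R[X]) {m n : ℕ}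
    (hE : E.natDegree ≤ m) (hG : G.natDegree ≤ n) (r : R) (j : Fin (m + n)) :
    ∑ i : Fin (m + n), r ^ (i : ℕ) * sylvester E G m n i j =
      j.addCases (fun j₁ => r ^ (j₁ : ℕ) * G.eval r) (fun j₁ => r ^ (j₁ : ℕ) * E.eval r) := by
  have key : ∀ (F : R[X]) (q s N : ℕ), F.natDegree ≤ q → s + q < N →
      ∑ i : Fin N, r ^ (i : ℕ) * (if (i : ℕ) ∈ Set.Icc s (s + q) then F.coeff (i - s) else 0) =
        r ^ s * F.eval r := by
    intro F q s N hF hN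
    rw [Fin.sum_univ_eq_sum_range
      (fun i => r ^ i * (if i ∈ Set.Icc s (s + q) then F.coeff (i - s) else 0)) N,
      eval_eq_sum_range' (Nat.lt_succ_of_le hF), Finset.mul_sum]
    symm
    apply Finset.sum_of_injOn (fun i => s + i)
    · intro a _ b _ h; simpa using h
    · intro i hi; simp at hi ⊢; lia
    · intro i hi hi'
      rw [if_neg, mul_zero]
      rintro ⟨h1, h2⟩
      exact hi' ⟨i - s, by simp; lia, by simp; lia⟩
    · intro i hi
      rw [Finset.mem_range] at hi
      rw [if_pos (by simp; lia)]
      simp [pow_add]; ring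
  induction j using Fin.addCases with
  | left j => simpa [sylvester] using key G n j (m + n) hG (by lia)
  | right j => simpa [sylvester] using key E m j (m + n) hE (by lia)

theorem pow_card_dvd_det_of_dvd_rows {R ι : Type*} [CommRing R] [Fintype ι] [DecidableEq ι]
    (M : Matrix ι ι R) (q : R) (S : Finset ι) (h : ∀ i ∈ S, ∀ j, q ∣ M i j) :
    q ^ S.card ∣ M.det := by
  rw [← Matrix.det_transpose, Matrix.det_apply']
  refine Finset.dvd_sum fun σ _ => Dvd.dvd.mul_left ?_ _
  rw [← Finset.prod_const]
  refine (Finset.prod_dvd_prod_of_dvd (fun _ => q) _ fun i hi => h i hi (σ i)).trans ?_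
  exact Finset.prod_dvd_prod_of_subset _ _ _ (Finset.subset_univ S)

/-- If two polynomials over `k[t]` have `|S|` common roots after specializing `t = t₀`, then their
resultant vanishes at `t₀` to order at least `|S|`. -/
theorem pow_card_dvd_resultant {k : Type*} [Field k] [Infinite k] (E G : k[X][X]) {m n : ℕ}
    (hE : E.natDegree ≤ m) (hG : G.natDegree ≤ n) (t₀ : k) (S : Finset k) (hS : S.card ≤ m + n)
    (h : ∀ c ∈ S, (E.eval (C c)).eval t₀ = 0 ∧ (G.eval (C c)).eval t₀ = 0) :
    (X - C t₀) ^ S.card ∣ resultant E G m n := by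
  classical
  obtain ⟨S', hSS', hS'⟩ := Infinite.exists_superset_card_eq S (m + n) hS
  let e := (S'.equivFinOfCardEq hS').symm
  let V : Matrix (Fin (m + n)) (Fin (m + n)) k[X] := Matrix.vandermonde fun i => C (e i : k)
  have hV : IsUnit V.det := by
    have h1 : V = (Matrix.vandermonde fun i => (e i : k)).map C := by
      ext i j; simp [V, Matrix.vandermonde_apply]
    rw [h1, ← RingHom.mapMatrix_apply, ← RingHom.map_det]
    refine IsUnit.map C (isUnit_iff_ne_zero.2 (Matrix.det_vandermonde_ne_zero_iff.2 ?_))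
    exact Subtype.val_injective.comp e.injective
  let T : Finset (Fin (m + n)) := Finset.univ.filter fun i => (e i : k) ∈ S
  have hT : T.card = S.card := by
    refine Finset.card_bij (fun i _ => (e i : k)) (by simp [T]) ?_ ?_
    · intro a _ b _ hab
      exact e.injective (Subtype.val_injective hab)
    · intro c hc
      exact ⟨e.symm ⟨c, hSS' hc⟩, by simp [T, hc], by simp⟩
  have h2 : (X - C t₀) ^ T.card ∣ (V * sylvester E G m n).det := by
    apply pow_card_dvd_det_of_dvd_rows
    intro i hi j
    have hi' : (e i : k) ∈ S := by simpa [T] using hi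
    have h3 := sum_pow_mul_sylvester E G hE hG (C (e i : k)) j
    rw [Matrix.mul_apply]
    simp only [V, Matrix.vandermonde_apply]
    rw [h3]
    induction j using Fin.addCases with
    | left j =>
      simp only [Fin.addCases_left]
      exact Dvd.dvd.mul_left (dvd_iff_isRoot.2 (h _ hi').2) _
    | right j =>
      simp only [Fin.addCases_right]
      exact Dvd.dvd.mul_left (dvd_iff_isRoot.2 (h _ hi').1) _
  rw [hT, Matrix.det_mul] at h2
  exact (hV.dvd_mul_left).1 h2

/-- A bound on the degree of the resultant of weighted-bounded polynomials over `k[t]`. -/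
theorem natDegree_resultant_le {k : Type*} [Field k] (E G : k[X][X]) (m n a b κ : ℕ)
    (hE : ∀ l, E.coeff l ≠ 0 → (E.coeff l).natDegree + κ * l ≤ a)
    (hG : ∀ l, G.coeff l ≠ 0 → (G.coeff l).natDegree + κ * l ≤ b) :
    (resultant E G m n).natDegree ≤ m * b + n * a - κ * (m * n) := by
  rw [resultant, Matrix.det_apply']
  refine natDegree_sum_le_of_forall_le _ _ fun σ _ => ?_
  by_cases h0 : ∏ i, sylvester E G m n (σ i) i = 0
  · simp [h0]
  replace h0 := Finset.prod_ne_zero_iff.1 h0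
  let w : Fin (m + n) → ℕ := fun j =>
    j.addCases (fun j₁ => b + κ * (j₁ : ℕ)) (fun j₁ => a + κ * (j₁ : ℕ))
  have h1 : ∀ i, (sylvester E G m n (σ i) i).natDegree + κ * (σ i : ℕ) ≤ w i := by
    intro i
    have h2 := h0 i (Finset.mem_univ i)
    generalize σ i = r at h2
    induction i using Fin.addCases with
    | left i =>
      simp only [sylvester, Matrix.of_apply, Fin.addCases_left, w] at h2 ⊢
      split_ifs at h2 ⊢ with h3
      · have h4 := hG _ h2
        obtain ⟨u, hu⟩ := Nat.exists_eq_add_of_le h3.1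
        rw [hu, Nat.add_sub_cancel_left] at h4 ⊢
        linarith [mul_add κ (i : ℕ) u]
      · exact absurd rfl h2
    | right i =>
      simp only [sylvester, Matrix.of_apply, Fin.addCases_right, w] at h2 ⊢
      split_ifs at h2 ⊢ with h3
      · have h4 := hE _ h2
        obtain ⟨u, hu⟩ := Nat.exists_eq_add_of_le h3.1
        rw [hu, Nat.add_sub_cancel_left] at h4 ⊢
        linarith [mul_add κ (i : ℕ) u]
      · exact absurd rfl h2
  have h2 := Finset.sum_le_sum fun i (_ : i ∈ Finset.univ) => h1 i
  rw [Finset.sum_add_distrib, ← Finset.mul_sum, Equiv.sum_comp σ (fun i => (i : ℕ)),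
    Fin.sum_univ_add w, Fin.sum_univ_add (fun i => (i : ℕ))] at h2
  simp only [w, Fin.addCases_left, Fin.addCases_right, Fin.val_castAdd, Fin.val_natAdd,
    Finset.sum_add_distrib, Finset.sum_const, Finset.card_univ, Fintype.card_fin, smul_eq_mul,
    ← Finset.mul_sum] at h2
  have h3 : (((Equiv.Perm.sign σ : ℤ) : k[X]) *
      ∏ i, sylvester E G m n (σ i) i).natDegree ≤
      ∑ i, (sylvester E G m n (σ i) i).natDegree := by
    refine natDegree_mul_le.trans ?_
    rw [natDegree_intCast, zero_add]
    exact natDegree_prod_le _ _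
  refine h3.trans (Nat.le_sub_of_add_le ?_)
  have h4 : κ * (m * n) = κ * (n * m) := by ring
  rw [h4]
  linarith [mul_add κ (∑ i : Fin m, (i : ℕ)) (n * m + ∑ i : Fin n, (i : ℕ)),
    mul_add κ (n * m) (∑ i : Fin n, (i : ℕ))]

theorem exists_root_of_resultant_eq_zero {R Ω : Type*} [CommRing R] [IsDomain R] [Field Ω]
    [IsAlgClosed Ω] [Algebra R Ω] [FaithfulSMul R Ω] (E G : R[X]) (n : ℕ) (hE : E ≠ 0)
    (hG : G.natDegree ≤ n) (h : resultant E G E.natDegree n = 0) :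
    ∃ ρ : Ω, aeval ρ E = 0 ∧ aeval ρ G = 0 := by
  have hinj := FaithfulSMul.algebraMap_injective R Ω
  have h1 : resultant (E.map (algebraMap R Ω)) (G.map (algebraMap R Ω)) E.natDegree n = 0 := by
    rw [resultant_map_map, h, map_zero]
  have h0 : E.map (algebraMap R Ω) ≠ 0 := (Polynomial.map_ne_zero_iff hinj).2 hE
  rw [← natDegree_map_eq_of_injective hinj E,
    resultant_eq_prod_eval _ _ _ (natDegree_map_le.trans hG) (IsAlgClosed.splits _)] at h1
  have h2 := (mul_eq_zero.1 h1).resolve_left (pow_ne_zero _ (leadingCoeff_ne_zero.2 h0))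
  rw [Multiset.prod_eq_zero_iff, Multiset.mem_map] at h2
  obtain ⟨ρ, hρ, hρ'⟩ := h2
  refine ⟨ρ, ?_, ?_⟩
  · simpa [aeval_def, eval_map] using (mem_roots h0).1 hρ
  · simpa [aeval_def, eval_map] using hρ'

end Polynomial

/-- A finitely generated field extension with a transcendental element has a derivation which does
not kill all the generators. -/
theorem exists_derivation_adjoin_ne_zero {k Ω : Type*} [Field k] [Field Ω] [Algebra k Ω]
    {s : Set Ω} (hs : s.Finite) {t : Ω} (hts : t ∈ s) (ht : Transcendental k t) :
    ∃ D : Derivation k (IntermediateField.adjoin k s) (IntermediateField.adjoin k s),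
      ∃ x : s, D ⟨x, IntermediateField.subset_adjoin k s x.2⟩ ≠ 0 := by
  set K := IntermediateField.adjoin k s with hK
  have hfg : Algebra.EssFiniteType k K :=
    IntermediateField.essFiniteType_iff.2 ⟨hs.toFinset, by simp [hK]⟩
  by_contra! H
  have hD : ∀ D : Derivation k K K, ∀ x, D x = 0 := by
    rintro D ⟨x, hx⟩
    induction hx using IntermediateField.adjoin_induction with
    | mem x hx => exact H D ⟨x, hx⟩
    | algebraMap x => exact D.map_algebraMap x
    | add x y hx hy h1 h2 =>
      have := D.map_add ⟨x, hx⟩ ⟨y, hy⟩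
      rw [h1, h2, add_zero] at this
      exact this
    | inv x hx h1 =>
      have := D.leibniz_inv ⟨x, hx⟩
      rw [h1, smul_zero] at this
      exact this
    | mul x y hx hy h1 h2 =>
      have := D.leibniz ⟨x, hx⟩ ⟨y, hy⟩
      rw [h1, h2, smul_zero, smul_zero, add_zero] at this
      exact this
  have hΩ : Subsingleton (Ω[K⁄k]) := by
    have h1 : ∀ x : K, KaehlerDifferential.D k K x = 0 := by
      intro x
      rw [← Module.forall_dual_apply_eq_zero_iff K]
      intro φ
      exact hD (φ.compDer (KaehlerDifferential.D k K)) x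
    rw [← Submodule.subsingleton_iff K, ← subsingleton_iff_bot_eq_top,
      ← KaehlerDifferential.span_range_derivation, eq_comm, Submodule.span_eq_bot]
    rintro _ ⟨x, rfl⟩
    exact h1 x
  have : Algebra.FormallyUnramified k K := ⟨hΩ⟩
  have := Algebra.FormallyUnramified.isSeparable k K
  have h2 := (Algebra.IsAlgebraic.isAlgebraic (R := k)
    (⟨t, IntermediateField.subset_adjoin k s hts⟩ : K))
  exact ht (by simpa using h2.algebraMap (A := Ω))

/-- The generic line meeting a fixed line does not lie on a smooth surface. -/
theorem IsSmoothSurface.aeval_ne_zero_of_transcendental {k Ω : Type*} [Field k] [IsAlgClosed k]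
    [Field Ω] [Algebra k Ω] {f : MvPolynomial (Fin 4) k} {d : ℕ} (hd : 3 ≤ d)
    (hf : IsSmoothSurface f d) (A B : Polynomial k) (hB : B ≠ 0) {t : Ω} (ht : Transcendental k t)
    (ρ : Ω) : aeval ![Polynomial.C (Polynomial.aeval t B) * Polynomial.X,
      -(Polynomial.C (Polynomial.aeval t A) * Polynomial.X),
      Polynomial.C t + Polynomial.C ρ * Polynomial.X, 1] f ≠ 0 := by
  intro hΦ
  obtain ⟨D, x, hx⟩ := exists_derivation_adjoin_ne_zero (Set.toFinite {t, ρ})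
    (Set.mem_insert t {ρ}) ht
  let K := IntermediateField.adjoin k ({t, ρ} : Set Ω)
  have htK : t ∈ K := IntermediateField.subset_adjoin k _ (Set.mem_insert t {ρ})
  have hρK : ρ ∈ K := IntermediateField.subset_adjoin k _ (by simp)
  let t' : K := ⟨t, htK⟩
  let ρ' : K := ⟨ρ, hρK⟩
  have hval : ∀ F : Polynomial k, K.val (Polynomial.aeval t' F) = Polynomial.aeval t F := fun F =>
    (Polynomial.aeval_algHom_apply K.val t' F).symm
  have hb : Polynomial.aeval t' B ≠ 0 := by
    intro h
    have := hval B
    rw [h, map_zero] at this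
    exact hB ((transcendental_iff.1 ht) B this.symm)
  have h0 := hf.derivation_eq_zero hd D (a := Polynomial.aeval t' A) (t := t') (ρ := ρ') hb
    (by intro h; simp [Derivation.map_aeval, h]) (by
      apply Polynomial.map_injective (K.val : K →+* Ω) K.val.injective
      rw [Polynomial.map_zero, ← hΦ]
      refine (comp_aeval_apply _ (Polynomial.mapAlgHom K.val) f).trans ?_
      congr 2
      funext i
      fin_cases i <;> simp [← hval]
      rfl)
  rcases x.2 with h | h
  · exact hx ((congrArg D (Subtype.ext h)).trans h0.1)
  · exact hx ((congrArg D (Subtype.ext (Set.mem_singleton_iff.1 h))).trans h0.2)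

theorem aeval_line_eq_zero_of_generic {k R : Type*} [Field k] [CommRing R] [Algebra k R]
    {f : MvPolynomial (Fin 4) k}
    (h : aeval ![0, 0, (X 0 : MvPolynomial (Fin 2) k), X 1] f = 0) (z w : R) :
    aeval ![0, 0, z, w] f = 0 := by
  have h1 := comp_aeval_apply ![0, 0, (X 0 : MvPolynomial (Fin 2) k), X 1] (aeval ![z, w]) f
  rw [h, map_zero] at h1
  refine Eq.trans ?_ h1.symm
  congr 2
  funext i
  fin_cases i <;> simp

/-- A polynomial vanishing on the line `x = y = 0` vanishes there over every algebra. -/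
theorem aeval_line_eq_zero {k R : Type*} [Field k] [Infinite k] [CommRing R] [Algebra k R]
    {f : MvPolynomial (Fin 4) k} (hL : ∀ z w : k, eval ![0, 0, z, w] f = 0) (z w : R) :
    aeval ![0, 0, z, w] f = 0 := by
  apply aeval_line_eq_zero_of_generic
  apply MvPolynomial.funext
  intro v
  rw [map_zero, ← hL (v 0) (v 1), ← aeval_eq_eval, comp_aeval_apply, ← aeval_eq_eval]
  congr 2
  funext i
  fin_cases i <;> simp

theorem aeval_pderiv_line_eq_zero {k R : Type*} [Field k] [Infinite k] [CommRing R] [Algebra k R]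
    {f : MvPolynomial (Fin 4) k} (hL : ∀ z w : k, eval ![0, 0, z, w] f = 0) (z w : R) :
    aeval ![0, 0, z, w] (pderiv 2 f) = 0 ∧ aeval ![0, 0, z, w] (pderiv 3 f) = 0 := by
  have h0 := aeval_line_eq_zero hL (X 0 : MvPolynomial (Fin 2) k) (X 1)
  constructor <;> apply aeval_line_eq_zero_of_generic
  · have h1 := derivation_aeval_eq_sum (pderiv (0 : Fin 2))
      ![0, 0, (X 0 : MvPolynomial (Fin 2) k), X 1] f
    rw [h0, map_zero, Fin.sum_univ_four] at h1
    simpa using h1.symm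
  · have h1 := derivation_aeval_eq_sum (pderiv (1 : Fin 2))
      ![0, 0, (X 0 : MvPolynomial (Fin 2) k), X 1] f
    rw [h0, map_zero, Fin.sum_univ_four] at h1
    simpa using h1.symm

/-- The `i`-th partial derivative of `f` along the affine line `(0, 0, t, 1)`. -/
noncomputable def linePartial {k : Type*} [Field k] (f : MvPolynomial (Fin 4) k) (i : Fin 4) :
    Polynomial k :=
  aeval ![0, 0, Polynomial.X, 1] (pderiv i f)

theorem eval_linePartial {k : Type*} [Field k] (f : MvPolynomial (Fin 4) k) (i : Fin 4) (t : k) :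
    (linePartial f i).eval t = eval ![0, 0, t, 1] (pderiv i f) := by
  rw [linePartial, ← Polynomial.coe_aeval_eq_eval, comp_aeval_apply, ← aeval_eq_eval]
  congr 2
  funext i
  fin_cases i <;> simp

theorem linePartial_natDegree_le {k : Type*} [Field k] {f : MvPolynomial (Fin 4) k} {d : ℕ}
    (hf : f.IsHomogeneous d) (i : Fin 4) : (linePartial f i).natDegree ≤ d - 1 ∧
      (linePartial f i).coeff (d - 1) = eval ![0, 0, 1, 0] (pderiv i f) := by
  rw [← aeval_eq_eval]
  refine aeval_add_X_mul_of_isHomogeneous hf.pderiv _ _ (fun i => ?_) (fun i => ?_)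
  · fin_cases i <;> simp
  · fin_cases i <;> simp [Polynomial.coeff_one]

namespace Polynomial

theorem ne_C_mul_of_no_common_root {k : Type*} [Field k] [IsAlgClosed k] {p q : k[X]} {n : ℕ}
    (hn : n ≠ 0) (h : ∀ t, ¬ (p.eval t = 0 ∧ q.eval t = 0))
    (hinf : ¬ (p.coeff n = 0 ∧ q.coeff n = 0)) (ν : k) : q ≠ C ν * p := by
  rintro rfl
  have hdeg : p.degree = 0 := by
    by_contra h0
    obtain ⟨t, ht⟩ := IsAlgClosed.exists_root p h0
    exact h t ⟨ht, by simp [ht.eq_zero]⟩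
  have hc : p.coeff n = 0 := coeff_eq_zero_of_degree_lt (by
    rw [hdeg]; exact_mod_cast Nat.pos_of_ne_zero hn)
  exact hinf ⟨hc, by simp [hc]⟩

theorem eq_zero_of_C_mul_add_eq_zero {k : Type*} [Field k] [IsAlgClosed k] {p q : k[X]} {n : ℕ}
    (hn : n ≠ 0) (h : ∀ t, ¬ (p.eval t = 0 ∧ q.eval t = 0))
    (hinf : ¬ (p.coeff n = 0 ∧ q.coeff n = 0)) {a b : k} (hab : C a * p + C b * q = 0) :
    a = 0 ∧ b = 0 := by
  have key : ∀ {p q : k[X]} {a b : k}, (∀ t, ¬ (p.eval t = 0 ∧ q.eval t = 0)) →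
      ¬ (p.coeff n = 0 ∧ q.coeff n = 0) → C a * p + C b * q = 0 → b = 0 := by
    intro p q a b h hinf hab
    by_contra hb
    apply ne_C_mul_of_no_common_root hn h hinf (-(b⁻¹ * a))
    have h1 : C b⁻¹ * C b = (1 : k[X]) := by rw [← C_mul, inv_mul_cancel₀ hb, C_1]
    simp only [C_neg, C_mul]
    linear_combination C b⁻¹ * hab - q * h1
  refine ⟨key (fun t ht => h t ht.symm) (fun h' => hinf h'.symm) (p := q) (q := p) (a := b) ?_,
    key h hinf hab⟩
  rw [add_comm]; exact hab

end Polynomial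

theorem IsSmoothSurface.linePartial_independent {k : Type*} [Field k] [IsAlgClosed k]
    {f : MvPolynomial (Fin 4) k} {d : ℕ} (hd : 3 ≤ d) (hf : IsSmoothSurface f d)
    (hL : ∀ z w : k, eval ![0, 0, z, w] f = 0) {a b : k}
    (h : Polynomial.C a * linePartial f 0 + Polynomial.C b * linePartial f 1 = 0) :
    a = 0 ∧ b = 0 := by
  have key : ∀ z w : k, ![0, 0, z, w] ≠ 0 →
      ¬ (eval ![0, 0, z, w] (pderiv 0 f) = 0 ∧ eval ![0, 0, z, w] (pderiv 1 f) = 0) := by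
    rintro z w h0 ⟨h1, h2⟩
    refine hf.2.2 _ h0 ⟨hL z w, fun i => ?_⟩
    have h3 := aeval_pderiv_line_eq_zero hL z w
    rw [aeval_eq_eval] at h3
    fin_cases i
    exacts [h1, h2, h3.1, h3.2]
  refine Polynomial.eq_zero_of_C_mul_add_eq_zero (n := d - 1) (by lia) (fun t => ?_) ?_ h
  · simp only [eval_linePartial]
    exact key t 1 fun h => by simpa using congrFun h 3
  · simp only [(linePartial_natDegree_le hf.2.1 _).2]
    exact key 1 0 fun h => by simpa using congrFun h 2

theorem IsSmoothSurface.linePartial_eval_ne_zero {k : Type*} [Field k] [IsAlgClosed k]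
    {f : MvPolynomial (Fin 4) k} {d : ℕ} (hf : IsSmoothSurface f d)
    (hL : ∀ z w : k, eval ![0, 0, z, w] f = 0) (t : k) :
    ¬ ((linePartial f 0).eval t = 0 ∧ (linePartial f 1).eval t = 0) := by
  simp only [eval_linePartial]
  rintro ⟨h1, h2⟩
  refine hf.2.2 ![0, 0, t, 1] (fun h => by simpa using congrFun h 3) ⟨hL t 1, fun i => ?_⟩
  have h3 := aeval_pderiv_line_eq_zero hL t 1
  rw [aeval_eq_eval] at h3
  fin_cases i
  exacts [h1, h2, h3.1, h3.2]

/-- The surface does not contain, nor meet only in one point, the tangent plane at a point of the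
line. -/
theorem IsSmoothSurface.not_forall_eval_eq_pow {k : Type*} [Field k] [IsAlgClosed k]
    {f : MvPolynomial (Fin 4) k} {d : ℕ} (hd : 3 ≤ d) (hf : IsSmoothSurface f d)
    (hL : ∀ z w : k, eval ![0, 0, z, w] f = 0) (t b : k) :
    ¬ ∀ c r : k, eval ![(linePartial f 1).eval t * r, -((linePartial f 0).eval t * r),
      t + c * r, 1] f = b * r ^ d := by
  intro H
  set A₀ := (linePartial f 0).eval t with hA
  set B₀ := (linePartial f 1).eval t with hB
  have hz : ∀ z : k, B₀ * (linePartial f 0).eval z - A₀ * (linePartial f 1).eval z = 0 := by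
    intro z
    let P : Fin 4 → Polynomial k := ![Polynomial.C B₀ * Polynomial.X,
      -(Polynomial.C A₀ * Polynomial.X), Polynomial.C z, 1]
    have hP : ∀ (r : k) (g : MvPolynomial (Fin 4) k),
        (aeval P g).eval r = eval ![B₀ * r, -(A₀ * r), z, 1] g := by
      intro r g
      rw [← Polynomial.coe_aeval_eq_eval, comp_aeval_apply, ← aeval_eq_eval]
      congr 2
      funext i
      fin_cases i <;> simp [P]
    have h1 : aeval P f = Polynomial.C b * Polynomial.X ^ d := by
      apply Polynomial.eq_of_infinite_eval_eq
      refine (Set.finite_singleton (0 : k)).infinite_compl.mono fun r hr => ?_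
      have hr0 : r ≠ 0 := hr
      have h2 := H ((z - t) / r) r
      rw [div_mul_cancel₀ _ hr0, add_sub_cancel] at h2
      simp [hP, h2]
    have h2 := derivation_aeval_eq_sum (Polynomial.derivative' (R := k)) P f
    rw [h1] at h2
    have h3 := congrArg (Polynomial.eval 0) h2
    rw [Fin.sum_univ_four] at h3
    have h4 : d - 1 ≠ 0 := by lia
    simp [Polynomial.derivative', hP, P, h4] at h3
    rw [eval_linePartial, eval_linePartial]
    linear_combination -h3
  have h0 : Polynomial.C B₀ * linePartial f 0 + Polynomial.C (-A₀) * linePartial f 1 = 0 := by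
    apply Polynomial.funext
    intro z
    simp only [Polynomial.eval_add, Polynomial.eval_mul, Polynomial.eval_C, Polynomial.eval_zero]
    linear_combination hz z
  have h5 := hf.linePartial_independent hd hL h0
  exact hf.linePartial_eval_ne_zero hL t ⟨by simpa using h5.2, h5.1⟩

namespace Polynomial

/-- The weight condition `deg_t + κ deg_c ≤ n + e deg_r` on the monomials of a polynomial in
`k[t][c][r]`. -/
def WeightLE {k : Type*} [CommRing k] (κ e n : ℕ) (P : k[X][X][X]) : Prop :=
  ∀ j l m, ((P.coeff j).coeff l).coeff m ≠ 0 → m + κ * l ≤ n + e * j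

theorem WeightLE.add {k : Type*} [CommRing k] {κ e n : ℕ} {P Q : k[X][X][X]}
    (hP : WeightLE κ e n P) (hQ : WeightLE κ e n Q) : WeightLE κ e n (P + Q) := by
  intro j l m h
  by_cases h1 : ((P.coeff j).coeff l).coeff m = 0
  · exact hQ j l m fun h2 => h (by simp [h1, h2])
  · exact hP j l m h1

theorem WeightLE.neg {k : Type*} [CommRing k] {κ e n : ℕ} {P : k[X][X][X]}
    (hP : WeightLE κ e n P) : WeightLE κ e n (-P) := by
  intro j l m h
  exact hP j l m (by simpa using h)

theorem WeightLE.mul {k : Type*} [CommRing k] {κ e n n' : ℕ} {P Q : k[X][X][X]}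
    (hP : WeightLE κ e n P) (hQ : WeightLE κ e n' Q) : WeightLE κ e (n + n') (P * Q) := by
  intro j l m h
  rw [coeff_mul, finsetSum_coeff, finsetSum_coeff] at h
  obtain ⟨⟨j₁, j₂⟩, hj, h⟩ := Finset.exists_ne_zero_of_sum_ne_zero h
  rw [coeff_mul, finsetSum_coeff] at h
  obtain ⟨⟨l₁, l₂⟩, hl, h⟩ := Finset.exists_ne_zero_of_sum_ne_zero h
  rw [coeff_mul] at h
  obtain ⟨⟨m₁, m₂⟩, hm, h⟩ := Finset.exists_ne_zero_of_sum_ne_zero h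
  rw [Finset.HasAntidiagonal.mem_antidiagonal] at hj hl hm
  have h1 := hP _ _ _ (left_ne_zero_of_mul h)
  have h2 := hQ _ _ _ (right_ne_zero_of_mul h)
  simp only at hj hl hm h1 h2
  subst hj hl hm
  linarith [mul_add κ l₁ l₂, mul_add e j₁ j₂]

theorem WeightLE.aeval {k : Type*} [CommRing k] {κ e d : ℕ} {σ : Type*} {f : MvPolynomial σ k}
    (hf : f.IsHomogeneous d) {x : σ → k[X][X][X]} (hx : ∀ i, WeightLE κ e 1 (x i)) :
    WeightLE κ e d (MvPolynomial.aeval x f) := by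
  refine aeval_induction_of_isHomogeneous (P := WeightLE κ e) ?_ ?_ (fun _ _ _ => WeightLE.add)
    (fun _ _ _ _ => WeightLE.mul) hf hx
  · intro n j l m h; simp at h
  · intro a j l m h
    simp only [algebraMap_apply, coeff_C, Algebra.algebraMap_self, RingHom.id_apply] at h
    split_ifs at h with h1
    · rw [coeff_C] at h
      split_ifs at h with h2
      · rw [coeff_C] at h
        split_ifs at h with h3
        · subst h2 h3; simp
        · simp at h
      · simp at h
    · simp at h

theorem WeightLE.C_C_mul_X {k : Type*} [CommRing k] {κ e : ℕ} {p : k[X]}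
    (hp : p.natDegree ≤ e + 1) : WeightLE κ e 1 (C (C p) * X) := by
  intro j l m h
  rw [coeff_C_mul, coeff_X] at h
  split_ifs at h with h1
  · subst h1
    rw [mul_one, coeff_C] at h
    split_ifs at h with h2
    · subst h2
      have := le_natDegree_of_ne_zero h
      lia
    · simp at h
  · simp at h

theorem WeightLE.C_C_X {k : Type*} [CommRing k] {κ e : ℕ} :
    WeightLE κ e 1 (C (C X) : k[X][X][X]) := by
  intro j l m h
  simp only [coeff_C] at h
  split_ifs at h with h1
  · rw [coeff_C] at h
    split_ifs at h with h2
    · rw [coeff_X] at h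
      split_ifs at h with h3
      · subst h2 h3; lia
      · simp at h
    · simp at h
  · simp at h

theorem WeightLE.C_X_mul_X {k : Type*} [CommRing k] {e : ℕ} :
    WeightLE (e + 1) e 1 (C X * X : k[X][X][X]) := by
  intro j l m h
  rw [coeff_C_mul, coeff_X] at h
  split_ifs at h with h1
  · subst h1
    rw [mul_one, coeff_X] at h
    split_ifs at h with h2
    · subst h2
      rw [coeff_one] at h
      split_ifs at h with h3
      · lia
      · simp at h
    · simp at h
  · simp at h

theorem WeightLE.one {k : Type*} [CommRing k] {κ e n : ℕ} :
    WeightLE κ e n (1 : k[X][X][X]) := by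
  intro j l m h
  rw [coeff_one] at h
  split_ifs at h with h1
  · rw [coeff_one] at h
    split_ifs at h with h2
    · rw [coeff_one] at h
      split_ifs at h with h3
      · subst h2 h3; lia
      · simp at h
    · simp at h
  · simp at h

theorem WeightLE.natDegree_coeff_le {k : Type*} [CommRing k] {κ e n : ℕ} {P : k[X][X][X]}
    (hP : WeightLE κ e n P) {j l : ℕ} (h : (P.coeff j).coeff l ≠ 0) :
    ((P.coeff j).coeff l).natDegree + κ * l ≤ n + e * j :=
  hP _ _ _ (by rwa [← leadingCoeff, leadingCoeff_ne_zero])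

/-- The polynomials in `R[c][r]` whose `c`-degree is bounded by the `r`-degree, monomial by
monomial. -/
def coeffDegreeSubring (R : Type*) [CommRing R] : Subring R[X][X] where
  carrier := {P | ∀ j, (P.coeff j).natDegree ≤ j}
  zero_mem' := by simp
  one_mem' := by
    intro j
    rw [coeff_one]
    split_ifs <;> simp
  add_mem' := by
    intro P Q hP hQ j
    rw [coeff_add]
    exact (natDegree_add_le _ _).trans (max_le (hP j) (hQ j))
  neg_mem' := by
    intro P hP j
    rw [coeff_neg, natDegree_neg]
    exact hP j
  mul_mem' := by
    intro P Q hP hQ j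
    rw [coeff_mul]
    refine natDegree_sum_le_of_forall_le _ _ fun x hx => natDegree_mul_le.trans ?_
    rw [← Finset.HasAntidiagonal.mem_antidiagonal.1 hx]
    exact add_le_add (hP _) (hQ _)

theorem X_mem_coeffDegreeSubring {R : Type*} [CommRing R] :
    (X : R[X][X]) ∈ coeffDegreeSubring R := by
  intro j
  rw [coeff_X]
  split_ifs <;> simp

theorem C_C_mem_coeffDegreeSubring {R : Type*} [CommRing R] (a : R) :
    (C (C a) : R[X][X]) ∈ coeffDegreeSubring R := by
  intro j
  rw [coeff_C]
  split_ifs <;> simp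

theorem C_X_mul_X_mem_coeffDegreeSubring {R : Type*} [CommRing R] :
    (C X * X : R[X][X]) ∈ coeffDegreeSubring R := by
  intro j
  rw [coeff_C_mul, coeff_X]
  split_ifs with h
  · subst h; simpa using natDegree_X_le
  · simp

theorem exists_aeval_eq_add_X_mul {k R : Type*} [CommRing k] [CommRing R] [Algebra k R]
    {σ : Type*} (f : MvPolynomial σ k) {x y h : σ → R[X][X]} (hx : ∀ i, x i = y i + X * h i)
    (hy : ∀ i, y i ∈ coeffDegreeSubring R) (hh : ∀ i, h i ∈ coeffDegreeSubring R) :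
    MvPolynomial.aeval y f ∈ coeffDegreeSubring R ∧
      ∃ g ∈ coeffDegreeSubring R, MvPolynomial.aeval x f = MvPolynomial.aeval y f + X * g := by
  induction f using MvPolynomial.induction_on with
  | C a =>
    refine ⟨?_, 0, zero_mem _, by simp⟩
    simpa [algebraMap_apply] using C_C_mem_coeffDegreeSubring (algebraMap k R a)
  | add p q hp hq =>
    obtain ⟨hp, g, hg, hg'⟩ := hp
    obtain ⟨hq, g', hg₂, hg₂'⟩ := hq
    refine ⟨by rw [map_add]; exact add_mem hp hq, g + g', add_mem hg hg₂, ?_⟩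
    rw [map_add, map_add, hg', hg₂']; ring
  | mul_X p i hp =>
    obtain ⟨hp, g, hg, hg'⟩ := hp
    refine ⟨by rw [map_mul, MvPolynomial.aeval_X]; exact mul_mem hp (hy i),
      g * y i + MvPolynomial.aeval y p * h i + X * g * h i, ?_, ?_⟩
    · exact add_mem (add_mem (mul_mem hg (hy i)) (mul_mem hp (hh i)))
        (mul_mem (mul_mem X_mem_coeffDegreeSubring hg) (hh i))
    · rw [map_mul, map_mul, MvPolynomial.aeval_X, MvPolynomial.aeval_X, hg', hx]; ring

end Polynomial

/-- The restriction of `f` to the tangent planes along the line `x = y = 0`: the value of `f` at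
`(B r, -A r, t + c r, 1)`, as a polynomial in `k[t][c][r]`, where `A` and `B` are the first two
partial derivatives of `f` at `(0, 0, t, 1)`. -/
noncomputable def tangentFamily {k : Type*} [Field k] (f : MvPolynomial (Fin 4) k) :
    Polynomial (Polynomial (Polynomial k)) :=
  aeval ![Polynomial.C (Polynomial.C (linePartial f 1)) * Polynomial.X,
    -(Polynomial.C (Polynomial.C (linePartial f 0)) * Polynomial.X),
    Polynomial.C (Polynomial.C Polynomial.X) + Polynomial.C Polynomial.X * Polynomial.X, 1] f

theorem tangentFamily_natDegree_le {k : Type*} [Field k] {f : MvPolynomial (Fin 4) k} {d : ℕ}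
    (hf : f.IsHomogeneous d) : (tangentFamily f).natDegree ≤ d := by
  refine (aeval_add_X_mul_of_isHomogeneous hf _ (fun i => Polynomial.coeff (![_, _, _, _] i) 1)
    (fun i => ?_) (fun i => rfl)).1
  fin_cases i <;> simp <;> compute_degree

theorem map_tangentFamily {k K : Type*} [Field k] [CommRing K] [Algebra k K]
    (f : MvPolynomial (Fin 4) k) (t ρ : K) :
    (tangentFamily f).map (Polynomial.aevalAeval (R := k) t ρ : _ →+* K) =
      aeval ![Polynomial.C (Polynomial.aeval t (linePartial f 1)) * Polynomial.X,
        -(Polynomial.C (Polynomial.aeval t (linePartial f 0)) * Polynomial.X),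
        Polynomial.C t + Polynomial.C ρ * Polynomial.X, 1] f := by
  let φ : Polynomial (Polynomial (Polynomial k)) →ₐ[k] Polynomial K :=
    Polynomial.mapAlgHom (Polynomial.aevalAeval (R := k) t ρ)
  refine (comp_aeval_apply (S₁ := Polynomial (Polynomial (Polynomial k)))
    (B := Polynomial K) _ φ f).trans ?_
  congr 2
  funext i
  fin_cases i <;> simp [φ]

theorem eval_map_tangentFamily {k : Type*} [Field k] (f : MvPolynomial (Fin 4) k) (t c r : k) :
    ((tangentFamily f).map (Polynomial.aevalAeval (R := k) t c : _ →+* k)).eval r =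
      eval ![(linePartial f 1).eval t * r, -((linePartial f 0).eval t * r), t + c * r, 1] f := by
  rw [map_tangentFamily, ← Polynomial.coe_aeval_eq_eval, comp_aeval_apply, ← aeval_eq_eval]
  congr 2
  funext i
  fin_cases i <;> simp

theorem weightLE_tangentFamily {k : Type*} [Field k] {f : MvPolynomial (Fin 4) k} {d : ℕ}
    (hd : 2 ≤ d) (hf : f.IsHomogeneous d) :
    Polynomial.WeightLE (d - 1) (d - 2) d (tangentFamily f) := by
  obtain ⟨e, rfl⟩ := Nat.exists_eq_add_of_le' hd
  refine Polynomial.WeightLE.aeval hf fun i => ?_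
  have h := fun i => (linePartial_natDegree_le hf i).1
  fin_cases i
  exacts [.C_C_mul_X (h 1), (Polynomial.WeightLE.C_C_mul_X (h 0)).neg,
    Polynomial.WeightLE.C_C_X.add Polynomial.WeightLE.C_X_mul_X, .one]

theorem natDegree_coeff_tangentFamily_le {k : Type*} [Field k] [Infinite k]
    {f : MvPolynomial (Fin 4) k} (hL : ∀ z w : k, eval ![0, 0, z, w] f = 0) (j : ℕ) :
    ((tangentFamily f).coeff j).natDegree ≤ j - 1 ∧ (tangentFamily f).coeff 0 = 0 := by
  obtain ⟨-, g, hg, hg'⟩ := Polynomial.exists_aeval_eq_add_X_mul f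
    (x := ![Polynomial.C (Polynomial.C (linePartial f 1)) * Polynomial.X,
      -(Polynomial.C (Polynomial.C (linePartial f 0)) * Polynomial.X),
      Polynomial.C (Polynomial.C Polynomial.X) + Polynomial.C Polynomial.X * Polynomial.X, 1])
    (y := ![0, 0, Polynomial.C (Polynomial.C Polynomial.X) +
      Polynomial.C Polynomial.X * Polynomial.X, 1])
    (h := ![Polynomial.C (Polynomial.C (linePartial f 1)),
      -(Polynomial.C (Polynomial.C (linePartial f 0))), 0, 0])
    (by
      intro i
      fin_cases i <;> simp
      all_goals ring)
    (by
      intro i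
      fin_cases i
      exacts [zero_mem _, zero_mem _, add_mem (Polynomial.C_C_mem_coeffDegreeSubring _)
        Polynomial.C_X_mul_X_mem_coeffDegreeSubring, one_mem _])
    (by
      intro i
      fin_cases i
      exacts [Polynomial.C_C_mem_coeffDegreeSubring _,
        neg_mem (Polynomial.C_C_mem_coeffDegreeSubring _), zero_mem _, zero_mem _])
  have h : tangentFamily f = Polynomial.X * g := by
    rw [tangentFamily, hg', aeval_line_eq_zero hL, zero_add]
  rw [h]
  constructor
  · cases j with
    | zero => simp
    | succ j => rw [Polynomial.coeff_X_mul]; exact hg j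
  · simp

namespace Polynomial

theorem WeightLE.eval {k : Type*} [CommRing k] {κ e n d : ℕ} {P : k[X][X][X]}
    (hP : WeightLE κ e n P) (hd : P.natDegree ≤ d) (s : k) {l : ℕ}
    (h : (P.eval (C (C s))).coeff l ≠ 0) :
    ((P.eval (C (C s))).coeff l).natDegree + κ * l ≤ n + e * d := by
  have h1 : ((P.eval (C (C s))).coeff l).coeff ((P.eval (C (C s))).coeff l).natDegree ≠ 0 := by
    rwa [← leadingCoeff, leadingCoeff_ne_zero]
  generalize ((P.eval (C (C s))).coeff l).natDegree = m at h1 ⊢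
  rw [eval_eq_sum_range' (Nat.lt_succ_of_le hd), finsetSum_coeff, finsetSum_coeff] at h1
  obtain ⟨j, hj, h2⟩ := Finset.exists_ne_zero_of_sum_ne_zero h1
  rw [← C_pow, ← C_pow, coeff_mul_C, coeff_mul_C] at h2
  have h3 := hP j l m (left_ne_zero_of_mul h2)
  rw [Finset.mem_range] at hj
  have : e * j ≤ e * d := Nat.mul_le_mul_left e (by lia)
  lia

theorem natDegree_eval_C_C_le {R : Type*} [CommRing R] {d : ℕ} {P : R[X][X]}
    (hP : ∀ j, (P.coeff j).natDegree ≤ j - 1) (hd : P.natDegree ≤ d) (s : R) :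
    (P.eval (C s)).natDegree ≤ d - 1 := by
  rw [eval_eq_sum_range' (Nat.lt_succ_of_le hd)]
  refine natDegree_sum_le_of_forall_le _ _ fun j hj => ?_
  rw [← C_pow]
  rw [Finset.mem_range] at hj
  exact (natDegree_mul_C_le _ _).trans ((hP j).trans (by lia))

theorem aevalAeval_algebraMap_X {k Ω : Type*} [CommRing k] [CommRing Ω] [Algebra k Ω]
    [Algebra k[X] Ω] [IsScalarTower k k[X] Ω] (ρ : Ω) (P : k[X][X]) :
    aevalAeval (R := k) (algebraMap k[X] Ω X) ρ P = aeval ρ P := by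
  have h : aevalAeval (R := k) (algebraMap k[X] Ω X) ρ =
      (aeval (R := k[X]) ρ).restrictScalars k := by
    ext <;> simp
  rw [h]; rfl

end Polynomial

section Generic

variable {k : Type*} (Ω : Type*) [Field k] [IsAlgClosed k] [Field Ω] [Algebra k Ω]
  [Algebra (Polynomial k) Ω] [IsScalarTower k (Polynomial k) Ω] [FaithfulSMul (Polynomial k) Ω]
  {f : MvPolynomial (Fin 4) k} {d : ℕ}

theorem IsSmoothSurface.map_tangentFamily_ne_zero (hd : 3 ≤ d) (hf : IsSmoothSurface f d)
    (hL : ∀ z w : k, eval ![0, 0, z, w] f = 0) (ρ : Ω) :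
    (tangentFamily f).map (Polynomial.aevalAeval (R := k)
      (algebraMap (Polynomial k) Ω Polynomial.X) ρ : _ →+* Ω) ≠ 0 := by
  rw [map_tangentFamily]
  refine hf.aeval_ne_zero_of_transcendental hd _ _ (fun hB => ?_) ?_ ρ
  · have := hf.linePartial_independent hd hL (a := 0) (b := 1) (by simp [hB])
    exact one_ne_zero this.2
  · exact (transcendental_algebraMap_iff (FaithfulSMul.algebraMap_injective _ _)).2
      (Polynomial.transcendental_X k)

/-- The tangent planes generically meet the surface along the line with multiplicity less than
`d`. -/
theorem IsSmoothSurface.natTrailingDegree_tangentFamily_lt [IsAlgClosed Ω] (hd : 3 ≤ d)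
    (hf : IsSmoothSurface f d) (hL : ∀ z w : k, eval ![0, 0, z, w] f = 0)
    (hΦ : tangentFamily f ≠ 0) : (tangentFamily f).natTrailingDegree < d := by
  have hdeg := tangentFamily_natDegree_le hf.2.1
  refine lt_of_le_of_ne ((Polynomial.natTrailingDegree_le_natDegree _).trans hdeg) fun hj => ?_
  have hlow : ∀ i, i ≠ d → (tangentFamily f).coeff i = 0 := by
    intro i hi
    rcases lt_or_gt_of_ne hi with h | h
    · exact Polynomial.coeff_eq_zero_of_lt_natTrailingDegree (by rwa [hj])
    · exact Polynomial.coeff_eq_zero_of_natDegree_lt (by lia)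
  have hE : (tangentFamily f).coeff d ≠ 0 := by
    rw [← hj]; exact Polynomial.trailingCoeff_nonzero_iff_nonzero.2 hΦ
  by_cases h0 : ((tangentFamily f).coeff d).natDegree = 0
  · rw [Polynomial.natDegree_eq_zero] at h0
    obtain ⟨g, hg⟩ := h0
    apply hf.not_forall_eval_eq_pow hd hL 0 (g.eval 0)
    intro c r
    rw [← eval_map_tangentFamily, Polynomial.eval_map,
      Polynomial.eval₂_eq_sum_range' _ (Nat.lt_succ_of_le hdeg), Finset.sum_eq_single d]
    · rw [← hg]; simp [Polynomial.aeval_def, Polynomial.eval₂_eq_eval_map]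
    · intro i _ hi
      simp [hlow i hi]
    · simp
  · obtain ⟨ρ, hρ⟩ := IsAlgClosed.exists_aeval_eq_zero_of_injective Ω
      (FaithfulSMul.algebraMap_injective (Polynomial k) Ω) ((tangentFamily f).coeff d)
      (fun h => h0 (Polynomial.natDegree_eq_zero_iff_degree_le_zero.2 h.le))
    apply hf.map_tangentFamily_ne_zero Ω hd hL ρ
    ext i
    rw [Polynomial.coeff_map, Polynomial.coeff_zero, RingHom.coe_coe,
      Polynomial.aevalAeval_algebraMap_X]
    by_cases hi : i = d
    · rw [hi, hρ]
    · rw [hlow i hi, map_zero]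

theorem IsSmoothSurface.exists_resultant_ne_zero [IsAlgClosed Ω] (hd : 3 ≤ d)
    (hf : IsSmoothSurface f d) (hL : ∀ z w : k, eval ![0, 0, z, w] f = 0)
    {E : Polynomial (Polynomial k)} (hE : E ≠ 0) :
    ∃ s : k, Polynomial.resultant E ((tangentFamily f).eval (Polynomial.C (Polynomial.C s)))
      E.natDegree (d - 1) ≠ 0 := by
  by_contra! H
  have h1 := fun s : k => Polynomial.exists_root_of_resultant_eq_zero (Ω := Ω) E _ (d - 1) hE
    (Polynomial.natDegree_eval_C_C_le (fun j => (natDegree_coeff_tangentFamily_le hL j).1)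
      (tangentFamily_natDegree_le hf.2.1) (Polynomial.C s)) (H s)
  choose ρ h2 h3 using h1
  have hinj := FaithfulSMul.algebraMap_injective (Polynomial k) Ω
  have hE' : E.map (algebraMap (Polynomial k) Ω) ≠ 0 := (Polynomial.map_ne_zero_iff hinj).2 hE
  have hfin : (Set.range ρ).Finite := by
    refine (E.rootSet_finite Ω).subset ?_
    rintro _ ⟨s, rfl⟩
    exact (Polynomial.mem_rootSet'.2 ⟨hE', h2 s⟩)
  have := hfin.to_subtype
  obtain ⟨⟨ρ₀, hρ₀⟩, hinf⟩ := Finite.exists_infinite_fiber (Set.rangeFactorization ρ)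
  apply hf.map_tangentFamily_ne_zero Ω hd hL ρ₀
  apply Polynomial.eq_zero_of_infinite_isRoot
  refine ((Set.infinite_coe_iff.1 hinf).image (algebraMap k Ω).injective.injOn).mono ?_
  rintro _ ⟨s, hs, rfl⟩
  have hs' : ρ s = ρ₀ := congrArg Subtype.val hs
  have h4 := h3 s
  rw [hs', ← Polynomial.aevalAeval_algebraMap_X, ← RingHom.coe_coe,
    ← Polynomial.eval₂_at_apply] at h4
  rw [Set.mem_ofPred_eq, Polynomial.IsRoot.def, Polynomial.eval_map, ← h4]
  simp

end Generic

theorem aeval_linear_eq_aeval_homogenize {k R A σ : Type*} [CommRing k] [CommRing R] [CommRing A]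
    [Algebra k R] [Algebra k A] [Algebra R A] [IsScalarTower k R A] {f : MvPolynomial σ k} {d : ℕ}
    (hf : f.IsHomogeneous d) (a b : σ → R) (u v : A) :
    aeval (fun i => algebraMap R A (a i) * u + algebraMap R A (b i) * v) f =
      aeval ![v, u] ((aeval (fun i => Polynomial.C (a i) + Polynomial.C (b i) * Polynomial.X)
        f : Polynomial R).homogenize d) := by
  let x : σ → Polynomial R × A := fun i =>
    (Polynomial.C (a i) + Polynomial.C (b i) * Polynomial.X,
      algebraMap R A (a i) * u + algebraMap R A (b i) * v)
  have h := aeval_induction_of_isHomogeneous (A := Polynomial R × A)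
    (P := fun n z => z.1.natDegree ≤ n ∧ z.2 = aeval ![v, u] (z.1.homogenize n))
    (by simp)
    (by
      intro a
      simp [Polynomial.algebraMap_apply, ← IsScalarTower.algebraMap_apply])
    (by
      rintro n x y ⟨hx, hx'⟩ ⟨hy, hy'⟩
      exact ⟨(Polynomial.natDegree_add_le _ _).trans (max_le hx hy), by simp [hx', hy']⟩)
    (by
      rintro m n x y ⟨hx, hx'⟩ ⟨hy, hy'⟩
      exact ⟨Polynomial.natDegree_mul_le.trans (add_le_add hx hy), by
        simp [hx', hy', Polynomial.homogenize_mul _ _ hx hy]⟩)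
    hf (x := x) (fun i => ⟨by simp only [x]; compute_degree, by
      simp [x, Polynomial.homogenize_C_mul, Polynomial.homogenize_X]⟩)
  have h1 := comp_aeval_apply x (AlgHom.fst k (Polynomial R) A) f
  have h2 := comp_aeval_apply x (AlgHom.snd k (Polynomial R) A) f
  simp only [AlgHom.fst_apply, AlgHom.snd_apply, x] at h1 h2 h
  rw [← h1, ← h2, h.2]

/-- If the tangent planes generically meet the surface along the line with multiplicity at least
`n`, where the degree is `n + 1`, then projection of the planes from another point gives further
degree bounds. -/
theorem weightLE_of_tangentFamily_eq {k : Type*} [Field k] {f : MvPolynomial (Fin 4) k} {n : ℕ}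
    (hn : 1 ≤ n) (hf : f.IsHomogeneous (n + 1)) {E F : Polynomial (Polynomial k)}
    (h : tangentFamily f =
      Polynomial.C E * Polynomial.X ^ n + Polynomial.C F * Polynomial.X ^ (n + 1)) :
    ∃ Φ : Polynomial (Polynomial (Polynomial k)), Polynomial.WeightLE n (n - 1) (n + 1) Φ ∧
      Φ.coeff n = E.comp (Polynomial.C Polynomial.X * Polynomial.X) ∧
      Φ.coeff (n + 1) = F.comp (Polynomial.C Polynomial.X * Polynomial.X) -
        Polynomial.X * E.comp (Polynomial.C Polynomial.X * Polynomial.X) := by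
  let a : Fin 4 → Polynomial (Polynomial k) := ![0, 0, Polynomial.C Polynomial.X, 1]
  let b : Fin 4 → Polynomial (Polynomial k) := ![Polynomial.C (linePartial f 1),
    -Polynomial.C (linePartial f 0), Polynomial.C Polynomial.X * Polynomial.X, 0]
  have h1 := aeval_linear_eq_aeval_homogenize (A := Polynomial (Polynomial (Polynomial k))) hf a b
    (1 - Polynomial.C Polynomial.X * Polynomial.X) Polynomial.X
  have hσ : ∀ P : Polynomial (Polynomial k), Polynomial.aevalAeval (R := k)
      (Polynomial.C Polynomial.X : Polynomial (Polynomial k))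
      (Polynomial.C Polynomial.X * Polynomial.X) P =
        P.comp (Polynomial.C Polynomial.X * Polynomial.X) :=
    Polynomial.aevalAeval_algebraMap_X (Ω := Polynomial (Polynomial k)) _
  have h2 : (aeval (fun i => Polynomial.C (a i) + Polynomial.C (b i) * Polynomial.X) f :
      Polynomial (Polynomial (Polynomial k))) = (tangentFamily f).map
        (Polynomial.aevalAeval (R := k) (Polynomial.C Polynomial.X : Polynomial (Polynomial k))
          (Polynomial.C Polynomial.X * Polynomial.X) : _ →+* Polynomial (Polynomial k)) := by
    rw [map_tangentFamily]
    congr 2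
    funext i
    have hC : ∀ p : Polynomial k, Polynomial.aeval
        (Polynomial.C Polynomial.X : Polynomial (Polynomial k)) p = Polynomial.C p := by
      intro p
      exact (Polynomial.aeval_algebraMap_apply (Polynomial (Polynomial k)) Polynomial.X p).trans
        (by simp)
    fin_cases i <;> simp [a, b, hC]
    ring
  rw [h2, h] at h1
  simp only [Polynomial.map_add, Polynomial.map_mul, Polynomial.map_C, Polynomial.map_pow,
    Polynomial.map_X, RingHom.coe_coe, hσ, Polynomial.homogenize_add,
    Polynomial.homogenize_C_mul, Polynomial.homogenize_X_pow (Nat.le_succ n),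
    Polynomial.homogenize_X_pow le_rfl] at h1
  let x : Fin 4 → Polynomial (Polynomial (Polynomial k)) :=
    ![Polynomial.C (Polynomial.C (linePartial f 1)) * Polynomial.X,
      -(Polynomial.C (Polynomial.C (linePartial f 0)) * Polynomial.X),
      Polynomial.C (Polynomial.C Polynomial.X),
      1 + -(Polynomial.C (Polynomial.X : Polynomial (Polynomial k)) * Polynomial.X)]
  refine ⟨aeval x f, Polynomial.WeightLE.aeval hf ?_, ?_⟩
  · obtain ⟨e, rfl⟩ := Nat.exists_eq_add_of_le' hn
    have h := fun i => (linePartial_natDegree_le hf i).1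
    intro i
    fin_cases i
    exacts [.C_C_mul_X (h 1), (Polynomial.WeightLE.C_C_mul_X (h 0)).neg, .C_C_X,
      Polynomial.WeightLE.one.add (Polynomial.WeightLE.C_X_mul_X (k := k)).neg]
  · have h3 : aeval x f =
        Polynomial.C (E.comp (Polynomial.C Polynomial.X * Polynomial.X)) * Polynomial.X ^ n +
        Polynomial.C (F.comp (Polynomial.C Polynomial.X * Polynomial.X) -
        Polynomial.X * E.comp (Polynomial.C Polynomial.X * Polynomial.X)) *
          Polynomial.X ^ (n + 1) := by
      refine Eq.trans ?_ (h1.trans ?_)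
      · congr 2
        funext i
        fin_cases i <;> simp [a, b, x]
        all_goals ring
      · simp
        ring
    rw [h3]
    simp only [Polynomial.coeff_add, Polynomial.coeff_C_mul_X_pow]
    simp

namespace Polynomial

theorem natDegree_coeff_add_le_of_comp_C_X_mul_X {k : Type*} [Field k] {κ b : ℕ} {P Q : k[X][X]}
    (h : P.comp (C X * X) = Q)
    (hQ : ∀ l, Q.coeff l ≠ 0 → (Q.coeff l).natDegree + κ * l ≤ b) (l : ℕ)
    (hl : P.coeff l ≠ 0) : (P.coeff l).natDegree + (κ + 1) * l ≤ b := by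
  have h1 : Q.coeff l = P.coeff l * X ^ l := by rw [← h, comp_C_mul_X_coeff]
  have h2 := hQ l (by rw [h1]; exact mul_ne_zero hl (pow_ne_zero _ X_ne_zero))
  rw [h1, natDegree_mul_X_pow _ hl] at h2
  lia

theorem natDegree_resultant_le_of_coeff {k : Type*} [Field k] {n : ℕ} {E F Q : k[X][X]}
    (hE : E.natDegree + 1 ≤ n)
    (hE' : ∀ l, (E.comp (C X * X)).coeff l ≠ 0 →
      ((E.comp (C X * X)).coeff l).natDegree + n * l ≤ n ^ 2 + 1)
    (hQ : Q = F.comp (C X * X) - X * E.comp (C X * X))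
    (hQ' : ∀ l, Q.coeff l ≠ 0 → (Q.coeff l).natDegree + n * l ≤ n ^ 2 + n) (s : k) :
    (resultant E (C (C s ^ n) * E + C (C s ^ (n + 1)) * F) E.natDegree n).natDegree ≤
      n * (n ^ 2 + 1) := by
  set m := E.natDegree with hm
  set R := resultant E (C (C s ^ n) * E + C (C s ^ (n + 1)) * F) m n with hR
  by_cases hR0 : R = 0
  · simp [hR0]
  let H := C X * F - X * E
  let H' := C (C s ^ (n + 1)) * H
  have h1 : X ^ m * R = resultant E H' m n := by
    rw [hR, ← resultant_C_mul_right, ← resultant_add_mul_right E H'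
      (C (C s ^ n * X) + C (C s ^ (n + 1)) * X) m n ?_ hm.ge]
    · congr 1
      simp only [H', H, C_mul]
      ring
    · refine le_trans (Nat.add_le_add_right (m := 1) ?_ _) (by lia)
      compute_degree
  have hHQ : H.comp (C X * X) = C X * Q := by
    simp only [H, hQ, sub_comp, mul_comp, C_comp, X_comp]
    ring
  have hH : ∀ l, H'.coeff l ≠ 0 → (H'.coeff l).natDegree + (n + 1) * l ≤ n ^ 2 + n + 1 := by
    intro l hl
    have h2 : H'.coeff l = C (s ^ (n + 1)) * H.coeff l := by
      rw [C_pow]; exact coeff_C_mul H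
    rw [h2] at hl ⊢
    refine (Nat.add_le_add_right (natDegree_C_mul_le _ _) _).trans ?_
    refine natDegree_coeff_add_le_of_comp_C_X_mul_X hHQ (fun i hi => ?_) l
      (right_ne_zero_of_mul hl)
    rw [coeff_C_mul] at hi ⊢
    rw [natDegree_X_mul (right_ne_zero_of_mul hi)]
    have := hQ' i (right_ne_zero_of_mul hi)
    lia
  have h3 := natDegree_resultant_le E H' m n _ _ (n + 1)
    (natDegree_coeff_add_le_of_comp_C_X_mul_X rfl hE') hH
  rw [← h1, natDegree_X_pow_mul _ hR0] at h3
  have h4 : m * (n ^ 2 + n + 1) + n * (n ^ 2 + 1) - (n + 1) * (m * n) =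
      m + n * (n ^ 2 + 1) := by
    rw [Nat.sub_eq_iff_eq_add (by nlinarith)]
    ring
  lia

end Polynomial

theorem IsSmoothSurface.card_le_of_map_tangentFamily_eq_zero {k : Type*} [Field k]
    [IsAlgClosed k] {f : MvPolynomial (Fin 4) k} {d : ℕ} (hd : 3 ≤ d) (hf : IsSmoothSurface f d)
    (hL : ∀ z w : k, eval ![0, 0, z, w] f = 0) {t : k} {S : Finset k}
    (hS : ∀ c ∈ S, (tangentFamily f).map (Polynomial.aevalAeval (R := k) t c : _ →+* k) = 0) :
    S.card ≤ d - 1 := by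
  by_contra! hcard
  apply hf.not_forall_eval_eq_pow hd hL t 0
  intro c r
  rw [zero_mul, ← eval_map_tangentFamily]
  have h1 : (tangentFamily f).map (Polynomial.aevalAeval (R := k) t c : _ →+* k) = 0 := by
    ext j
    rw [Polynomial.coeff_map, Polynomial.coeff_zero, RingHom.coe_coe,
      Polynomial.coe_aevalAeval_eq_evalEval, ← Polynomial.map_evalRingHom_eval]
    by_cases hj : d < j
    · rw [Polynomial.coeff_eq_zero_of_natDegree_lt
        ((tangentFamily_natDegree_le hf.2.1).trans_lt hj)]
      simp
    · have h2 : ((tangentFamily f).coeff j).map (Polynomial.evalRingHom t) = 0 := by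
        refine Polynomial.eq_zero_of_natDegree_lt_card_of_eval_eq_zero' _ S (fun c' hc' => ?_) ?_
        · have h2 := congrArg (Polynomial.coeff · j) (hS c' hc')
          simp only [Polynomial.coeff_map, Polynomial.coeff_zero, RingHom.coe_coe,
            Polynomial.coe_aevalAeval_eq_evalEval] at h2
          rw [Polynomial.map_evalRingHom_eval, h2]
        · have h2 := (natDegree_coeff_tangentFamily_le hL j).1
          refine (Polynomial.natDegree_map_le.trans h2).trans_lt ?_
          lia
      rw [h2, Polynomial.eval_zero]
  rw [h1, Polynomial.eval_zero]

theorem IsSmoothSurface.exists_eliminant {k : Type*} [Field k] [IsAlgClosed k]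
    {f : MvPolynomial (Fin 4) k} {d : ℕ} (hd : 3 ≤ d) (hf : IsSmoothSurface f d)
    (hL : ∀ z w : k, eval ![0, 0, z, w] f = 0) :
    ∃ R : Polynomial k, R ≠ 0 ∧ R.natDegree ≤ (d - 1) * ((d - 1) ^ 2 + 1) ∧
      ∀ (t : k) (S : Finset k),
        (∀ c ∈ S, (tangentFamily f).map (Polynomial.aevalAeval (R := k) t c : _ →+* k) = 0) →
          (Polynomial.X - Polynomial.C t) ^ S.card ∣ R := by
  let Ω := AlgebraicClosure (FractionRing (Polynomial k))
  have : FaithfulSMul (Polynomial k) Ω :=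
    FaithfulSMul.trans (Polynomial k) (FractionRing (Polynomial k)) Ω
  have hΦ : tangentFamily f ≠ 0 := by
    intro h
    exact hf.map_tangentFamily_ne_zero Ω hd hL 0 (by rw [h, Polynomial.map_zero])
  have hdeg := tangentFamily_natDegree_le hf.2.1
  have hcoeff := fun j => (natDegree_coeff_tangentFamily_le hL j).1
  set j := (tangentFamily f).natTrailingDegree with hj
  have hjd : j < d := hf.natTrailingDegree_tangentFamily_lt Ω hd hL hΦ
  have hE : (tangentFamily f).coeff j ≠ 0 := Polynomial.trailingCoeff_nonzero_iff_nonzero.2 hΦ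
  have hj0 : j ≠ 0 := by
    intro h
    rw [h] at hE
    exact hE (natDegree_coeff_tangentFamily_le hL 0).2
  have hEdeg := hcoeff j
  set E := (tangentFamily f).coeff j with hEdef
  obtain ⟨s, hs⟩ := hf.exists_resultant_ne_zero Ω hd hL hE
  have hw := weightLE_tangentFamily (by lia : 2 ≤ d) hf.2.1
  refine ⟨_, hs, ?_, fun t S hS => Polynomial.pow_card_dvd_resultant _ _ le_rfl
    (Polynomial.natDegree_eval_C_C_le hcoeff hdeg _) t S ?_ fun c hc => ⟨?_, ?_⟩⟩
  · obtain ⟨n, rfl⟩ := Nat.exists_eq_add_of_le' (by lia : 1 ≤ d)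
    simp only [Nat.add_sub_cancel] at hs ⊢
    by_cases hjn : j = n
    · rw [hjn] at hEdef hEdeg
      set F := (tangentFamily f).coeff (n + 1) with hF
      have hΦeq : tangentFamily f =
          Polynomial.C E * Polynomial.X ^ n + Polynomial.C F * Polynomial.X ^ (n + 1) := by
        ext1 i
        rw [Polynomial.coeff_add, Polynomial.coeff_C_mul_X_pow, Polynomial.coeff_C_mul_X_pow]
        rcases lt_trichotomy i n with hi | rfl | hi
        · rw [Polynomial.coeff_eq_zero_of_lt_natTrailingDegree (by lia), if_neg (by lia),
            if_neg (by lia), add_zero]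
        · simp [hEdef]
        · by_cases hi' : i = n + 1
          · subst hi'; simp [hF]
          · rw [Polynomial.coeff_eq_zero_of_natDegree_lt (by lia), if_neg (by lia),
              if_neg (by lia), add_zero]
      obtain ⟨Φ, hΦw, hΦ₁, hΦ₂⟩ := weightLE_of_tangentFamily_eq (by lia) hf.2.1 hΦeq
      have h1 : (tangentFamily f).eval (Polynomial.C (Polynomial.C s)) =
          Polynomial.C (Polynomial.C s ^ n) * E + Polynomial.C (Polynomial.C s ^ (n + 1)) * F := by
        rw [hΦeq]
        simp [mul_comm]
      rw [h1]
      obtain ⟨q, rfl⟩ := Nat.exists_eq_add_of_le' (by lia : 1 ≤ n)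
      simp only [Nat.add_sub_cancel] at hΦw
      refine Polynomial.natDegree_resultant_le_of_coeff (by lia) (fun l hl => ?_) hΦ₂
        (fun l hl => (hΦw.natDegree_coeff_le hl).trans (by nlinarith)) s
      rw [← hΦ₁] at hl ⊢
      exact (hΦw.natDegree_coeff_le hl).trans (by nlinarith)
    · obtain ⟨q, rfl⟩ := Nat.exists_eq_add_of_le' (by lia : 1 ≤ n)
      simp only [Nat.add_sub_cancel] at hw
      refine (Polynomial.natDegree_resultant_le _ _ _ _ (q + 1 + 1 + q * j)
        (q + 1 + 1 + q * (q + 1 + 1)) (q + 1) (fun l hl => hw.natDegree_coeff_le hl)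
        (fun l hl => hw.eval hdeg s hl)).trans ?_
      generalize E.natDegree = m at hEdeg
      have h1 : q * j ≤ q * q := Nat.mul_le_mul_left q (by lia)
      have h2 : m + q * j + 1 ≤ q + q * q := by lia
      have h3 := Nat.mul_le_mul_left (q + 1) h2
      rw [Nat.sub_le_iff_le_add]
      nlinarith
  · exact (hf.card_le_of_map_tangentFamily_eq_zero hd hL hS).trans (Nat.le_add_left _ _)
  · have h1 := congrArg (Polynomial.coeff · j) (hS c hc)
    simp only [Polynomial.coeff_map, Polynomial.coeff_zero, RingHom.coe_coe,
      Polynomial.coe_aevalAeval_eq_evalEval] at h1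
    exact h1
  · have h1 := congrArg (Polynomial.eval s) (hS c hc)
    have h2 := Polynomial.eval₂_at_apply (p := tangentFamily f)
      (Polynomial.aevalAeval (R := k) t c : _ →+* k) (Polynomial.C (Polynomial.C s))
    rw [← Polynomial.eval_map] at h2
    simp only [RingHom.coe_coe, Polynomial.coe_aevalAeval_eq_evalEval, Polynomial.evalEval_C,
      Polynomial.eval_C] at h2
    rw [h1, Polynomial.eval_zero] at h2
    exact h2.symm

theorem Polynomial.card_le_natDegree_of_pow_dvd {k : Type*} [Field k] {R : Polynomial k}
    (hR : R ≠ 0) (Z : Finset (k × k))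
    (h : ∀ (t : k) (S : Finset k), (∀ c ∈ S, (t, c) ∈ Z) →
      (Polynomial.X - Polynomial.C t) ^ S.card ∣ R) : Z.card ≤ R.natDegree := by
  classical
  rw [Finset.card_eq_sum_card_image Prod.fst Z]
  have h1 : ∀ t, (Z.filter fun z => z.1 = t).card ≤ R.roots.count t := by
    intro t
    rw [Polynomial.count_roots, Polynomial.le_rootMultiplicity_iff hR]
    have h2 : ((Z.filter fun z => z.1 = t).image Prod.snd).card =
        (Z.filter fun z => z.1 = t).card := by
      refine Finset.card_image_of_injOn fun a ha b hb hab => Prod.ext ?_ hab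
      simp only [Finset.coe_filter, Set.mem_ofPred_eq] at ha hb
      rw [ha.2, hb.2]
    rw [← h2]
    refine h t _ fun c hc => ?_
    simp only [Finset.mem_image, Finset.mem_filter] at hc
    obtain ⟨⟨t', c'⟩, ⟨hz, rfl⟩, rfl⟩ := hc
    exact hz
  calc _ ≤ ∑ t ∈ Z.image Prod.fst, R.roots.count t := Finset.sum_le_sum fun t _ => h1 t
    _ ≤ ∑ t ∈ R.roots.toFinset, R.roots.count t := by
      refine Finset.sum_le_sum_of_ne_zero fun t _ ht => ?_
      rw [Multiset.mem_toFinset]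
      exact Multiset.count_ne_zero.1 ht
    _ = R.roots.card := Multiset.toFinset_sum_count_eq _
    _ ≤ R.natDegree := Polynomial.card_roots' R

theorem sum_eval_pderiv_mul_eq_zero_of_forall_eval {k σ : Type*} [Field k] [Infinite k]
    [Fintype σ] {f : MvPolynomial σ k} {p v : σ → k}
    (h : ∀ r : k, eval (fun i => p i + r * v i) f = 0) :
    ∑ i, eval p (pderiv i f) * v i = 0 := by
  let P : σ → Polynomial k := fun i => Polynomial.C (p i) + Polynomial.C (v i) * Polynomial.X
  have hP : ∀ (r : k) (g : MvPolynomial σ k),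
      (aeval P g).eval r = eval (fun i => p i + r * v i) g := by
    intro r g
    rw [← Polynomial.coe_aeval_eq_eval, comp_aeval_apply, ← aeval_eq_eval]
    congr 2
    funext i
    simp [P, mul_comm r]
  have h1 : aeval P f = 0 := Polynomial.funext fun r => by rw [hP, h, Polynomial.eval_zero]
  have h2 := derivation_aeval_eq_sum (Polynomial.derivative' (R := k)) P f
  rw [h1, map_zero] at h2
  have h3 := congrArg (Polynomial.eval 0) h2
  rw [Polynomial.eval_finsetSum] at h3
  refine Eq.trans (Finset.sum_congr rfl fun i _ => ?_) (h3.symm.trans Polynomial.eval_zero)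
  rw [Polynomial.eval_mul, hP]
  congr 1
  · simp
  · simp [P]

/-- Lines on the surface meeting the line `x = y = 0`, but not at `(0, 0, 1, 0)`, are spanned by
a point `(0, 0, t, 1)` and a tangent vector there. -/
theorem IsSmoothSurface.exists_line_eq_span {k : Type*} [Field k] [IsAlgClosed k]
    {f : MvPolynomial (Fin 4) k} {d : ℕ} (hf : IsSmoothSurface f d)
    (hL : ∀ z w : k, eval ![0, 0, z, w] f = 0) {M : Submodule k (Fin 4 → k)}
    (hM : IsLineOn f M) (hM' : ∃ z w : k, ![0, 0, z, w] ∈ M ∧ ![0, 0, z, w] ≠ 0)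
    (h2 : ![0, 0, 1, 0] ∉ M) :
    ∃ t c : k, M = Submodule.span k {![0, 0, t, 1],
      ![(linePartial f 1).eval t, -(linePartial f 0).eval t, c, 0]} ∧
      (tangentFamily f).map (Polynomial.aevalAeval (R := k) t c : _ →+* k) = 0 := by
  have h2' : ∀ z : k, ![0, 0, z, 0] ∈ M → z = 0 := by
    intro z hz
    by_contra h0
    apply h2
    convert M.smul_mem z⁻¹ hz using 1
    funext i
    fin_cases i <;> simp [h0]
  obtain ⟨z, w, hzw, hzw0⟩ := hM'
  have hw : w ≠ 0 := by
    rintro rfl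
    exact hzw0 (by rw [h2' z hzw]; funext i; fin_cases i <;> rfl)
  have hp : ![0, 0, z / w, 1] ∈ M := by
    convert M.smul_mem w⁻¹ hzw using 1
    funext i
    fin_cases i <;> simp [hw]
    field_simp
  set t := z / w
  have hp0 : ![0, 0, t, 1] ≠ 0 := fun h => by simpa using congrFun h 3
  set A₀ := (linePartial f 0).eval t with hA
  set B₀ := (linePartial f 1).eval t with hB
  have : Nontrivial M := Module.nontrivial_of_finrank_pos (R := k) (by rw [hM.1]; norm_num)
  obtain ⟨⟨u, hu⟩, hpu⟩ := exists_linearIndependent_pair_of_one_lt_finrank (R := k) (M := M)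
    (by rw [hM.1]; norm_num) (x := ⟨_, hp⟩) (fun h => hp0 (congrArg Subtype.val h))
  rw [LinearIndependent.pair_iff] at hpu
  have hv : ![u 0, u 1, u 2 - u 3 * t, 0] ∈ M := by
    convert M.sub_mem hu (M.smul_mem (u 3) hp) using 1
    funext i
    fin_cases i <;> simp
  have htan : A₀ * u 0 + B₀ * u 1 = 0 := by
    have h3 := sum_eval_pderiv_mul_eq_zero_of_forall_eval (f := f) (p := ![0, 0, t, 1])
      (v := ![u 0, u 1, u 2 - u 3 * t, 0]) fun r => hM.2 _ (M.add_mem hp (M.smul_mem r hv))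
    have h4 := aeval_pderiv_line_eq_zero hL t (1 : k)
    rw [aeval_eq_eval] at h4
    rw [Fin.sum_univ_four, ← eval_linePartial, ← eval_linePartial] at h3
    simpa [h4.1, h4.2] using h3
  have hu01 : ¬ (u 0 = 0 ∧ u 1 = 0) := by
    rintro ⟨h0, h1⟩
    rw [h0, h1] at hv
    have h3 := h2' _ hv
    have h4 := hpu (u 3) (-1) (by
      ext i
      fin_cases i <;> simp [h0, h1]
      linear_combination -h3)
    simp at h4
  have hAB : ¬ (A₀ = 0 ∧ B₀ = 0) := hf.linePartial_eval_ne_zero hL t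
  obtain ⟨a, ha0, ha, hb⟩ : ∃ a, a ≠ 0 ∧ B₀ = a * u 0 ∧ -A₀ = a * u 1 := by
    by_cases h0 : u 0 = 0
    · have h1 : u 1 ≠ 0 := fun h => hu01 ⟨h0, h⟩
      have hB0 : B₀ = 0 := by simpa [h0, h1] using htan
      refine ⟨-A₀ / u 1, div_ne_zero (neg_ne_zero.2 fun h => hAB ⟨h, hB0⟩) h1, ?_, ?_⟩
      · rw [h0, hB0, mul_zero]
      · field_simp
    · refine ⟨B₀ / u 0, div_ne_zero (fun h => hAB ⟨?_, h⟩) h0, ?_, ?_⟩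
      · simpa [h, h0] using htan
      · field_simp
      · field_simp
        linear_combination -htan
  have hq : ![B₀, -A₀, a * (u 2 - u 3 * t), 0] ∈ M := by
    convert M.smul_mem a hv using 1
    funext i
    fin_cases i <;> simp [ha, hb]
  refine ⟨t, a * (u 2 - u 3 * t), ?_, ?_⟩
  · rw [← hA, ← hB]
    symm
    apply Submodule.eq_of_le_of_finrank_eq
    · rw [Submodule.span_le]
      rintro x (rfl | rfl)
      exacts [hp, hq]
    · rw [hM.1]
      have hli : LinearIndependent k ![![0, 0, t, 1], ![B₀, -A₀, a * (u 2 - u 3 * t), 0]] := by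
        rw [LinearIndependent.pair_iff]
        intro x y hxy
        have h3 : x = 0 := by simpa using congrFun hxy 3
        refine ⟨h3, ?_⟩
        by_contra hy
        apply hAB
        have h4 := congrFun hxy 0
        have h5 := congrFun hxy 1
        constructor
        · simpa [hy] using h5
        · simpa [hy] using h4
      have h3 := finrank_span_eq_card hli
      rw [Matrix.range_cons, Matrix.range_cons, Matrix.range_empty, Set.union_empty,
        Set.singleton_union, Fintype.card_fin] at h3
      exact h3
  · apply Polynomial.funext
    intro r
    rw [eval_map_tangentFamily, Polynomial.eval_zero, ← hA, ← hB]
    convert hM.2 _ (M.add_mem hp (M.smul_mem r hq)) using 2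
    congr 1
    funext i
    fin_cases i <;> simp
    all_goals ring

theorem IsSmoothSurface.card_lines_le {k : Type*} [Field k] [IsAlgClosed k]
    {f : MvPolynomial (Fin 4) k} {d : ℕ} (hd : 3 ≤ d) (hf : IsSmoothSurface f d)
    (hL : ∀ z w : k, eval ![0, 0, z, w] f = 0) (T : Finset (Submodule k (Fin 4 → k)))
    (hT : ∀ M ∈ T, IsLineOn f M ∧ (∃ z w : k, ![0, 0, z, w] ∈ M ∧ ![0, 0, z, w] ≠ 0) ∧
      ![0, 0, 1, 0] ∉ M) : T.card ≤ (d - 1) * ((d - 1) ^ 2 + 1) := by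
  classical
  obtain ⟨R, hR, hdeg, hdvd⟩ := hf.exists_eliminant hd hL
  have h := fun M : T => hf.exists_line_eq_span hL (hT M M.2).1 (hT M M.2).2.1 (hT M M.2).2.2
  choose t c hM hz using h
  have hinj : Function.Injective fun M : T => (t M, c M) := by
    intro M N hMN
    simp only [Prod.mk.injEq] at hMN
    exact Subtype.ext (by rw [hM M, hM N, hMN.1, hMN.2])
  refine le_trans ?_ ((Polynomial.card_le_natDegree_of_pow_dvd hR
    (Finset.univ.image fun M : T => (t M, c M)) fun s S hS => hdvd s S fun c' hc' => ?_).trans hdeg)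
  · rw [Finset.card_image_of_injective _ hinj, Finset.card_univ, Fintype.card_coe]
  · obtain ⟨M, -, hMc⟩ := Finset.mem_image.1 (hS c' hc')
    simp only [Prod.mk.injEq] at hMc
    rw [← hMc.1, ← hMc.2]
    exact hz M

/-- Smooth surfaces can be pulled back along linear changes of coordinates. -/
theorem IsSmoothSurface.exists_comp_linearEquiv {k : Type*} [Field k] [Infinite k]
    {f : MvPolynomial (Fin 4) k} {d : ℕ} (hf : IsSmoothSurface f d)
    (e : (Fin 4 → k) ≃ₗ[k] (Fin 4 → k)) :
    ∃ g : MvPolynomial (Fin 4) k, IsSmoothSurface g d ∧ ∀ v, eval v g = eval (e v) f := by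
  let δ : Fin 4 → Fin 4 → k := fun a j => if a = j then 1 else 0
  have he : ∀ v i, e v i = ∑ a, v a * e (δ a) i := by
    intro v i
    have h := congrFun ((e : (Fin 4 → k) →ₗ[k] (Fin 4 → k)).pi_apply_eq_sum_univ v) i
    simpa [Finset.sum_apply] using h
  let x : Fin 4 → MvPolynomial (Fin 4) k := fun i => ∑ a, C (e (δ a) i) * X a
  have hx : ∀ v i, eval v (x i) = e v i := by
    intro v i
    rw [he, map_sum]
    simp [mul_comm]
  have heval : ∀ v h, eval v (aeval x h) = eval (e v) h := by
    intro v h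
    rw [← aeval_eq_eval, comp_aeval_apply, ← aeval_eq_eval]
    congr 2
    funext i
    rw [aeval_eq_eval, hx]
  refine ⟨aeval x f, ⟨?_, ?_, ?_⟩, fun v => heval v f⟩
  · intro h
    apply hf.1
    apply MvPolynomial.funext
    intro v
    rw [map_zero, ← e.apply_symm_apply v, ← heval, h, map_zero]
  · have := hf.2.1.aeval (n := 1) x fun i => IsHomogeneous.sum _ _ _ fun a _ => by
      simpa using (isHomogeneous_C _ (e (δ a) i)).mul (isHomogeneous_X k a)
    simpa using this
  · rintro v hv ⟨h0, h1⟩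
    have h2 : ∀ u, ∑ i, eval (e v) (pderiv i f) * e u i = 0 := by
      intro u
      have h3 : ∀ a, ∑ i, eval (e v) (pderiv i f) * e (δ a) i = 0 := by
        intro a
        rw [← h1 a, derivation_aeval_eq_sum, map_sum]
        refine Finset.sum_congr rfl fun i _ => ?_
        rw [map_mul, heval]
        simp [x, pderiv_X, Pi.single_apply]
      simp only [he u, Finset.mul_sum]
      rw [Finset.sum_comm]
      refine Finset.sum_eq_zero fun a _ => ?_
      rw [← mul_zero (u a), ← h3 a, Finset.mul_sum]
      exact Finset.sum_congr rfl fun i _ => by ring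
    refine hf.2.2 (e v) (by simpa using hv) ⟨by rw [← heval, h0], fun i => ?_⟩
    have h3 := h2 (e.symm (Pi.single i 1))
    simpa [Pi.single_apply] using h3

theorem exists_linearEquiv_of_finrank_eq_two {k : Type*} [Field k]
    {L : Submodule k (Fin 4 → k)} (hL : Module.finrank k L = 2) {u : Fin 4 → k} (hu : u ∈ L)
    (hu0 : u ≠ 0) : ∃ e : (Fin 4 → k) ≃ₗ[k] (Fin 4 → k), e ![0, 0, 1, 0] = u ∧
      ∀ v, v ∈ L ↔ ∃ z w, v = e ![0, 0, z, w] := by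
  obtain ⟨⟨u', hu'⟩, hli⟩ := exists_linearIndependent_pair_of_one_lt_finrank (R := k) (M := L)
    (by rw [hL]; norm_num) (x := ⟨u, hu⟩) (fun h => hu0 (congrArg Subtype.val h))
  have hli' : LinearIndependent k ![u, u'] := by
    rw [LinearIndependent.pair_iff] at hli ⊢
    exact fun s t h => hli s t (Subtype.ext h)
  obtain ⟨b, hb⟩ := exists_linearIndependent_cons_of_lt_finrank hli'
    (by rw [Module.finrank_fin_fun]; norm_num)
  obtain ⟨a, ha⟩ := exists_linearIndependent_cons_of_lt_finrank hb
    (by rw [Module.finrank_fin_fun]; norm_num)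
  let B := basisOfLinearIndependentOfCardEqFinrank ha (by simp)
  have hB : ∀ z w : k, B.equivFun.symm ![0, 0, z, w] = z • u + w • u' := by
    intro z w
    rw [Module.Basis.equivFun_symm_apply, Fin.sum_univ_four]
    simp [B]
  refine ⟨B.equivFun.symm, by rw [hB]; simp, fun v => ?_⟩
  simp only [hB]
  have hspan : Submodule.span k {u, u'} = L := by
    apply Submodule.eq_of_le_of_finrank_eq
    · rw [Submodule.span_le]
      rintro x (rfl | rfl)
      exacts [hu, hu']
    · have h3 := finrank_span_eq_card hli'
      rw [Matrix.range_cons, Matrix.range_cons, Matrix.range_empty, Set.union_empty,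
        Set.singleton_union, Fintype.card_fin] at h3
      rw [h3, hL]
  rw [← hspan, Submodule.mem_span_pair]
  simp only [eq_comm]

theorem exists_mem_forall_notMem_of_finrank_eq_two {k V : Type*} [Field k] [Infinite k]
    [AddCommGroup V] [Module k V] {L : Submodule k V} (hL : Module.finrank k L = 2)
    (T : Finset (Submodule k V)) (hT : ∀ M ∈ T, Module.finrank k M = 2 ∧ M ≠ L) :
    ∃ u ∈ L, u ≠ 0 ∧ ∀ M ∈ T, u ∉ M := by
  classical
  have hfin : Module.Finite k L := Module.finite_of_finrank_pos (by rw [hL]; norm_num)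
  have h := Subspace.biUnion_ne_univ_of_top_notMem (k := k) (E := L)
    (s := insert ⊥ (T.image fun M => M.comap L.subtype)) (by
      intro h
      rcases Finset.mem_insert.1 h with h | h
      · have := Module.nontrivial_of_finrank_pos (R := k) (M := L) (by rw [hL]; norm_num)
        exact bot_ne_top h.symm
      · obtain ⟨M, hM, hM'⟩ := Finset.mem_image.1 h
        obtain ⟨h2, h3⟩ := hT M hM
        have : Module.Finite k M := Module.finite_of_finrank_pos (by rw [h2]; norm_num)
        apply h3
        rw [Submodule.comap_subtype_eq_top] at hM'
        exact (Submodule.eq_of_le_of_finrank_eq hM' (by rw [hL, h2])).symm)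
  rw [Set.ne_univ_iff_exists_notMem] at h
  obtain ⟨⟨u, hu⟩, h⟩ := h
  simp only [Set.mem_iUnion, not_exists] at h
  refine ⟨u, hu, ?_, ?_⟩
  · rintro rfl
    exact h ⊥ (by simp) (by simp)
  · intro M hM hMu
    exact h (M.comap L.subtype) (by simpa using Or.inr ⟨M, hM, rfl⟩) hMu

theorem lines_meeting_a_line_bound {k : Type*} [Field k] [IsAlgClosed k] (d : ℕ) (hd : 3 ≤ d)
    (f : MvPolynomial (Fin 4) k) (hf : IsSmoothSurface f d)
    (L : Submodule k (Fin 4 → k)) (hL : IsLineOn f L) :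
    {M : Submodule k (Fin 4 → k) | IsLineOn f M ∧ M ≠ L ∧ M ⊓ L ≠ ⊥}.Finite ∧
      {M : Submodule k (Fin 4 → k) | IsLineOn f M ∧ M ≠ L ∧ M ⊓ L ≠ ⊥}.ncard ≤
        d ^ 3 - 3 * d ^ 2 + 4 * d - 2 := by
  classical
  have hbound : (d - 1) * ((d - 1) ^ 2 + 1) = d ^ 3 - 3 * d ^ 2 + 4 * d - 2 := by
    obtain ⟨q, rfl⟩ := Nat.exists_eq_add_of_le' hd
    have h1 : (q + 3) ^ 3 - 3 * (q + 3) ^ 2 = q * (q + 3) ^ 2 := by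
      rw [Nat.sub_eq_iff_eq_add (by nlinarith [sq_nonneg (q + 3)])]; ring
    rw [h1]
    have h2 : q + 3 - 1 = q + 2 := rfl
    rw [h2]
    symm
    rw [Nat.sub_eq_iff_eq_add (by lia)]
    ring
  rw [← hbound]
  have key : ∀ T : Finset (Submodule k (Fin 4 → k)),
      (∀ M ∈ T, IsLineOn f M ∧ M ≠ L ∧ M ⊓ L ≠ ⊥) → T.card ≤ (d - 1) * ((d - 1) ^ 2 + 1) := by
    intro T hT
    obtain ⟨u, hu, hu0, huT⟩ := exists_mem_forall_notMem_of_finrank_eq_two hL.1 T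
      fun M hM => ⟨(hT M hM).1.1, (hT M hM).2.1⟩
    obtain ⟨e, he, heL⟩ := exists_linearEquiv_of_finrank_eq_two hL.1 hu hu0
    obtain ⟨g, hg, hgf⟩ := hf.exists_comp_linearEquiv e
    have hinj : Function.Injective
        (Submodule.comap (e : (Fin 4 → k) →ₗ[k] (Fin 4 → k))) :=
      Submodule.comap_injective_of_surjective e.surjective
    rw [← Finset.card_image_of_injective T hinj]
    refine hg.card_lines_le hd (fun z w => ?_) _ fun M hM => ?_
    · rw [hgf]
      exact hL.2 _ ((heL _).2 ⟨z, w, rfl⟩)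
    · obtain ⟨M, hMT, rfl⟩ := Finset.mem_image.1 hM
      obtain ⟨hM1, hM2, hM3⟩ := hT M hMT
      refine ⟨⟨?_, fun v hv => ?_⟩, ?_, ?_⟩
      · rw [← hM1.1]
        exact (LinearEquiv.ofSubmodule' e M).finrank_eq
      · rw [hgf]
        exact hM1.2 _ hv
      · obtain ⟨v, hv, hv0⟩ := Submodule.exists_mem_ne_zero_of_ne_bot hM3
        obtain ⟨z, w, rfl⟩ := (heL v).1 hv.2
        exact ⟨z, w, hv.1, fun h => hv0 (by rw [h, map_zero])⟩
      · rw [Submodule.mem_comap]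
        exact fun h => huT M hMT (he ▸ h)
  have hfin : {M : Submodule k (Fin 4 → k) | IsLineOn f M ∧ M ≠ L ∧ M ⊓ L ≠ ⊥}.Finite := by
    by_contra hinf
    obtain ⟨T, hT, hcard⟩ := Set.Infinite.exists_subset_card_eq hinf
      ((d - 1) * ((d - 1) ^ 2 + 1) + 1)
    have := key T fun M hM => hT hM
    lia
  refine ⟨hfin, ?_⟩
  rw [Set.ncard_eq_toFinset_card _ hfin]
  exact key _ fun M hM => by simpa using hM
end

section
/- Let k be an algebraically closed field and let S = V(f) ⊆ P³ be a smooth surface of degree d ≥ 3 containing a line L. Then the set of lines on S distinct from L that meet L has cardinality exactly d³−3d²+4d−2 if and only if the set of planes containing L and containing at least one line on S other than L has cardinality exactly d²−2d+2 and each such plane contains exactly d distinct lines on S. -/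
open MvPolynomial

section
variable {k : Type*} [Field k]

open Polynomial in
lemma coeff_pow_expChar_pow (p : ℕ) [ExpChar k p] (e : ℕ) (T : Polynomial k) (n : ℕ) :
    (T ^ p ^ e).coeff n = if p ^ e ∣ n then T.coeff (n / p ^ e) ^ p ^ e else 0 := by
  rw [← Polynomial.map_iterateFrobenius_expand p, Polynomial.coeff_map,
    Polynomial.coeff_expand (expChar_pow_pos k p e)]
  split_ifs
  · rw [iterateFrobenius_def]
  · simp

lemma hasseDeriv_pow_expChar_pow_self [Infinite k] (p : ℕ) [ExpChar k p] (e : ℕ)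
    (T : Polynomial k) :
    Polynomial.hasseDeriv (p ^ e) (T ^ p ^ e) = T.derivative ^ p ^ e := by
  refine Polynomial.funext fun z ↦ ?_
  rw [← Polynomial.taylor_coeff, Polynomial.taylor_pow, coeff_pow_expChar_pow,
    if_pos dvd_rfl, Nat.div_self (expChar_pow_pos k p e), Polynomial.taylor_coeff_one,
    Polynomial.eval_pow]

lemma hasseDeriv_pow_expChar_pow_of_lt [Infinite k] (p : ℕ) [ExpChar k p] (e : ℕ)
    (T : Polynomial k) {s : ℕ} (hs : 0 < s) (hs' : s < p ^ e) :
    Polynomial.hasseDeriv s (T ^ p ^ e) = 0 := by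
  refine Polynomial.funext fun z ↦ ?_
  rw [← Polynomial.taylor_coeff, Polynomial.taylor_pow, coeff_pow_expChar_pow,
    if_neg (Nat.not_dvd_of_pos_of_lt hs hs'), Polynomial.eval_zero]

lemma prime_of_derivative_eq_zero (p : ℕ) [ExpChar k p] {A : Polynomial k}
    (hA : A.derivative = 0) (hA' : A.natDegree ≠ 0) : p.Prime := by
  rcases expChar_is_prime_or_one k p with h | rfl
  · exact h
  · have := charZero_of_expChar_one' k
    exact absurd (Polynomial.derivative_eq_zero.1 hA) hA'

lemma exists_eq_pow_of_derivative_eq_zero (p : ℕ) [ExpChar k p] [PerfectRing k p]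
    {A : Polynomial k} (hA : A.derivative = 0) : ∃ A₁ : Polynomial k, A = A₁ ^ p := by
  refine ⟨(Polynomial.contract p A).map (frobeniusEquiv k p).symm.toRingHom, ?_⟩
  rw [← Polynomial.map_frobenius_expand, ← Polynomial.map_expand, Polynomial.expand_contract' p hA,
    Polynomial.map_map]
  ext n
  simp

/-- Coprime polynomials, not both constant, are `p ^ e`-th powers of polynomials with nonzero
Wronskian, where `p` is the characteristic exponent. -/
lemma exists_eq_pow_wronskian_ne_zero (p : ℕ) [ExpChar k p] [PerfectRing k p]
    (A B : Polynomial k) (hAB : IsCoprime A B) (hdeg : max A.natDegree B.natDegree ≠ 0) :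
    ∃ (e : ℕ) (A₁ B₁ : Polynomial k), A = A₁ ^ p ^ e ∧ B = B₁ ^ p ^ e ∧
      A₁.wronskian B₁ ≠ 0 := by
  induction h : max A.natDegree B.natDegree using Nat.strong_induction_on generalizing A B with
  | _ n ih =>
  subst h
  by_cases hW : A.wronskian B = 0
  · obtain ⟨hA, hB⟩ := hAB.wronskian_eq_zero_iff.1 hW
    have hp : p.Prime := by
      by_cases h : A.natDegree = 0
      · exact prime_of_derivative_eq_zero p hB (by omega)
      · exact prime_of_derivative_eq_zero p hA h
    obtain ⟨A', rfl⟩ := exists_eq_pow_of_derivative_eq_zero p hA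
    obtain ⟨B', rfl⟩ := exists_eq_pow_of_derivative_eq_zero p hB
    have h2 := hp.two_le
    simp only [Polynomial.natDegree_pow] at *
    have hmax : max (p * A'.natDegree) (p * B'.natDegree) = p * max A'.natDegree B'.natDegree :=
      (Nat.mul_max_mul_left ..)
    have hne : max A'.natDegree B'.natDegree ≠ 0 := by
      intro h0
      rw [hmax, h0] at hdeg
      exact hdeg rfl
    obtain ⟨e, A₁, B₁, h⟩ := ih (max A'.natDegree B'.natDegree)
      (by rw [hmax]; nlinarith [Nat.pos_of_ne_zero hne])
      A' B' ((IsCoprime.pow_iff hp.pos hp.pos).1 hAB) hne rfl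
    refine ⟨e + 1, A₁, B₁, ?_, ?_, h.2.2⟩
    · rw [pow_succ, pow_mul, ← h.1]
    · rw [pow_succ, pow_mul, ← h.2.1]
  · exact ⟨0, A, B, by simp, by simp, hW⟩

lemma natDegree_wronskian_le {A B : Polynomial k} {m : ℕ} (hA : A.natDegree ≤ m)
    (hB : B.natDegree ≤ m) : (A.wronskian B).natDegree ≤ 2 * m - 2 := by
  rcases Nat.eq_zero_or_pos m with rfl | hm
  · rw [Nat.le_zero] at hA hB
    rw [Polynomial.eq_C_of_natDegree_eq_zero hA, Polynomial.eq_C_of_natDegree_eq_zero hB]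
    simp [Polynomial.wronskian]
  obtain ⟨m, rfl⟩ : ∃ n, m = n + 1 := ⟨m - 1, by omega⟩
  have hA' : A.derivative.natDegree ≤ m := (Polynomial.natDegree_derivative_le A).trans (by omega)
  have hB' : B.derivative.natDegree ≤ m := (Polynomial.natDegree_derivative_le B).trans (by omega)
  have h1 : (A.wronskian B).natDegree ≤ 2 * m + 1 := by
    rw [Polynomial.wronskian]
    refine (Polynomial.natDegree_sub_le_of_le (Polynomial.natDegree_mul_le_of_le hA hB')
      (Polynomial.natDegree_mul_le_of_le hA' hB)).trans (by omega)
  have h2 : (A.wronskian B).coeff (2 * m + 1) = 0 := by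
    rw [Polynomial.wronskian, Polynomial.coeff_sub, show 2 * m + 1 = (m + 1) + m by omega,
      Polynomial.coeff_mul_add_eq_of_natDegree_le hA hB', add_comm (m + 1) m,
      Polynomial.coeff_mul_add_eq_of_natDegree_le hA' hB, Polynomial.coeff_derivative,
      Polynomial.coeff_derivative]
    ring
  have h3 : (A.wronskian B).natDegree ≠ 2 * m + 1 := by
    intro h
    rw [← h, Polynomial.coeff_natDegree, Polynomial.leadingCoeff_eq_zero] at h2
    simp [h2] at h
  omega

lemma eq_zero_of_sum_mul_pow_mul_pow_eq_zero {A B : Polynomial k} (hAB : IsCoprime A B)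
    (J : ℕ) (C : ℕ → Polynomial k) (hC : ∀ i ≤ J, (C i).natDegree < A.natDegree)
    (h : ∑ i ∈ Finset.range (J + 1), C i * B ^ i * A ^ (J - i) = 0) :
    ∀ i ≤ J, C i = 0 := by
  have hA : A ≠ 0 := by
    rintro rfl
    simpa using hC 0 (by omega)
  induction J with
  | zero =>
    intro i hi
    obtain rfl : i = 0 := by omega
    simpa using h
  | succ J ih =>
    have hsum : ∑ i ∈ Finset.range (J + 1), C i * B ^ i * A ^ (J + 1 - i) =
        A * ∑ i ∈ Finset.range (J + 1), C i * B ^ i * A ^ (J - i) := by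
      rw [Finset.mul_sum]
      refine Finset.sum_congr rfl fun i hi ↦ ?_
      rw [Nat.succ_sub (by simpa [Nat.lt_succ_iff] using hi), pow_succ]
      ring
    rw [Finset.sum_range_succ, hsum, Nat.sub_self, pow_zero, mul_one] at h
    have hdvd : A ∣ C (J + 1) * B ^ (J + 1) :=
      ⟨-∑ i ∈ Finset.range (J + 1), C i * B ^ i * A ^ (J - i), by linear_combination h⟩
    have h0 : C (J + 1) = 0 := Polynomial.eq_zero_of_dvd_of_natDegree_lt
      (hAB.pow_right.dvd_of_dvd_mul_right hdvd) (hC _ le_rfl)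
    rw [h0, zero_mul, add_zero] at h
    intro i hi
    rcases Nat.lt_or_ge J i with h' | h'
    · obtain rfl : i = J + 1 := by omega
      exact h0
    · exact ih (fun i hi ↦ hC i (by omega)) ((mul_eq_zero.1 h).resolve_left hA) i h'

lemma eq_zero_of_sum_antidiagonal_eq_zero {A B : Polynomial k} (hAB : IsCoprime A B)
    (J : ℕ) (C : ℕ → ℕ → Polynomial k)
    (hC : ∀ a b, a + b = J → (C a b).natDegree < max A.natDegree B.natDegree)
    (h : ∑ x ∈ Finset.HasAntidiagonal.antidiagonal J, C x.1 x.2 * B ^ x.1 * A ^ x.2 = 0) :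
    ∀ a b, a + b = J → C a b = 0 := by
  intro a b hab
  rcases le_total B.natDegree A.natDegree with hle | hle
  · rw [max_eq_left hle] at hC
    rw [Finset.Nat.sum_antidiagonal_eq_sum_range_succ (fun i j ↦ C i j * B ^ i * A ^ j)] at h
    have := eq_zero_of_sum_mul_pow_mul_pow_eq_zero hAB J (fun i ↦ C i (J - i))
      (fun i hi ↦ hC _ _ (by omega)) h a (by omega)
    rwa [show J - a = b by omega] at this
  · rw [max_eq_right hle] at hC
    rw [← Finset.Nat.sum_antidiagonal_swap] at h
    simp only [Prod.fst_swap, Prod.snd_swap] at h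
    rw [Finset.Nat.sum_antidiagonal_eq_sum_range_succ (fun i j ↦ C j i * B ^ j * A ^ i)] at h
    have := eq_zero_of_sum_mul_pow_mul_pow_eq_zero hAB.symm J (fun i ↦ C (J - i) i)
      (fun i hi ↦ hC _ _ (by omega))
      (by rw [← h]; exact Finset.sum_congr rfl fun i _ ↦ by ring) b (by omega)
    rwa [show J - b = a by omega] at this
end

section
open Finset.HasAntidiagonal (antidiagonal)
variable {K : Type*} [Field K]

/-- For a surface `∑ P a b(z) x^a y^b = 0` containing the line `x = y = 0`, the coefficient of
`(u r)^s u^i` in the restriction of its equation to the tangent line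
`u ↦ (u P₀₁(z), -u P₁₀(z), z + u r)`. -/
noncomputable def tangentCoeff (P : ℕ → ℕ → Polynomial K) (i s : ℕ) : Polynomial K :=
  ∑ x ∈ antidiagonal i, Polynomial.hasseDeriv s (P x.1 x.2) * P 0 1 ^ x.1 * (-P 1 0) ^ x.2

/-- The coefficient of `u^l` in the restriction of `∑ P a b(z) x^a y^b` to the tangent line
`u ↦ (u P₀₁(z), -u P₁₀(z), z + u r)`. -/
noncomputable def tangentLineCoeff (P : ℕ → ℕ → Polynomial K) (l : ℕ) (z r : K) : K :=
  ∑ x ∈ antidiagonal l, (tangentCoeff P x.1 x.2).eval z * r ^ x.2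

/-- The parameters `(z, r)` of the tangent lines `u ↦ (u P₀₁(z), -u P₁₀(z), z + u r)` lying on the
surface `∑ P a b(z) x^a y^b = 0` of degree `d`. -/
def tangentLineSet (P : ℕ → ℕ → Polynomial K) (d : ℕ) : Set (K × K) :=
  {x | ∀ l ≤ d, tangentLineCoeff P l x.1 x.2 = 0}

lemma tangentCoeff_zero_left {P : ℕ → ℕ → Polynomial K} (h0 : P 0 0 = 0) (s : ℕ) :
    tangentCoeff P 0 s = 0 := by
  simp [tangentCoeff, h0]

lemma tangentCoeff_one_left (P : ℕ → ℕ → Polynomial K) (s : ℕ) :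
    tangentCoeff P 1 s = Polynomial.hasseDeriv s (P 1 0) * P 0 1 -
      Polynomial.hasseDeriv s (P 0 1) * P 1 0 := by
  simp [tangentCoeff, Finset.Nat.antidiagonal_succ]
  ring

lemma tangentCoeff_eq_zero {P : ℕ → ℕ → Polynomial K} {i : ℕ}
    (h : ∀ a b, a + b = i → P a b = 0) (s : ℕ) : tangentCoeff P i s = 0 :=
  Finset.sum_eq_zero fun x hx ↦ by
    rw [h x.1 x.2 (Finset.HasAntidiagonal.mem_antidiagonal.1 hx)]
    simp

lemma natDegree_tangentCoeff_le {P : ℕ → ℕ → Polynomial K} {d : ℕ}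
    (hP : ∀ a b, (P a b).natDegree ≤ d - (a + b)) {i s : ℕ} (his : i + s ≤ d) :
    (tangentCoeff P i s).natDegree ≤ d - (i + s) + i * (d - 1) := by
  refine Polynomial.natDegree_sum_le_of_forall_le _ _ fun x hx ↦ ?_
  have hx := Finset.HasAntidiagonal.mem_antidiagonal.1 hx
  have h1 : (Polynomial.hasseDeriv s (P x.1 x.2)).natDegree ≤ d - (i + s) := by
    refine (Polynomial.natDegree_hasseDeriv_le _ _).trans ?_
    have := hP x.1 x.2
    omega
  have hA : (-P 1 0).natDegree ≤ d - 1 := by simpa using hP 1 0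
  have hB : (P 0 1).natDegree ≤ d - 1 := by simpa using hP 0 1
  have h2 := Polynomial.natDegree_mul_le_of_le (Polynomial.natDegree_mul_le_of_le h1
    (Polynomial.natDegree_pow_le_of_le x.1 hB)) (Polynomial.natDegree_pow_le_of_le x.2 hA)
  refine h2.trans (le_of_eq ?_)
  rw [← hx]
  ring

lemma card_fiber_tangentLineSet_le [Infinite K] {P : ℕ → ℕ → Polynomial K} (h0 : P 0 0 = 0)
    {d : ℕ} (hfin : (tangentLineSet P d).Finite) (z : K) (s : Finset K)
    (hs : ∀ r ∈ s, (z, r) ∈ tangentLineSet P d) : s.card ≤ d - 1 := by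
  classical
  let G : ℕ → Polynomial K := fun l ↦
    ∑ x ∈ antidiagonal l, Polynomial.C ((tangentCoeff P x.1 x.2).eval z) * Polynomial.X ^ x.2
  have hG : ∀ l r, (G l).eval r = tangentLineCoeff P l z r := fun l r ↦ by
    simp [G, tangentLineCoeff, Polynomial.eval_finsetSum]
  obtain ⟨l, hl, hne⟩ : ∃ l ≤ d, G l ≠ 0 := by
    by_contra! h
    refine Set.infinite_univ (α := K) ((hfin.preimage (f := fun r ↦ (z, r))
      (Prod.mk_right_injective z).injOn).subset fun r _ l hl ↦ ?_)
    rw [← hG, h l hl, Polynomial.eval_zero]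
  have hdeg : (G l).natDegree ≤ d - 1 := by
    refine Polynomial.natDegree_sum_le_of_forall_le _ _ fun x hx ↦ ?_
    have hx := Finset.HasAntidiagonal.mem_antidiagonal.1 hx
    rcases Nat.eq_zero_or_pos x.1 with h | h
    · rw [h, tangentCoeff_zero_left h0]
      simp
    · exact (Polynomial.natDegree_C_mul_X_pow_le _ _).trans (by omega)
  refine (Finset.card_le_card fun r hr ↦ ?_).trans
    ((Multiset.toFinset_card_le _).trans ((Polynomial.card_roots' _).trans hdeg))
  rw [Multiset.mem_toFinset, Polynomial.mem_roots hne, Polynomial.IsRoot, hG]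
  exact hs r hr l hl

lemma Polynomial.sum_rootMultiplicity_le {R : Polynomial K} (s : Finset K) :
    ∑ z ∈ s, R.rootMultiplicity z ≤ R.natDegree := by
  classical
  refine le_trans ?_ (Polynomial.card_roots' R)
  rw [← Multiset.sum_count_eq_card (s := s ∪ R.roots.toFinset) (m := R.roots) (fun a ha ↦ by
    simp [Multiset.mem_toFinset.2 ha] )]
  simp only [Polynomial.count_roots]
  exact Finset.sum_le_sum_of_subset Finset.subset_union_left

lemma tangentLineCoeff_add_one [Infinite K] {P : ℕ → ℕ → Polynomial K} (h0 : P 0 0 = 0) {q : ℕ}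
    (hq : 0 < q) (hP : ∀ a b, 2 ≤ a + b → a + b ≤ q → P a b = 0) (z r : K) :
    tangentLineCoeff P (q + 1) z r =
      (tangentCoeff P (q + 1) 0).eval z + (tangentCoeff P 1 q).eval z * r ^ q := by
  rw [tangentLineCoeff, Finset.sum_eq_add (q + 1, 0) (1, q) (by simp; omega)]
  · simp
  · rintro ⟨i, s⟩ hx hne
    have hx := Finset.HasAntidiagonal.mem_antidiagonal.1 hx
    simp only [ne_eq, Prod.mk.injEq, not_and] at hne hx
    rcases Nat.eq_zero_or_pos i with rfl | hi
    · simp [tangentCoeff_zero_left h0]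
    · rw [tangentCoeff_eq_zero fun a b hab ↦ hP a b (by omega) (by omega)]
      simp
  · intro h
    exact absurd (Finset.HasAntidiagonal.mem_antidiagonal.2 (by simp)) h
  · intro h
    exact absurd (Finset.HasAntidiagonal.mem_antidiagonal.2 (by simp [add_comm])) h

lemma tangentLineCoeff_of_le {P : ℕ → ℕ → Polynomial K} (h0 : P 0 0 = 0) {q : ℕ}
    (hA : ∀ s < q, tangentCoeff P 1 s = 0) {l : ℕ} (hl : l ≤ q)
    (hP : ∀ a b, 2 ≤ a + b → a + b < l → P a b = 0) (z r : K) :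
    tangentLineCoeff P l z r = if l = 0 then 0 else (tangentCoeff P l 0).eval z := by
  split_ifs with h
  · subst h
    simp [tangentLineCoeff, tangentCoeff_zero_left h0]
  rw [tangentLineCoeff, Finset.sum_eq_single (l, 0)]
  · simp
  · rintro ⟨i, s⟩ hx hne
    have hx := Finset.HasAntidiagonal.mem_antidiagonal.1 hx
    simp only [ne_eq, Prod.mk.injEq, not_and] at hne hx
    rcases Nat.eq_zero_or_pos i with rfl | hi
    · simp [tangentCoeff_zero_left h0]
    rcases Nat.eq_or_lt_of_le hi with rfl | hi
    · simp [hA s (by omega)]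
    · rw [tangentCoeff_eq_zero fun a b hab ↦ hP a b (by omega) (by omega)]
      simp
  · intro h
    exact absurd (Finset.HasAntidiagonal.mem_antidiagonal.2 (by simp)) h

end

section
open Finset.HasAntidiagonal (antidiagonal)
variable {K : Type*} [Field K]

lemma infinite_tangentLineSet [Infinite K] {P : ℕ → ℕ → Polynomial K} {d : ℕ} {W : Polynomial K}
    (hW : W ≠ 0) (h : ∀ z, W.eval z ≠ 0 → ∃ r, (z, r) ∈ tangentLineSet P d) :
    (tangentLineSet P d).Infinite := by
  classical
  intro hfin
  refine Set.infinite_univ (α := K)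
    (((hfin.image Prod.fst).union W.roots.toFinset.finite_toSet).subset fun z _ ↦ ?_)
  by_cases hz : W.eval z = 0
  · right
    simp [hW, hz]
  · left
    obtain ⟨r, hr⟩ := h z hz
    exact ⟨_, hr, rfl⟩

/-- The norm of the `l`-th coefficient of the equation on tangent lines, under the relation
`W r ^ q + Q = 0`, where `W = tangentCoeff P 1 q` and `Q = tangentCoeff P (q + 1) 0`. -/
noncomputable def tangentResultant (P : ℕ → ℕ → Polynomial K) (d q l : ℕ) : Polynomial K :=
  ∑ x ∈ antidiagonal l, tangentCoeff P x.1 x.2 ^ q * (-tangentCoeff P (q + 1) 0) ^ x.2 *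
    tangentCoeff P 1 q ^ (d - 1 - x.2)

lemma natDegree_tangentResultant_le {P : ℕ → ℕ → Polynomial K} (h0 : P 0 0 = 0) {d q l : ℕ}
    (hP : ∀ a b, (P a b).natDegree ≤ d - (a + b)) (hq0 : 0 < q) (hq : q < d)
    (hl : l ≤ d) (hW : (tangentCoeff P 1 q).natDegree ≤ 2 * (d - 1) - 2 * q) :
    (tangentResultant P d q l).natDegree ≤ (q + 2) * (d - 1) ^ 2 := by
  refine Polynomial.natDegree_sum_le_of_forall_le _ _ fun x hx ↦ ?_
  have hx := Finset.HasAntidiagonal.mem_antidiagonal.1 hx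
  rcases Nat.eq_zero_or_pos x.1 with h | h
  · rw [h, tangentCoeff_zero_left h0, zero_pow hq0.ne']
    simp
  have h1 := natDegree_tangentCoeff_le hP (i := x.1) (s := x.2) (by omega)
  have h2 : (-tangentCoeff P (q + 1) 0).natDegree ≤ d - (q + 1) + (q + 1) * (d - 1) := by
    simpa using natDegree_tangentCoeff_le hP (i := q + 1) (s := 0) (by omega)
  refine (Polynomial.natDegree_mul_le_of_le (Polynomial.natDegree_mul_le_of_le
    (Polynomial.natDegree_pow_le_of_le q h1) (Polynomial.natDegree_pow_le_of_le x.2 h2))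
    (Polynomial.natDegree_pow_le_of_le (d - 1 - x.2) hW)).trans ?_
  obtain ⟨i, s⟩ := x
  simp only at *
  obtain ⟨m, rfl⟩ : ∃ m, d = m + l := ⟨d - l, by omega⟩
  obtain ⟨i, rfl⟩ : ∃ j, i = j + 1 := ⟨i - 1, by omega⟩
  subst hx
  obtain ⟨t, ht⟩ : ∃ t, m + i + s = q + t := ⟨m + i + s - q, by omega⟩
  have e1 : m + (i + 1 + s) - 1 = q + t := by omega
  have e2 : m + (i + 1 + s) - (i + 1 + s) = m := by omega
  have e3 : m + (i + 1 + s) - (q + 1) = t := by omega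
  have e4 : m + (i + 1 + s) - 1 - s = m + i := by omega
  rw [e4, e1, e2, e3, show 2 * (q + t) - 2 * q = 2 * t by omega]
  zify at *
  have hmi : (m : ℤ) + i = q + t - s := by linarith
  have hi : (i : ℤ) = q + t - s - m := by linarith
  rw [hmi, hi]
  have : (0 : ℤ) ≤ m := by positivity
  have hs : (0 : ℤ) ≤ q + t - s := by linarith [(by positivity : (0 : ℤ) ≤ i)]
  have hqt : (0 : ℤ) ≤ q * m * (q + t - 1) := by
    have : (0 : ℤ) ≤ (q : ℤ) + t - 1 := by
      have : (1 : ℤ) ≤ q := by exact_mod_cast hq0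
      linarith [(by positivity : (0 : ℤ) ≤ t)]
    positivity
  have hqs : (0 : ℤ) ≤ q * (q + t - s) := by positivity
  linear_combination hqt + hqs

lemma eval_tangentResultant (p e : ℕ) [ExpChar K p] {P : ℕ → ℕ → Polynomial K} (h0 : P 0 0 = 0)
    {d l : ℕ} (hl : l ≤ d) {z r : K}
    (hr : (tangentCoeff P (p ^ e + 1) 0).eval z + (tangentCoeff P 1 (p ^ e)).eval z * r ^ p ^ e =
      0) :
    (tangentResultant P d (p ^ e) l).eval z =
      (tangentCoeff P 1 (p ^ e)).eval z ^ (d - 1) * tangentLineCoeff P l z r ^ p ^ e := by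
  rw [tangentLineCoeff, ← iterateFrobenius_def, map_sum, Finset.mul_sum, tangentResultant,
    Polynomial.eval_finsetSum]
  refine Finset.sum_congr rfl fun x hx ↦ ?_
  have hx := Finset.HasAntidiagonal.mem_antidiagonal.1 hx
  simp only [iterateFrobenius_def, Polynomial.eval_mul, Polynomial.eval_pow, Polynomial.eval_neg]
  rcases Nat.eq_zero_or_pos x.1 with h | h
  · rw [h, tangentCoeff_zero_left h0]
    simp [zero_pow (expChar_pow_pos K p e).ne']
  · rw [neg_eq_of_add_eq_zero_right hr, show d - 1 = x.2 + (d - 1 - x.2) by omega,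
      Nat.add_sub_cancel_left]
    ring

lemma pow_dvd_tangentResultant {P : ℕ → ℕ → Polynomial K} (h0 : P 0 0 = 0) {d q l : ℕ}
    (hq : 0 < q) (hl : l ≤ d) {T : Polynomial K} (hQ : T ∣ tangentCoeff P (q + 1) 0)
    (hW : T ∣ tangentCoeff P 1 q) : T ^ (d - 1) ∣ tangentResultant P d q l := by
  refine Finset.dvd_sum fun x hx ↦ ?_
  have hx := Finset.HasAntidiagonal.mem_antidiagonal.1 hx
  rcases Nat.eq_zero_or_pos x.1 with h | h
  · rw [h, tangentCoeff_zero_left h0, zero_pow hq.ne']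
    simp
  · rw [show d - 1 = x.2 + (d - 1 - x.2) by omega, Nat.add_sub_cancel_left, mul_assoc, pow_add]
    exact Dvd.dvd.mul_left (mul_dvd_mul (pow_dvd_pow_of_dvd (hQ.neg_right) _)
      (pow_dvd_pow_of_dvd hW _)) _

/-- If the second contact of the tangent lines is governed by the Gauss map, then few tangent lines
lie on the surface. -/
lemma ncard_tangentLineSet_le [IsAlgClosed K] (p e : ℕ) [ExpChar K p]
    {P : ℕ → ℕ → Polynomial K} (h0 : P 0 0 = 0) {d : ℕ}
    (hP : ∀ a b, (P a b).natDegree ≤ d - (a + b)) (hq : p ^ e < d)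
    (hfin : (tangentLineSet P d).Finite)
    (hP2 : ∀ a b, 2 ≤ a + b → a + b ≤ p ^ e → P a b = 0)
    (hW0 : tangentCoeff P 1 (p ^ e) ≠ 0)
    (hW : (tangentCoeff P 1 (p ^ e)).natDegree ≤ 2 * (d - 1) - 2 * p ^ e) :
    (tangentLineSet P d).ncard ≤ (p ^ e + 2) * (d - 1) ^ 2 := by
  classical
  have hinf : Infinite K := IsAlgClosed.instInfinite
  have hqpos := expChar_pow_pos K p e
  have hrel : ∀ z r, (z, r) ∈ tangentLineSet P d →
      (tangentCoeff P (p ^ e + 1) 0).eval z +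
        (tangentCoeff P 1 (p ^ e)).eval z * r ^ p ^ e = 0 := fun z r h ↦ by
    rw [← tangentLineCoeff_add_one h0 hqpos hP2]
    exact h _ hq
  obtain ⟨l, hl, hR⟩ : ∃ l ≤ d, tangentResultant P d (p ^ e) l ≠ 0 := by
    by_contra! h
    refine infinite_tangentLineSet hW0 (fun z hz ↦ ?_) hfin
    obtain ⟨r, hr⟩ := IsAlgClosed.exists_pow_nat_eq
      (-(tangentCoeff P (p ^ e + 1) 0).eval z / (tangentCoeff P 1 (p ^ e)).eval z) hqpos
    refine ⟨r, fun l hl ↦ ?_⟩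
    have := eval_tangentResultant p e h0 hl (z := z) (r := r) (by rw [hr]; field_simp; ring)
    rw [h l hl, Polynomial.eval_zero] at this
    exact eq_zero_of_pow_eq_zero
      ((mul_eq_zero.1 this.symm).resolve_left (pow_ne_zero _ hz))
  refine le_trans ?_ (natDegree_tangentResultant_le h0 hP hqpos hq hl hW)
  rw [Set.ncard_eq_toFinset_card _ hfin, Finset.card_eq_sum_card_image Prod.fst]
  refine (Finset.sum_le_sum fun z hz ↦ ?_).trans (Polynomial.sum_rootMultiplicity_le _)
  obtain ⟨⟨z', r⟩, hzr, hz'⟩ := Finset.mem_image.1 hz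
  obtain rfl : z' = z := hz'
  rw [Set.Finite.mem_toFinset] at hzr
  have hcard : (hfin.toFinset.filter fun x ↦ x.1 = z').card =
      ((hfin.toFinset.filter fun x ↦ x.1 = z').image Prod.snd).card := by
    refine (Finset.card_image_of_injOn ?_).symm
    rintro ⟨a, b⟩ h ⟨a', b'⟩ h' heq
    simp only [Finset.coe_filter, Set.mem_ofPred_eq] at h h' heq
    rw [Prod.mk.injEq]
    exact ⟨h.2.trans h'.2.symm, heq⟩
  rw [hcard]
  have hmem : ∀ r ∈ (hfin.toFinset.filter fun x ↦ x.1 = z').image Prod.snd,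
      (z', r) ∈ tangentLineSet P d := by
    intro r hr
    obtain ⟨⟨a, b⟩, h, rfl⟩ := Finset.mem_image.1 hr
    obtain ⟨h2, rfl : a = z'⟩ := Finset.mem_filter.1 h
    exact hfin.mem_toFinset.1 h2
  by_cases hz : (tangentCoeff P 1 (p ^ e)).eval z' = 0
  · refine (card_fiber_tangentLineSet_le h0 hfin z' _ hmem).trans ?_
    rw [Polynomial.le_rootMultiplicity_iff hR]
    have := hrel _ _ hzr
    rw [hz, zero_mul, add_zero] at this
    exact pow_dvd_tangentResultant h0 hqpos hl (Polynomial.dvd_iff_isRoot.2 this)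
      (Polynomial.dvd_iff_isRoot.2 hz)
  · refine le_trans (Finset.card_le_one.2 fun r₁ h₁ r₂ h₂ ↦ ?_)
      (Nat.one_le_iff_ne_zero.2 ((Polynomial.rootMultiplicity_pos hR).2 ?_).ne')
    · have h := (hrel _ _ (hmem _ h₁)).trans (hrel _ _ (hmem _ h₂)).symm
      exact iterateFrobenius_inj K p e (mul_left_cancel₀ hz (add_left_cancel h))
    · rw [Polynomial.IsRoot, eval_tangentResultant p e h0 hl (hrel _ _ hzr), hzr l hl,
        zero_pow hqpos.ne', mul_zero]

/-- The number of lines on the surface `∑ P a b(z) x^a y^b = 0` of degree `d` that meet the line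
`x = y = 0` away from infinity is too small, unless these lines meet it in few points. -/
theorem ncard_tangentLineSet_lt_or_ncard_image_fst_le [IsAlgClosed K]
    {P : ℕ → ℕ → Polynomial K} (h0 : P 0 0 = 0) {d : ℕ} (hd : 4 ≤ d)
    (hP : ∀ a b, (P a b).natDegree ≤ d - (a + b)) (hcop : IsCoprime (P 1 0) (P 0 1))
    (hdeg : max (P 1 0).natDegree (P 0 1).natDegree = d - 1)
    (hfin : (tangentLineSet P d).Finite) :
    (tangentLineSet P d).ncard < (d - 1) * ((d - 1) ^ 2 + 1) ∨
      (Prod.fst '' tangentLineSet P d).ncard ≤ (d - 1) ^ 2 + 1 := by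
  classical
  have hinf : Infinite K := IsAlgClosed.instInfinite
  obtain ⟨p, hp⟩ := ExpChar.exists K
  obtain ⟨e, A, B, hA, hB, hAB⟩ := exists_eq_pow_wronskian_ne_zero p _ _ hcop (by omega)
  have hqpos := expChar_pow_pos K p e
  set m := max A.natDegree B.natDegree with hm
  have hqm : p ^ e * m = d - 1 := by
    rw [← hdeg, hA, hB, Polynomial.natDegree_pow, Polynomial.natDegree_pow, Nat.mul_max_mul_left]
  have hm0 : 0 < m := Nat.pos_of_ne_zero fun h ↦ by rw [h] at hqm; omega
  have hT : tangentCoeff P 1 (p ^ e) = (-A.wronskian B) ^ p ^ e := by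
    rw [tangentCoeff_one_left, hA, hB, hasseDeriv_pow_expChar_pow_self,
      hasseDeriv_pow_expChar_pow_self, ← mul_pow, ← mul_pow, ← sub_pow_expChar_pow,
      Polynomial.wronskian]
    congr 1
    ring
  have hT0 : tangentCoeff P 1 (p ^ e) ≠ 0 := by
    rw [hT]
    exact pow_ne_zero _ (neg_ne_zero.2 hAB)
  have hlow : ∀ s < p ^ e, tangentCoeff P 1 s = 0 := fun s hs ↦ by
    rw [tangentCoeff_one_left]
    rcases Nat.eq_zero_or_pos s with rfl | hs0
    · simp [mul_comm]
    · rw [hA, hB, hasseDeriv_pow_expChar_pow_of_lt p e _ hs0 hs,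
        hasseDeriv_pow_expChar_pow_of_lt p e _ hs0 hs]
      simp
  have hqd : p ^ e ≤ d - 1 := hqm ▸ Nat.le_mul_of_pos_right _ hm0
  by_cases hJ : ∃ J, 2 ≤ J ∧ J ≤ p ^ e ∧ ∃ a b, a + b = J ∧ P a b ≠ 0
  · right
    obtain ⟨h2, hJq, a, b, hab, hne⟩ := Nat.find_spec hJ
    have hmin := fun j (hj : j < Nat.find hJ) ↦ Nat.find_min hJ hj
    generalize Nat.find hJ = J at *
    have hne0 : tangentCoeff P J 0 ≠ 0 := by
      intro h
      refine hne ?_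
      have h3 := eq_zero_of_sum_antidiagonal_eq_zero hcop J
        (fun a b ↦ (-1) ^ b * P a b) (fun a b hab ↦ ?_) ?_ a b hab
      · simpa using h3
      · rw [hdeg]
        have h1 : ((-1 : Polynomial K) ^ b).natDegree ≤ b * 0 :=
          Polynomial.natDegree_pow_le_of_le b (by simp)
        have h2 := Polynomial.natDegree_mul_le_of_le h1 (hP a b)
        omega
      · rw [← h, tangentCoeff]
        refine Finset.sum_congr rfl fun x _ ↦ ?_
        rw [Polynomial.hasseDeriv_zero', neg_pow (P 1 0)]
        ring
    have hsub : Prod.fst '' tangentLineSet P d ⊆ ((tangentCoeff P J 0).roots.toFinset : Set K) := by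
      rintro _ ⟨⟨z, r⟩, h, rfl⟩
      have := h J (by omega)
      rw [tangentLineCoeff_of_le h0 hlow hJq, if_neg (by omega)] at this
      · simpa [hne0] using this
      · intro a b h2 hlt
        by_contra hne
        exact hmin _ hlt ⟨h2, by omega, a, b, rfl, hne⟩
    refine (Set.ncard_le_ncard hsub (Finset.finite_toSet _)).trans ?_
    rw [Set.ncard_coe_finset]
    refine (Multiset.toFinset_card_le _).trans ((Polynomial.card_roots' _).trans
      ((natDegree_tangentCoeff_le hP (by omega)).trans ?_))
    obtain ⟨t, rfl⟩ : ∃ t, d = J + 1 + t := ⟨d - J - 1, by omega⟩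
    rw [show J + 1 + t - (J + 0) = t + 1 by omega, show J + 1 + t - 1 = J + t by omega]
    nlinarith
  · left
    have hP2 : ∀ a b, 2 ≤ a + b → a + b ≤ p ^ e → P a b = 0 := fun a b h h' ↦ by
      by_contra hne
      exact hJ ⟨_, h, h', a, b, rfl, hne⟩
    rcases Nat.eq_or_lt_of_le hqd with hq | hq
    · refine absurd hfin (infinite_tangentLineSet hT0 fun z hz ↦ ?_)
      obtain ⟨r, hr⟩ := IsAlgClosed.exists_pow_nat_eq
        (-(tangentCoeff P (p ^ e + 1) 0).eval z / (tangentCoeff P 1 (p ^ e)).eval z) hqpos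
      refine ⟨r, fun l hl ↦ ?_⟩
      rcases Nat.eq_or_lt_of_le hl with rfl | hl
      · rw [show l = p ^ e + 1 by omega, tangentLineCoeff_add_one h0 hqpos hP2]
        simp only [hr]
        field_simp
        ring
      · simp only
        rw [tangentLineCoeff_of_le h0 hlow (by omega) fun a b h h' ↦ hP2 a b h (by omega)]
        split_ifs with hl0
        · rfl
        · rcases Nat.eq_or_lt_of_le (Nat.one_le_iff_ne_zero.2 hl0) with rfl | hl1
          · rw [hlow 0 hqpos, Polynomial.eval_zero]
          · rw [tangentCoeff_eq_zero fun a b hab ↦ hP2 a b (by omega) (by omega),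
              Polynomial.eval_zero]
    · have hm2 : 2 ≤ m := by
        by_contra h
        have : m = 1 := by omega
        rw [this] at hqm
        omega
      have h2q : 2 * p ^ e ≤ d - 1 := by nlinarith
      refine (ncard_tangentLineSet_le p e h0 hP (by omega) hfin hP2 hT0 ?_).trans_lt ?_
      · rw [hT, Polynomial.natDegree_pow, Polynomial.natDegree_neg]
        have := Nat.mul_le_mul_left (p ^ e) (natDegree_wronskian_le (A := A) (B := B)
          (le_max_left _ _) (le_max_right _ _))
        rw [← hm, Nat.mul_sub, Nat.mul_left_comm, hqm] at this
        omega
      · have : p ^ e + 2 ≤ d - 1 := by omega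
        nlinarith [Nat.mul_le_mul_right ((d - 1) ^ 2) this]

end
section
variable {k : Type*} [Field k]

namespace Submodule
variable {E : Type*} [AddCommGroup E] [Module k E]

lemma exists_mem_forall_notMem [Infinite k] (H : Submodule k E)
    {s : Set (Submodule k E)} (hs : s.Finite) (h : ∀ p ∈ s, ¬ H ≤ p) :
    ∃ v ∈ H, ∀ p ∈ s, v ∉ p := by
  classical
  have key := Subspace.biUnion_ne_univ_of_top_notMem (k := k) (E := H)
    (s := (hs.image (Submodule.comap H.subtype)).toFinset) (by
      simp only [Set.Finite.mem_toFinset, Set.mem_image, not_exists, not_and]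
      intro p hp htop
      exact h p hp (Submodule.comap_subtype_eq_top.1 htop))
  obtain ⟨v, hv⟩ := (Set.ne_univ_iff_exists_notMem _).1 key
  refine ⟨v, v.2, fun p hp hvp ↦ hv ?_⟩
  simp only [Set.Finite.mem_toFinset, Set.mem_iUnion]
  exact ⟨_, Set.mem_image_of_mem _ hp, hvp⟩

lemma finrank_span_pair_eq_two {v w : E} (hw : w ≠ 0) (hv : v ∉ span k {w}) :
    Module.finrank k (span k {v, w}) = 2 := by
  have h : LinearIndependent k ![w, v] := (LinearIndependent.pair_iff' hw).2 fun a ha ↦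
    hv (mem_span_singleton.2 ⟨a, ha⟩)
  have := finrank_span_eq_card h
  rwa [Matrix.range_cons, Matrix.range_cons, Matrix.range_empty, Set.union_empty,
    Set.singleton_union, Set.pair_comm, Fintype.card_fin] at this

lemma not_le_of_finrank_lt [FiniteDimensional k E] {p q : Submodule k E}
    (h : Module.finrank k p < Module.finrank k q) : ¬ q ≤ p :=
  fun hle ↦ absurd (finrank_mono hle) (by omega)

lemma inf_ne_bot_of_le [FiniteDimensional k E] {M N H : Submodule k E}
    (hM : Module.finrank k M = 2) (hN : Module.finrank k N = 2) (hH : Module.finrank k H = 3)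
    (hMH : M ≤ H) (hNH : N ≤ H) : M ⊓ N ≠ ⊥ := by
  intro h
  have h1 := finrank_sup_add_finrank_inf_eq M N
  have h2 := finrank_mono (sup_le hMH hNH)
  rw [h, finrank_bot] at h1
  omega

lemma finrank_inf_le_one [FiniteDimensional k E] {M N : Submodule k E}
    (hM : Module.finrank k M = 2) (hN : Module.finrank k N = 2) (hne : M ≠ N) :
    Module.finrank k (M ⊓ N : Submodule k E) ≤ 1 := by
  by_contra! h
  have h1 : M ⊓ N = M := eq_of_le_of_finrank_le inf_le_left (by omega)
  have h2 : M ⊓ N = N := eq_of_le_of_finrank_le inf_le_right (by omega)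
  exact hne (h1.symm.trans h2)

lemma finrank_sup_eq_three [FiniteDimensional k E] {M N : Submodule k E}
    (hM : Module.finrank k M = 2) (hN : Module.finrank k N = 2) (hne : M ≠ N)
    (h : M ⊓ N ≠ ⊥) : Module.finrank k (M ⊔ N : Submodule k E) = 3 := by
  have h1 := finrank_sup_add_finrank_inf_eq M N
  have h2 := finrank_inf_le_one hM hN hne
  have h3 := Submodule.one_le_finrank_iff.2 h
  omega

end Submodule

namespace MvPolynomial

lemma derivation_aeval {σ R A : Type*} [CommRing R] [CommRing A] [Algebra R A] [Fintype σ]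
    (D : Derivation R A A) (g : σ → A) (f : MvPolynomial σ R) :
    D (aeval g f) = ∑ j, aeval g (pderiv j f) * D (g j) := by
  classical
  induction f using MvPolynomial.induction_on with
  | C a => simp
  | add p q hp hq => simp only [map_add, hp, hq, add_mul, Finset.sum_add_distrib]
  | mul_X p n hp =>
    simp only [map_mul, Derivation.leibniz, aeval_X, hp, pderiv_X, map_add, smul_eq_mul, add_mul,
      Finset.sum_add_distrib, Finset.mul_sum]
    congr 1
    · rw [Finset.sum_eq_single n]
      · simp
      · intro j _ hj
        simp [Pi.single_eq_of_ne' hj]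
      · simp
    · exact Finset.sum_congr rfl fun j _ ↦ by ring

/-- The restriction of `f` to the parametrized line `t ↦ w + t v`. -/
noncomputable def restrictLine {σ : Type*} (f : MvPolynomial σ k) (v w : σ → k) : Polynomial k :=
  aeval (fun i ↦ Polynomial.C (w i) + Polynomial.C (v i) * Polynomial.X) f

lemma eval_restrictLine {σ : Type*} (f : MvPolynomial σ k) (v w : σ → k) (t : k) :
    (f.restrictLine v w).eval t = eval (w + t • v) f := by
  rw [restrictLine]
  induction f using MvPolynomial.induction_on with
  | C a => simp
  | add p q hp hq => simp only [map_add, Polynomial.eval_add, hp, hq]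
  | mul_X p n hp =>
    rw [map_mul, aeval_X, Polynomial.eval_mul, hp, map_mul, eval_X]
    simp [mul_comm t]

lemma IsHomogeneous.natDegree_restrictLine_le {σ : Type*} {f : MvPolynomial σ k} {d : ℕ}
    (hf : f.IsHomogeneous d) (v w : σ → k) : (f.restrictLine v w).natDegree ≤ d := by
  have := aeval_natDegree_le f hf.totalDegree_le
    (fun i ↦ Polynomial.C (w i) + Polynomial.C (v i) * Polynomial.X) (n := 1) fun i ↦ by
      compute_degree
  simpa [restrictLine] using this

lemma restrictLine_eq_zero [Infinite k] {σ : Type*} {f : MvPolynomial σ k} {v w : σ → k}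
    (h : ∀ t : k, t ≠ 0 → eval (w + t • v) f = 0) : f.restrictLine v w = 0 := by
  by_contra hne
  refine Set.infinite_univ (α := k)
    (((f.restrictLine v w).rootSet_finite k).insert 0 |>.subset fun t _ ↦ ?_)
  by_cases ht : t = 0
  · exact Or.inl ht
  · right
    rw [Polynomial.mem_rootSet_of_ne hne, Polynomial.coe_aeval_eq_eval, eval_restrictLine, h t ht]

lemma eval_eq_zero_of_forall_ne_zero [Infinite k] {σ : Type*} {f : MvPolynomial σ k}
    {v w : σ → k} (h : ∀ t : k, t ≠ 0 → eval (w + t • v) f = 0) : eval w f = 0 := by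
  have := eval_restrictLine f v w 0
  rw [restrictLine_eq_zero h, zero_smul, add_zero, Polynomial.eval_zero] at this
  exact this.symm

/-- The directional derivative of a polynomial in the direction `v`. -/
lemma sum_mul_eval_pderiv {σ : Type*} [Fintype σ] (f : MvPolynomial σ k) (v w : σ → k) :
    ∑ i, v i * eval w (pderiv i f) = (f.restrictLine v w).derivative.eval 0 := by
  have h1 := congrArg (Polynomial.eval 0)
    (derivation_aeval Polynomial.derivative'
      (fun i ↦ Polynomial.C (w i) + Polynomial.C (v i) * Polynomial.X) f)
  rw [← restrictLine, Polynomial.derivative'_apply, Polynomial.eval_finsetSum] at h1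
  rw [h1]
  refine Finset.sum_congr rfl fun i _ ↦ ?_
  have h2 := eval_restrictLine (pderiv i f) v w 0
  rw [restrictLine, zero_smul, add_zero] at h2
  rw [Polynomial.eval_mul, h2, mul_comm]
  simp

/-- A polynomial that vanishes on a line has zero derivative in the direction of this line. -/
lemma sum_mul_eval_pderiv_eq_zero [Infinite k] {σ : Type*} [Fintype σ] {f : MvPolynomial σ k}
    {v w : σ → k} (h : ∀ t : k, eval (w + t • v) f = 0) :
    ∑ i, v i * eval w (pderiv i f) = 0 := by
  rw [sum_mul_eval_pderiv, restrictLine_eq_zero fun t _ ↦ h t, map_zero, Polynomial.eval_zero]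

end MvPolynomial

/-- Smooth surfaces are preserved by linear changes of coordinates. -/
lemma IsSmoothSurface.exists_comp [Infinite k] {f : MvPolynomial (Fin 4) k} {d : ℕ}
    (hf : IsSmoothSurface f d)
    (T : (Fin 4 → k) ≃ₗ[k] (Fin 4 → k)) :
    ∃ g, IsSmoothSurface g d ∧ ∀ v, eval v g = eval (T v) f := by
  classical
  let G : Fin 4 → MvPolynomial (Fin 4) k := fun j ↦ ∑ i, C (T (Pi.single i 1) j) * X i
  have hT : ∀ v, (fun j ↦ eval v (G j)) = T v := fun v ↦ by
    ext j
    conv_rhs => rw [pi_eq_sum_univ' v]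
    simp [G, map_sum, mul_comm]
  have hev : ∀ v p, eval v (aeval G p) = eval (T v) p := fun v p ↦ by
    rw [← hT v]
    induction p using MvPolynomial.induction_on with
    | C a => simp
    | add p q hp hq => simp only [map_add, hp, hq]
    | mul_X p n hp => simp only [map_mul, aeval_X, eval_X, hp]
  have hd : ∀ i j, pderiv i (G j) = C (T (Pi.single i 1) j) := fun i j ↦ by
    simp [G, pderiv_X, Pi.single_apply]
  refine ⟨aeval G f, ⟨?_, ?_, ?_⟩, fun v ↦ hev v f⟩
  · intro h
    refine hf.1 (MvPolynomial.funext fun v ↦ ?_)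
    obtain ⟨w, rfl⟩ := T.surjective v
    rw [← hev, h, map_zero, map_zero]
  · simpa using hf.2.1.aeval G (n := 1) (fun j ↦ IsHomogeneous.sum _ _ _ fun i _ ↦
      (isHomogeneous_C_mul_X _ _))
  · rintro v hv ⟨h0, h1⟩
    refine hf.2.2 (T v) (by simpa using hv) ⟨by rw [← hev, h0], ?_⟩
    have hS : ∀ w, ∑ j, eval (T v) (pderiv j f) * T w j = 0 := by
      intro w
      conv_lhs =>
        enter [2, j]
        rw [pi_eq_sum_univ' w, map_sum, Finset.sum_apply, Finset.mul_sum]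
      rw [Finset.sum_comm]
      refine Finset.sum_eq_zero fun i _ ↦ ?_
      have h2 := h1 i
      rw [derivation_aeval, map_sum] at h2
      rw [← mul_zero (w i), ← h2, Finset.mul_sum]
      refine Finset.sum_congr rfl fun j _ ↦ ?_
      rw [map_mul, hev, hd, eval_C]
      simp
      ring
    intro j
    obtain ⟨w, hw⟩ := T.surjective (Pi.single j 1)
    have := hS w
    rw [hw] at this
    simpa [Pi.single_apply] using this

variable [Infinite k] {f : MvPolynomial (Fin 4) k}

/-- A plane section that is not the whole plane contains at most `d` lines. -/
lemma IsLineOn.card_le {d : ℕ} (hf : f.IsHomogeneous d) {H : Submodule k (Fin 4 → k)}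
    (hH : Module.finrank k H = 3) (hfH : ∃ w ∈ H, eval w f ≠ 0)
    (s : Finset (Submodule k (Fin 4 → k))) (hs : ∀ M ∈ s, IsLineOn f M ∧ M ≤ H) :
    s.card ≤ d := by
  classical
  obtain ⟨w, hwH, hw⟩ := hfH
  have hwM : ∀ M ∈ s, w ∉ M := fun M hM h ↦ hw ((hs M hM).1.2 w h)
  have hfin : (Set.image2 (fun M N : Submodule k (Fin 4 → k) ↦ k ∙ w ⊔ M ⊓ N) s s).Finite :=
    s.finite_toSet.image2 _ s.finite_toSet
  obtain ⟨v, hvH, hv⟩ := H.exists_mem_forall_notMem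
    (s := insert (k ∙ w) s ∪ {p | ∃ M ∈ s, ∃ N ∈ s, M ≠ N ∧ k ∙ w ⊔ M ⊓ N = p})
    ((s.finite_toSet.insert _).union (hfin.subset (by
      rintro _ ⟨M, hM, N, hN, -, rfl⟩
      exact ⟨M, hM, N, hN, rfl⟩))) (by
      have h2 : Module.finrank k (k ∙ w) ≤ 1 :=
        (finrank_span_le_card _).trans (by simp)
      rintro p ((rfl | hp) | ⟨M, hM, N, hN, hne, rfl⟩)
      · exact Submodule.not_le_of_finrank_lt (by omega)
      · exact Submodule.not_le_of_finrank_lt (by rw [(hs p hp).1.1]; omega)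
      · refine Submodule.not_le_of_finrank_lt ?_
        have h1 := Submodule.finrank_add_le_finrank_add_finrank (k ∙ w) (M ⊓ N)
        have h3 := Submodule.finrank_inf_le_one (hs M hM).1.1 (hs N hN).1.1 hne
        omega)
  have hQ := eval_restrictLine f v w
  have hQd := hf.natDegree_restrictLine_le v w
  generalize f.restrictLine v w = Q at hQ hQd
  have hQ0 : Q ≠ 0 := by
    rintro rfl
    exact hw (by simpa using (hQ 0).symm)
  have ht : ∀ M ∈ s, ∃ t : k, w + t • v ∈ M := by
    intro M hM
    have hvM : v ∉ M := hv M (Or.inl (Or.inr hM))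
    have h2 : Module.finrank k (Submodule.span k {v, w}) = 2 :=
      Submodule.finrank_span_pair_eq_two (by rintro rfl; exact hwM M hM M.zero_mem)
        (hv _ (Or.inl (Or.inl rfl)))
    have := Submodule.inf_ne_bot_of_le (hs M hM).1.1 h2 hH (hs M hM).2
      (Submodule.span_le.2 (by rintro x (rfl | rfl) <;> assumption))
    obtain ⟨x, ⟨hxM, hx⟩, hx0⟩ := Submodule.exists_mem_ne_zero_of_ne_bot this
    obtain ⟨b, a, rfl⟩ := Submodule.mem_span_pair.1 hx
    have ha : a ≠ 0 := by
      rintro rfl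
      rw [zero_smul, add_zero] at hxM hx0
      exact hvM ((M.smul_mem_iff (by rintro rfl; simp at hx0)).1 hxM)
    refine ⟨a⁻¹ * b, ?_⟩
    have := M.smul_mem a⁻¹ hxM
    rwa [smul_add, smul_smul, smul_smul, inv_mul_cancel₀ ha, one_smul, add_comm] at this
  choose! t ht using ht
  rw [← Finset.card_image_of_injOn (f := t) (s := s)]
  · refine (Finset.card_le_card fun r hr ↦ ?_).trans
      ((Multiset.toFinset_card_le _).trans ((Polynomial.card_roots' Q).trans hQd))
    obtain ⟨M, hM, rfl⟩ := Finset.mem_image.1 hr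
    rw [Multiset.mem_toFinset, Polynomial.mem_roots hQ0, Polynomial.IsRoot, hQ]
    exact (hs M hM).1.2 _ (ht M hM)
  · intro M hM N hN heq
    by_contra hne
    refine hv _ (Or.inr ⟨M, hM, N, hN, hne, rfl⟩) ?_
    have h1 := ht M hM
    have h2 := ht N hN
    rw [← heq] at h2
    have h0 : t M ≠ 0 := by
      intro h0
      rw [h0, zero_smul, add_zero] at h1
      exact hwM M hM h1
    rw [← Submodule.smul_mem_iff _ h0, ← add_sub_cancel_left w (t M • v)]
    exact Submodule.sub_mem _ (Submodule.mem_sup_right ⟨h1, h2⟩)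
      (Submodule.mem_sup_left (Submodule.mem_span_singleton_self w))

/-- If the surface contains the whole plane `H`, then infinitely many lines meet `L`. -/
lemma infinite_of_forall_mem_eval_eq_zero {L H : Submodule k (Fin 4 → k)}
    (hL : Module.finrank k L = 2) (hH : Module.finrank k H = 3)
    (h : ∀ v ∈ H, eval v f = 0) (hLH : L ≤ H) :
    {M : Submodule k (Fin 4 → k) | IsLineOn f M ∧ M ≠ L ∧ M ⊓ L ≠ ⊥}.Infinite := by
  intro hfin
  obtain ⟨v, hvH, hv⟩ := H.exists_mem_forall_notMem (hfin.insert L) (by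
    rintro p (rfl | hp)
    · exact Submodule.not_le_of_finrank_lt (by omega)
    · exact Submodule.not_le_of_finrank_lt (by rw [hp.1.1]; omega))
  obtain ⟨w, hwL, hw0⟩ := L.exists_mem_ne_zero_of_ne_bot (by
    rintro rfl
    simp at hL)
  have hvL : v ∉ L := hv L (Set.mem_insert _ _)
  refine hv (Submodule.span k {v, w}) (Set.mem_insert_of_mem _ ⟨⟨?_, ?_⟩, ?_, ?_⟩)
    (Submodule.subset_span (by simp))
  · exact Submodule.finrank_span_pair_eq_two hw0 fun hvw ↦
      hvL ((Submodule.span_singleton_le_iff_mem _ _).2 hwL hvw)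
  · exact fun x hx ↦ h x (Submodule.span_le.2 (by
      rintro y (rfl | rfl)
      exacts [hvH, hLH hwL]) hx)
  · rintro rfl
    exact hvL (Submodule.subset_span (by simp))
  · exact (Submodule.ne_bot_iff _).2 ⟨w, ⟨Submodule.subset_span (by simp), hwL⟩, hw0⟩

end
section
open Finset.HasAntidiagonal (antidiagonal)
variable {k : Type*} [Field k]

namespace MvPolynomial

lemma IsHomogeneous.sum_fin_four {g : MvPolynomial (Fin 4) k} {d : ℕ} (hg : g.IsHomogeneous d)
    {m : Fin 4 →₀ ℕ} (hm : m ∈ g.support) : m 0 + m 1 + m 2 + m 3 = d := by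
  have := hg (mem_support_iff.1 hm)
  rw [← Fin.sum_univ_four]
  rw [Finsupp.weight_apply, Finsupp.sum_fintype _ _ (by simp)] at this
  simpa using this

lemma IsHomogeneous.eval_smul_fin_four {g : MvPolynomial (Fin 4) k} {d : ℕ} (hg : g.IsHomogeneous d)
    (c : k) (v : Fin 4 → k) : eval (c • v) g = c ^ d * eval v g := by
  rw [eval_eq', eval_eq', Finset.mul_sum]
  refine Finset.sum_congr rfl fun m hm ↦ ?_
  simp only [Fin.prod_univ_four, Pi.smul_apply, smul_eq_mul, mul_pow, ← hg.sum_fin_four hm]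
  ring

/-- The coefficient of `x^a y^b` in the dehomogenization `g(x, y, z, 1)`, a polynomial in `z`. -/
noncomputable def chartCoeff (g : MvPolynomial (Fin 4) k) (a b : ℕ) : Polynomial k :=
  ∑ m ∈ g.support.filter (fun m ↦ (m 0, m 1) = (a, b)),
    Polynomial.C (coeff m g) * Polynomial.X ^ m 2

variable {g : MvPolynomial (Fin 4) k} {d : ℕ}

lemma natDegree_chartCoeff_le (hg : g.IsHomogeneous d) (a b : ℕ) :
    (chartCoeff g a b).natDegree ≤ d - (a + b) := by
  refine Polynomial.natDegree_sum_le_of_forall_le _ _ fun m hm ↦ ?_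
  obtain ⟨hm, hab⟩ := Finset.mem_filter.1 hm
  have := hg.sum_fin_four hm
  simp only [Prod.mk.injEq] at hab
  exact (Polynomial.natDegree_C_mul_X_pow_le _ _).trans (by omega)

lemma eval_eq_sum_chartCoeff (hg : g.IsHomogeneous d) (x y z : k) :
    eval ![x, y, z, 1] g = ∑ i ∈ Finset.range (d + 1), ∑ p ∈ antidiagonal i,
      (chartCoeff g p.1 p.2).eval z * x ^ p.1 * y ^ p.2 := by
  rw [eval_eq', ← Finset.sum_fiberwise_of_maps_to (t := Finset.range (d + 1))
    (g := fun m ↦ m 0 + m 1) (fun m hm ↦ by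
      have := hg.sum_fin_four hm
      simp only [Finset.mem_range]
      omega)]
  refine Finset.sum_congr rfl fun i _ ↦ ?_
  rw [← Finset.sum_fiberwise_of_maps_to (t := antidiagonal i)
    (g := fun m ↦ (m 0, m 1)) (fun m hm ↦ by
      simpa using (Finset.mem_filter.1 hm).2)]
  refine Finset.sum_congr rfl fun p hp ↦ ?_
  have hp := Finset.HasAntidiagonal.mem_antidiagonal.1 hp
  have hfil : (g.support.filter fun m ↦ m 0 + m 1 = i).filter (fun m ↦ (m 0, m 1) = p) =
      g.support.filter fun m ↦ (m 0, m 1) = (p.1, p.2) := by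
    ext m
    simp only [Finset.mem_filter, Prod.ext_iff, and_assoc]
    refine and_congr_right fun _ ↦ ⟨fun h ↦ h.2, fun h ↦ ⟨?_, h⟩⟩
    omega
  rw [hfil, chartCoeff, Polynomial.eval_finsetSum, Finset.sum_mul, Finset.sum_mul]
  refine Finset.sum_congr rfl fun m hm ↦ ?_
  have hm := (Finset.mem_filter.1 hm).2
  simp only [Prod.mk.injEq] at hm
  simp [Fin.prod_univ_four, hm.1, hm.2]
  ring

lemma chartCoeff_zero_zero [Infinite k] (hg : g.IsHomogeneous d)
    (h : ∀ v : Fin 4 → k, v 0 = 0 → v 1 = 0 → eval v g = 0) : chartCoeff g 0 0 = 0 := by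
  refine Polynomial.funext fun z ↦ ?_
  have := eval_eq_sum_chartCoeff hg 0 0 z
  rw [h _ rfl rfl, Finset.sum_eq_single 0] at this
  · simpa using this.symm
  · intro i _ hi
    refine Finset.sum_eq_zero fun p hp ↦ ?_
    have hp := Finset.HasAntidiagonal.mem_antidiagonal.1 hp
    by_cases h1 : p.1 = 0
    · rw [zero_pow (show p.2 ≠ 0 by omega), mul_zero]
    · rw [zero_pow h1, mul_zero, zero_mul]
  · simp

lemma eval_pderiv_eq_sum (i : Fin 4) (v : Fin 4 → k) :
    eval v (pderiv i g) = ∑ m ∈ g.support, coeff m g * m i *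
      ∏ j, v j ^ (m j - if i = j then 1 else 0) := by
  conv_lhs => rw [g.as_sum, map_sum, map_sum]
  refine Finset.sum_congr rfl fun m _ ↦ ?_
  rw [pderiv_monomial, eval_monomial, Finsupp.prod_fintype _ _ (by simp)]
  simp only [Finsupp.tsub_apply, Finsupp.single_apply]

lemma eval_pderiv_zero (z w : k) :
    eval ![0, 0, z, w] (pderiv 0 g) =
      ∑ m ∈ g.support.filter (fun m ↦ (m 0, m 1) = (1, 0)), coeff m g * z ^ m 2 * w ^ m 3 := by
  rw [eval_pderiv_eq_sum, Finset.sum_filter]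
  refine Finset.sum_congr rfl fun m _ ↦ ?_
  simp only [Fin.prod_univ_four, Prod.mk.injEq]
  by_cases h : m 0 = 1 ∧ m 1 = 0
  · simp [h.1, h.2]
    ring
  · rw [if_neg h]
    have : m 0 = 0 ∨ m 0 - 1 ≠ 0 ∨ m 1 ≠ 0 := by omega
    rcases this with h | h | h <;> simp [h]

lemma eval_pderiv_one (z w : k) :
    eval ![0, 0, z, w] (pderiv 1 g) =
      ∑ m ∈ g.support.filter (fun m ↦ (m 0, m 1) = (0, 1)), coeff m g * z ^ m 2 * w ^ m 3 := by
  rw [eval_pderiv_eq_sum, Finset.sum_filter]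
  refine Finset.sum_congr rfl fun m _ ↦ ?_
  simp only [Fin.prod_univ_four, Prod.mk.injEq]
  by_cases h : m 0 = 0 ∧ m 1 = 1
  · simp [h.1, h.2]
    ring
  · rw [if_neg h]
    have : m 1 = 0 ∨ m 1 - 1 ≠ 0 ∨ m 0 ≠ 0 := by omega
    rcases this with h | h | h <;> simp [h]

lemma coeff_chartCoeff (hg : g.IsHomogeneous d) {m : Fin 4 →₀ ℕ} (hm : m ∈ g.support) :
    (chartCoeff g (m 0) (m 1)).coeff (m 2) = coeff m g := by
  rw [chartCoeff, Polynomial.finsetSum_coeff, Finset.sum_eq_single m]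
  · simp
  · intro n hn hne
    obtain ⟨hn, hab⟩ := Finset.mem_filter.1 hn
    rw [Polynomial.coeff_C_mul_X_pow, if_neg]
    intro h
    have h1 := hg.sum_fin_four hm
    have h2 := hg.sum_fin_four hn
    simp only [Prod.mk.injEq] at hab
    refine hne (Finsupp.ext fun i ↦ ?_)
    fin_cases i <;> simp <;> omega
  · simp [hm]

lemma eval_pderiv_zero_one (z : k) :
    eval ![0, 0, z, 1] (pderiv 0 g) = (chartCoeff g 1 0).eval z := by
  simp [eval_pderiv_zero, chartCoeff, Polynomial.eval_finsetSum]

lemma eval_pderiv_one_one (z : k) :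
    eval ![0, 0, z, 1] (pderiv 1 g) = (chartCoeff g 0 1).eval z := by
  simp [eval_pderiv_one, chartCoeff, Polynomial.eval_finsetSum]

lemma eval_pderiv_zero_infinity (hg : g.IsHomogeneous d) :
    eval ![0, 0, 1, 0] (pderiv 0 g) = (chartCoeff g 1 0).coeff (d - 1) := by
  rw [eval_pderiv_zero, chartCoeff, Polynomial.finsetSum_coeff]
  refine Finset.sum_congr rfl fun m hm ↦ ?_
  obtain ⟨hm, hab⟩ := Finset.mem_filter.1 hm
  have := hg.sum_fin_four hm
  simp only [Prod.mk.injEq] at hab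
  rw [Polynomial.coeff_C_mul_X_pow, one_pow, mul_one]
  split_ifs with h
  · rw [show m 3 = 0 by omega, pow_zero, mul_one]
  · rw [zero_pow (by omega), mul_zero]

lemma eval_pderiv_one_infinity (hg : g.IsHomogeneous d) :
    eval ![0, 0, 1, 0] (pderiv 1 g) = (chartCoeff g 0 1).coeff (d - 1) := by
  rw [eval_pderiv_one, chartCoeff, Polynomial.finsetSum_coeff]
  refine Finset.sum_congr rfl fun m hm ↦ ?_
  obtain ⟨hm, hab⟩ := Finset.mem_filter.1 hm
  have := hg.sum_fin_four hm
  simp only [Prod.mk.injEq] at hab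
  rw [Polynomial.coeff_C_mul_X_pow, one_pow, mul_one]
  split_ifs with h
  · rw [show m 3 = 0 by omega, pow_zero, mul_one]
  · rw [zero_pow (by omega), mul_zero]

end MvPolynomial

lemma IsSmoothSurface.eval_pderiv_ne_zero [Infinite k] {g : MvPolynomial (Fin 4) k} {d : ℕ}
    (hg : IsSmoothSurface g d)
    (h : ∀ v : Fin 4 → k, v 0 = 0 → v 1 = 0 → eval v g = 0) {z w : k} (hzw : z ≠ 0 ∨ w ≠ 0) :
    eval ![0, 0, z, w] (pderiv 0 g) ≠ 0 ∨ eval ![0, 0, z, w] (pderiv 1 g) ≠ 0 := by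
  by_contra! h0
  have hcoeff : ∀ m ∈ g.support, m 0 ≠ 0 ∨ m 1 ≠ 0 := by
    intro m hm
    by_contra! hm0
    have := coeff_chartCoeff hg.2.1 hm
    rw [hm0.1, hm0.2, chartCoeff_zero_zero hg.2.1 h, Polynomial.coeff_zero] at this
    exact mem_support_iff.1 hm this.symm
  refine hg.2.2 ![0, 0, z, w] (fun h ↦ ?_) ⟨h _ rfl rfl, fun i ↦ ?_⟩
  · have h2 := congrFun h 2
    have h3 := congrFun h 3
    simp at h2 h3
    simp [h2, h3] at hzw
  fin_cases i
  · exact h0.1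
  · exact h0.2
  all_goals
    simp only [eval_pderiv_eq_sum, Fin.prod_univ_four]
    refine Finset.sum_eq_zero fun m hm ↦ ?_
    rcases hcoeff m hm with h | h <;> simp [h]

end
section
open Finset.HasAntidiagonal (antidiagonal)
variable {k : Type*} [Field k]

lemma Polynomial.eval_add_mul_eq_sum {P : Polynomial k} {d : ℕ} (hP : P.natDegree ≤ d) (z u r : k) :
    P.eval (z + u * r) =
      ∑ s ∈ Finset.range (d + 1), (Polynomial.hasseDeriv s P).eval z * (u * r) ^ s := by
  rw [add_comm, ← Polynomial.taylor_eval, Polynomial.eval_eq_sum_range' (n := d + 1)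
    (by rw [Polynomial.natDegree_taylor]; omega)]
  simp only [Polynomial.taylor_coeff]

lemma tangentCoeff_eq_zero_of_lt {P : ℕ → ℕ → Polynomial k} {d : ℕ}
    (hP : ∀ a b, (P a b).natDegree ≤ d - (a + b)) {i s : ℕ} (hi : i ≤ d) (h : d < i + s) :
    tangentCoeff P i s = 0 := by
  refine Finset.sum_eq_zero fun x hx ↦ ?_
  have hx := Finset.HasAntidiagonal.mem_antidiagonal.1 hx
  have := hP x.1 x.2
  rw [Polynomial.hasseDeriv_eq_zero_of_lt_natDegree _ _ (by omega), zero_mul, zero_mul]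

lemma sum_eval_tangentLine {P : ℕ → ℕ → Polynomial k} {d : ℕ}
    (hP : ∀ a b, (P a b).natDegree ≤ d - (a + b)) (z r u : k) :
    ∑ i ∈ Finset.range (d + 1), ∑ x ∈ antidiagonal i, (P x.1 x.2).eval (z + u * r) *
      (u * (P 0 1).eval z) ^ x.1 * (u * -(P 1 0).eval z) ^ x.2 =
    ∑ l ∈ Finset.range (d + 1), tangentLineCoeff P l z r * u ^ l := by
  have h1 : ∀ l, tangentLineCoeff P l z r * u ^ l = ∑ i ∈ Finset.range (l + 1),
      (tangentCoeff P i (l - i)).eval z * (u * r) ^ (l - i) * u ^ i := by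
    intro l
    rw [tangentLineCoeff, ← Finset.Nat.sum_antidiagonal_eq_sum_range_succ
      (fun i s ↦ (tangentCoeff P i s).eval z * (u * r) ^ s * u ^ i), Finset.sum_mul]
    refine Finset.sum_congr rfl fun x hx ↦ ?_
    rw [← Finset.HasAntidiagonal.mem_antidiagonal.1 hx]
    ring
  simp only [h1]
  rw [Finset.sum_range_diag_flip (d + 1)
    (fun i s ↦ (tangentCoeff P i s).eval z * (u * r) ^ s * u ^ i)]
  refine Finset.sum_congr rfl fun i hi ↦ ?_
  have hi : i ≤ d := by simpa [Nat.lt_succ_iff] using hi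
  rw [Finset.sum_subset (Finset.range_subset_range.2 (Nat.sub_le (d + 1) i)) (fun s _ hs ↦ by
    rw [tangentCoeff_eq_zero_of_lt hP hi (by simp at hs; omega)]
    simp)]
  simp only [tangentCoeff, Polynomial.eval_finsetSum, Finset.sum_mul]
  rw [Finset.sum_comm]
  refine Finset.sum_congr rfl fun x hx ↦ ?_
  rw [Polynomial.eval_add_mul_eq_sum ((hP x.1 x.2).trans (Nat.sub_le _ _)), Finset.sum_mul,
    Finset.sum_mul]
  refine Finset.sum_congr rfl fun s _ ↦ ?_
  rw [← Finset.HasAntidiagonal.mem_antidiagonal.1 hx]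
  simp only [Polynomial.eval_mul, Polynomial.eval_pow, Polynomial.eval_neg]
  ring

lemma mem_tangentLineSet_iff [Infinite k] {P : ℕ → ℕ → Polynomial k} {d : ℕ}
    (hP : ∀ a b, (P a b).natDegree ≤ d - (a + b)) (z r : k) :
    (z, r) ∈ tangentLineSet P d ↔ ∀ u,
      ∑ i ∈ Finset.range (d + 1), ∑ x ∈ antidiagonal i, (P x.1 x.2).eval (z + u * r) *
        (u * (P 0 1).eval z) ^ x.1 * (u * -(P 1 0).eval z) ^ x.2 = 0 := by
  simp only [sum_eval_tangentLine hP]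
  refine ⟨fun h u ↦ Finset.sum_eq_zero fun l hl ↦ ?_, fun h l hl ↦ ?_⟩
  · have := h l (by simpa [Nat.lt_succ_iff] using hl)
    simp only at this
    rw [this, zero_mul]
  · have h0 : ∑ l ∈ Finset.range (d + 1),
        Polynomial.monomial l (tangentLineCoeff P l z r) = 0 :=
      Polynomial.funext fun u ↦ by simpa [Polynomial.eval_finsetSum] using h u
    have := congrArg (Polynomial.coeff · l) h0
    simpa [Polynomial.finsetSum_coeff, Polynomial.coeff_monomial, hl, Nat.lt_succ_iff] using this

variable {g : MvPolynomial (Fin 4) k} {d : ℕ}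

namespace MvPolynomial

lemma mem_tangentLineSet_chartCoeff_iff [Infinite k] (hg : g.IsHomogeneous d) (z r : k) :
    (z, r) ∈ tangentLineSet (chartCoeff g) d ↔ ∀ u : k,
      eval (![0, 0, z, 1] + u • ![(chartCoeff g 0 1).eval z, -(chartCoeff g 1 0).eval z, r, 0]) g =
        0 := by
  rw [mem_tangentLineSet_iff (natDegree_chartCoeff_le hg)]
  refine forall_congr' fun u ↦ ?_
  rw [← eval_eq_sum_chartCoeff hg]
  simp

end MvPolynomial

lemma IsSmoothSurface.isCoprime_chartCoeff [IsAlgClosed k] (hg : IsSmoothSurface g d)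
    (h : ∀ v : Fin 4 → k, v 0 = 0 → v 1 = 0 → eval v g = 0) :
    IsCoprime (chartCoeff g 1 0) (chartCoeff g 0 1) := by
  have : Infinite k := IsAlgClosed.instInfinite
  rw [Polynomial.isCoprime_iff_aeval_ne_zero_of_isAlgClosed k k]
  intro z
  rw [Polynomial.coe_aeval_eq_eval, ← eval_pderiv_zero_one, ← eval_pderiv_one_one]
  exact hg.eval_pderiv_ne_zero h (Or.inr one_ne_zero)

lemma IsSmoothSurface.max_natDegree_chartCoeff [Infinite k] (hg : IsSmoothSurface g d)
    (h : ∀ v : Fin 4 → k, v 0 = 0 → v 1 = 0 → eval v g = 0) :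
    max (chartCoeff g 1 0).natDegree (chartCoeff g 0 1).natDegree = d - 1 := by
  refine le_antisymm (max_le (natDegree_chartCoeff_le hg.2.1 1 0)
    (natDegree_chartCoeff_le hg.2.1 0 1)) ?_
  have := hg.eval_pderiv_ne_zero h (z := 1) (w := 0) (Or.inl one_ne_zero)
  rw [eval_pderiv_zero_infinity hg.2.1, eval_pderiv_one_infinity hg.2.1] at this
  rcases this with h | h
  · exact (Polynomial.le_natDegree_of_ne_zero h).trans (le_max_left _ _)
  · exact (Polynomial.le_natDegree_of_ne_zero h).trans (le_max_right _ _)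

end
section

variable {k : Type*} [Field k] {g : MvPolynomial (Fin 4) k} {d : ℕ}

/-- The direction, with last coordinate `0`, of the lines tangent to `V(g)` at `(0 : 0 : z : 1)`. -/
noncomputable def tangentDirection (g : MvPolynomial (Fin 4) k) (x : k × k) : Fin 4 → k :=
  ![(chartCoeff g 0 1).eval x.1, -(chartCoeff g 1 0).eval x.1, x.2, 0]

/-- The line through `(0 : 0 : z : 1)` with direction `tangentDirection g (z, r)`. -/
noncomputable def tangentLine (g : MvPolynomial (Fin 4) k) (x : k × k) :
    Submodule k (Fin 4 → k) :=
  Submodule.span k {tangentDirection g x, ![0, 0, x.1, 1]}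

lemma tangentDirection_mem (x : k × k) : tangentDirection g x ∈ tangentLine g x :=
  Submodule.subset_span (Set.mem_insert _ _)

lemma mem_tangentLine_self (x : k × k) : ![0, 0, x.1, 1] ∈ tangentLine g x :=
  Submodule.subset_span (Set.mem_insert_of_mem _ rfl)

lemma tangentLine_injective
    (hne : ∀ z, (chartCoeff g 1 0).eval z ≠ 0 ∨ (chartCoeff g 0 1).eval z ≠ 0) :
    Function.Injective (tangentLine g) := by
  intro x y hxy
  obtain ⟨a, b, hp⟩ := Submodule.mem_span_pair.1 (hxy ▸ mem_tangentLine_self (g := g) y)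
  obtain ⟨a', b', hq⟩ := Submodule.mem_span_pair.1 (hxy ▸ tangentDirection_mem (g := g) y)
  have hp0 := congrFun hp 0
  have hp1 := congrFun hp 1
  have hp2 := congrFun hp 2
  have hp3 := congrFun hp 3
  have hq0 := congrFun hq 0
  have hq1 := congrFun hq 1
  have hq2 := congrFun hq 2
  have hq3 := congrFun hq 3
  simp [tangentDirection] at hp0 hp1 hp2 hp3 hq0 hq1 hq2 hq3
  have ha : a = 0 := by
    rcases hne x.1 with h | h
    · exact hp1.resolve_right h
    · exact hp0.resolve_right h
  have h1 : x.1 = y.1 := by simpa [ha, hp3] using hp2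
  rw [h1] at hq0 hq1
  have ha' : a' = 1 := by
    rcases hne y.1 with h | h
    · exact mul_right_cancel₀ h (by linear_combination hq1)
    · exact mul_right_cancel₀ h (by linear_combination hq0)
  refine Prod.ext h1 ?_
  simpa [ha', hq3] using hq2

variable {L : Submodule k (Fin 4 → k)}

lemma isLineOn_tangentLine [Infinite k] (hg : g.IsHomogeneous d)
    (hne : ∀ z, (chartCoeff g 1 0).eval z ≠ 0 ∨ (chartCoeff g 0 1).eval z ≠ 0)
    {x : k × k} (hx : x ∈ tangentLineSet (chartCoeff g) d) : IsLineOn g (tangentLine g x) := by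
  have hx' := (mem_tangentLineSet_chartCoeff_iff hg x.1 x.2).1 hx
  have hp0 : ![0, 0, x.1, 1] ≠ (0 : Fin 4 → k) := fun h ↦ by simpa using congrFun h 3
  refine ⟨Submodule.finrank_span_pair_eq_two hp0 fun h ↦ ?_, fun v hv ↦ ?_⟩
  · obtain ⟨a, ha⟩ := Submodule.mem_span_singleton.1 h
    have h0 := congrFun ha 0
    have h1 := congrFun ha 1
    simp [tangentDirection] at h0 h1
    exact (hne x.1).elim (· h1) (· h0.symm)
  have key : ∀ a b : k, b ≠ 0 →
      eval (a • tangentDirection g x + b • ![0, 0, x.1, 1]) g = 0 := fun a b hb ↦ by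
    have : a • tangentDirection g x + b • ![0, 0, x.1, 1] =
        b • (![0, 0, x.1, 1] + (a / b) • tangentDirection g x) := by
      rw [smul_add, smul_smul, mul_div_cancel₀ _ hb, add_comm]
    rw [this, hg.eval_smul_fin_four, tangentDirection, hx', mul_zero]
  obtain ⟨a, b, rfl⟩ := Submodule.mem_span_pair.1 hv
  by_cases hb : b = 0
  · rw [hb, zero_smul, add_zero]
    exact eval_eq_zero_of_forall_ne_zero fun t ht ↦ key a t ht
  · exact key a b hb

lemma exists_tangentLine_eq [Infinite k] (hg : g.IsHomogeneous d)
    (hne : ∀ z, (chartCoeff g 1 0).eval z ≠ 0 ∨ (chartCoeff g 0 1).eval z ≠ 0)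
    (hL : ∀ v, v ∈ L ↔ v 0 = 0 ∧ v 1 = 0) (hLg : IsLineOn g L)
    {M : Submodule k (Fin 4 → k)} (hM : IsLineOn g M) (hML : M ≠ L) (hinf : M ⊓ L ≠ ⊥)
    (he : ![0, 0, 1, 0] ∉ M) :
    ∃ x ∈ tangentLineSet (chartCoeff g) d, tangentLine g x = M := by
  obtain ⟨p, ⟨hpM, hpL⟩, hp0⟩ := Submodule.exists_mem_ne_zero_of_ne_bot hinf
  obtain ⟨hpx, hpy⟩ := (hL p).1 hpL
  have hp3 : p 3 ≠ 0 := fun h3 ↦ by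
    have hp : p = p 2 • ![0, 0, 1, 0] := by
      ext i
      fin_cases i <;> simp [*]
    have h2 : p 2 ≠ 0 := fun h2 ↦ hp0 (by rw [hp, h2, zero_smul])
    rw [hp] at hpM
    exact he ((Submodule.smul_mem_iff _ h2).1 hpM)
  set z := p 2 / p 3 with hz
  have hpz : ![0, 0, z, 1] ∈ M := by
    have : ![0, 0, z, 1] = (p 3)⁻¹ • p := by
      ext i
      fin_cases i <;> simp [*, div_eq_inv_mul]
    rw [this]
    exact M.smul_mem _ hpM
  obtain ⟨m, hmM, hmL⟩ : ∃ m ∈ M, m ∉ L := by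
    by_contra! h
    exact hML (Submodule.eq_of_le_of_finrank_le h (by rw [hM.1, hLg.1]))
  obtain ⟨x, y, s, hq, hxy⟩ : ∃ x y s : k, ![x, y, s, 0] ∈ M ∧ (x ≠ 0 ∨ y ≠ 0) := by
    refine ⟨m 0, m 1, m 2 - m 3 * z, ?_, ?_⟩
    · have : ![m 0, m 1, m 2 - m 3 * z, 0] = m - m 3 • ![0, 0, z, 1] := by
        ext i
        fin_cases i <;> simp
      rw [this]
      exact M.sub_mem hmM (M.smul_mem _ hpz)
    · by_contra! h
      exact hmL ((hL m).2 h)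
  have h2 : eval ![0, 0, z, 1] (pderiv 2 g) = 0 := by
    have := sum_mul_eval_pderiv_eq_zero (f := g) (w := ![0, 0, z, 1]) (v := ![0, 0, 1, 0])
      fun t ↦ hLg.2 _ ((hL _).2 (by simp))
    simpa [Fin.sum_univ_four] using this
  have h01 := sum_mul_eval_pderiv_eq_zero (f := g) (w := ![0, 0, z, 1]) (v := ![x, y, s, 0])
    fun t ↦ hM.2 _ (M.add_mem hpz (M.smul_mem t hq))
  simp [Fin.sum_univ_four, h2, eval_pderiv_zero_one, eval_pderiv_one_one] at h01
  obtain ⟨c, hcx, hcy⟩ : ∃ c, x = c * (chartCoeff g 0 1).eval z ∧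
      y = -(c * (chartCoeff g 1 0).eval z) := by
    rcases hne z with h | h
    · refine ⟨-y / (chartCoeff g 1 0).eval z, ?_, ?_⟩
      · field_simp
        linear_combination h01
      · field_simp
    · refine ⟨x / (chartCoeff g 0 1).eval z, ?_, ?_⟩
      · field_simp
      · field_simp
        linear_combination h01
  have hc : c ≠ 0 := by
    rintro rfl
    simp at hcx hcy
    exact hxy.elim (· hcx) (· hcy)
  have hqM : tangentDirection g (z, s / c) ∈ M := by
    rw [← Submodule.smul_mem_iff M hc]
    have : c • tangentDirection g (z, s / c) = ![x, y, s, 0] := by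
      ext i
      fin_cases i <;> simp [tangentDirection, hcx, hcy, mul_div_cancel₀ _ hc]
    rwa [this]
  have hZ : (z, s / c) ∈ tangentLineSet (chartCoeff g) d :=
    (mem_tangentLineSet_chartCoeff_iff hg _ _).2 fun u ↦
      hM.2 _ (M.add_mem hpz (M.smul_mem u hqM))
  refine ⟨_, hZ, Submodule.eq_of_le_of_finrank_le ?_ ?_⟩
  · rw [tangentLine, Submodule.span_le]
    rintro v (rfl | rfl)
    exacts [hqM, hpz]
  · rw [hM.1, (isLineOn_tangentLine hg hne hZ).1]

lemma sup_tangentLine (hL : ∀ v, v ∈ L ↔ v 0 = 0 ∧ v 1 = 0) (x : k × k) :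
    L ⊔ tangentLine g x = L ⊔ Submodule.span k {tangentDirection g (x.1, 0)} := by
  have hp : ![0, 0, x.1, 1] ∈ L := (hL _).2 (by simp)
  have hr : tangentDirection g x - tangentDirection g (x.1, 0) ∈ L :=
    (hL _).2 (by simp [tangentDirection])
  refine le_antisymm (sup_le le_sup_left ?_) (sup_le le_sup_left ?_)
  · rw [tangentLine, Submodule.span_le]
    rintro v (rfl | rfl)
    · rw [← sub_add_cancel (tangentDirection g x) (tangentDirection g (x.1, 0))]
      exact Submodule.add_mem_sup hr (Submodule.mem_span_singleton_self _)
    · exact Submodule.mem_sup_left hp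
  · rw [Submodule.span_singleton_le_iff_mem,
      ← sub_sub_cancel (tangentDirection g x) (tangentDirection g (x.1, 0))]
    exact Submodule.sub_mem _ (Submodule.mem_sup_right (tangentDirection_mem x))
      (Submodule.mem_sup_left hr)

lemma IsSmoothSurface.ncard_lines_lt_or_ncard_planes_le_of_coordinates [IsAlgClosed k]
    (hd : 4 ≤ d) (hg : IsSmoothSurface g d)
    (hL : ∀ v, v ∈ L ↔ v 0 = 0 ∧ v 1 = 0) (hLg : IsLineOn g L)
    (hfin : {M : Submodule k (Fin 4 → k) | IsLineOn g M ∧ M ≠ L ∧ M ⊓ L ≠ ⊥}.Finite)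
    (he : ∀ M : Submodule k (Fin 4 → k), IsLineOn g M → M ≠ L → ![0, 0, 1, 0] ∉ M) :
    {M : Submodule k (Fin 4 → k) | IsLineOn g M ∧ M ≠ L ∧ M ⊓ L ≠ ⊥}.ncard <
        (d - 1) * ((d - 1) ^ 2 + 1) ∨
      {H : Submodule k (Fin 4 → k) | Module.finrank k H = 3 ∧ L ≤ H ∧
          ∃ M : Submodule k (Fin 4 → k), IsLineOn g M ∧ M ≠ L ∧ M ≤ H}.ncard ≤
        (d - 1) ^ 2 + 1 := by
  have : Infinite k := IsAlgClosed.instInfinite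
  have h0 : ∀ v : Fin 4 → k, v 0 = 0 → v 1 = 0 → eval v g = 0 :=
    fun v h h' ↦ hLg.2 v ((hL v).2 ⟨h, h'⟩)
  have hne : ∀ z, (chartCoeff g 1 0).eval z ≠ 0 ∨ (chartCoeff g 0 1).eval z ≠ 0 := fun z ↦ by
    have := hg.eval_pderiv_ne_zero h0 (z := z) (w := 1) (Or.inr one_ne_zero)
    rwa [eval_pderiv_zero_one, eval_pderiv_one_one] at this
  have himage : {M : Submodule k (Fin 4 → k) | IsLineOn g M ∧ M ≠ L ∧ M ⊓ L ≠ ⊥} =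
      tangentLine g '' tangentLineSet (chartCoeff g) d := by
    ext M
    refine ⟨fun ⟨h1, h2, h3⟩ ↦ exists_tangentLine_eq hg.2.1 hne hL hLg h1 h2 h3 (he M h1 h2), ?_⟩
    rintro ⟨x, hx, rfl⟩
    refine ⟨isLineOn_tangentLine hg.2.1 hne hx, fun h ↦ ?_, fun h ↦ ?_⟩
    · have := (hL _).1 (h ▸ tangentDirection_mem (g := g) x)
      simp [tangentDirection] at this
      exact (hne x.1).elim (· this.2) (· this.1)
    · have := (Submodule.eq_bot_iff _).1 h _
        ⟨mem_tangentLine_self x, (hL _).2 (by simp)⟩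
      simpa using congrFun this 3
  have hinj := tangentLine_injective hne
  have hZ : (tangentLineSet (chartCoeff g) d).Finite := by
    rw [himage] at hfin
    exact hfin.of_finite_image hinj.injOn
  rw [himage, Set.ncard_image_of_injective _ hinj]
  refine (ncard_tangentLineSet_lt_or_ncard_image_fst_le (chartCoeff_zero_zero hg.2.1 h0) hd
    (natDegree_chartCoeff_le hg.2.1) (hg.isCoprime_chartCoeff h0)
    (hg.max_natDegree_chartCoeff h0) hZ).imp_right fun h ↦ le_trans ?_ h
  refine (Set.ncard_le_ncard (t := (fun z ↦ L ⊔ Submodule.span k {tangentDirection g (z, 0)}) ''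
    (Prod.fst '' tangentLineSet (chartCoeff g) d)) ?_ ((hZ.image _).image _)).trans
    (Set.ncard_image_le (hZ.image _))
  rintro H ⟨hH, hLH, M, hM, hML, hMH⟩
  have hinf := Submodule.inf_ne_bot_of_le hM.1 hLg.1 hH hMH hLH
  obtain ⟨x, hx, rfl⟩ := exists_tangentLine_eq hg.2.1 hne hL hLg hM hML hinf (he M hM hML)
  refine ⟨x.1, ⟨x, hx, rfl⟩, ?_⟩
  simp only
  rw [← sup_tangentLine hL]
  refine Submodule.eq_of_le_of_finrank_le (sup_le hLH hMH) ?_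
  rw [hH, Submodule.finrank_sup_eq_three hLg.1 hM.1 hML.symm (by rwa [inf_comm])]

end
section

variable {k : Type*} [Field k] {f : MvPolynomial (Fin 4) k} {d : ℕ}

lemma exists_linearEquiv_of_notMem_span {e₁ e₂ e₃ e₄ : Fin 4 → k} (h₄ : e₄ ≠ 0)
    (h₃ : e₃ ∉ Submodule.span k {e₄}) (h₂ : e₂ ∉ Submodule.span k {e₃, e₄})
    (h₁ : e₁ ∉ Submodule.span k {e₂, e₃, e₄}) :
    ∃ T : (Fin 4 → k) ≃ₗ[k] (Fin 4 → k),
      ∀ v, T v = v 0 • e₁ + v 1 • e₂ + v 2 • e₃ + v 3 • e₄ := by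
  have h : LinearIndependent k ![e₁, e₂, e₃, e₄] := by
    refine linearIndependent_finCons.2 ⟨linearIndependent_finCons.2
      ⟨linearIndependent_finCons.2 ⟨linearIndependent_finCons.2
        ⟨linearIndependent_empty_type, by simpa using h₄⟩, ?_⟩, ?_⟩, ?_⟩
    · simpa using h₃
    · change e₂ ∉ Submodule.span k (Set.range ![e₃, e₄])
      rwa [Matrix.range_cons_cons_empty]
    · change e₁ ∉ Submodule.span k (Set.range ![e₂, e₃, e₄])
      rwa [Matrix.range_cons, Matrix.range_cons_cons_empty, Set.singleton_union]
  refine ⟨(basisOfLinearIndependentOfCardEqFinrank h (by simp)).equivFun.symm, fun v ↦ ?_⟩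
  simp [Module.Basis.equivFun_symm_apply, Fin.sum_univ_four]

lemma isLineOn_map_iff {g : MvPolynomial (Fin 4) k} {T : (Fin 4 → k) ≃ₗ[k] (Fin 4 → k)}
    (h : ∀ v, eval v g = eval (T v) f) (M : Submodule k (Fin 4 → k)) :
    IsLineOn f (Submodule.orderIsoMapComap T M) ↔ IsLineOn g M := by
  refine and_congr (Eq.congr_left (LinearEquiv.finrank_map_eq T M)) ?_
  simp only [h]
  exact Set.forall_mem_image

lemma IsSmoothSurface.ncard_lines_lt_or_ncard_planes_le [IsAlgClosed k]
    (hd : 4 ≤ d) (hf : IsSmoothSurface f d) {L : Submodule k (Fin 4 → k)} (hL : IsLineOn f L)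
    (hfin : {M : Submodule k (Fin 4 → k) | IsLineOn f M ∧ M ≠ L ∧ M ⊓ L ≠ ⊥}.Finite) :
    {M : Submodule k (Fin 4 → k) | IsLineOn f M ∧ M ≠ L ∧ M ⊓ L ≠ ⊥}.ncard <
        (d - 1) * ((d - 1) ^ 2 + 1) ∨
      {H : Submodule k (Fin 4 → k) | Module.finrank k H = 3 ∧ L ≤ H ∧
          ∃ M : Submodule k (Fin 4 → k), IsLineOn f M ∧ M ≠ L ∧ M ≤ H}.ncard ≤
        (d - 1) ^ 2 + 1 := by
  have : Infinite k := IsAlgClosed.instInfinite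
  obtain ⟨e₃, he₃L, he₃⟩ := L.exists_mem_forall_notMem (hfin.insert ⊥) (by
    rintro p (rfl | hp) hle
    · exact Submodule.not_le_of_finrank_lt (by rw [finrank_bot, hL.1]; omega) hle
    · exact hp.2.1 (Submodule.eq_of_le_of_finrank_le hle (by rw [hp.1.1, hL.1])).symm)
  have he₃0 : e₃ ≠ 0 := fun h ↦ he₃ ⊥ (Or.inl rfl) ((Submodule.mem_bot k).2 h)
  have hspan : Module.finrank k (Submodule.span k {e₃}) = 1 := finrank_span_singleton he₃0
  obtain ⟨e₄, he₄L, he₄⟩ := SetLike.not_le_iff_exists.1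
    (Submodule.not_le_of_finrank_lt (p := Submodule.span k {e₃}) (q := L)
      (by rw [hspan, hL.1]; omega))
  have hpair : Submodule.span k {e₃, e₄} = L := by
    refine Submodule.eq_of_le_of_finrank_le (Submodule.span_le.2 ?_) ?_
    · rintro v (rfl | rfl)
      exacts [he₃L, he₄L]
    · rw [Set.pair_comm, Submodule.finrank_span_pair_eq_two he₃0 he₄, hL.1]
  have he₄0 : e₄ ≠ 0 := by
    rintro rfl
    exact he₄ (Submodule.zero_mem _)
  have he₃₄ : e₃ ∉ Submodule.span k {e₄} := fun h ↦ by
    obtain ⟨a, rfl⟩ := Submodule.mem_span_singleton.1 h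
    have ha : a ≠ 0 := fun h ↦ he₃0 (by rw [h, zero_smul])
    exact he₄ ((Submodule.smul_mem_iff _ ha).1 (Submodule.mem_span_singleton_self (a • e₄)))
  obtain ⟨e₂, -, he₂⟩ := SetLike.not_le_iff_exists.1
    (Submodule.not_le_of_finrank_lt (p := L) (q := ⊤) (by rw [hL.1]; simp))
  have he₂₃₄ : Module.finrank k (Submodule.span k {e₂, e₃, e₄}) ≤ 3 := by
    have := finrank_range_le_card (R := k) ![e₂, e₃, e₄]
    rwa [Matrix.range_cons, Matrix.range_cons_cons_empty, Set.singleton_union,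
      Fintype.card_fin] at this
  obtain ⟨e₁, -, he₁⟩ := SetLike.not_le_iff_exists.1
    (Submodule.not_le_of_finrank_lt (p := Submodule.span k {e₂, e₃, e₄}) (q := ⊤)
      (by simp only [finrank_top, Module.finrank_fin_fun]; omega))
  obtain ⟨T, hT⟩ := exists_linearEquiv_of_notMem_span he₄0 he₃₄ (by rwa [hpair]) he₁
  obtain ⟨g, hg, hgf⟩ := hf.exists_comp T
  let φ : Submodule k (Fin 4 → k) ≃o Submodule k (Fin 4 → k) := Submodule.orderIsoMapComap T
  have hφ : ∀ M, IsLineOn f (φ M) ↔ IsLineOn g M := isLineOn_map_iff hgf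
  have hmem : ∀ M v, T v ∈ φ M ↔ v ∈ M := fun M v ↦
    (Submodule.mem_map_equiv (e := T) M).trans (by simp)
  obtain ⟨L', rfl⟩ := φ.surjective L
  have hX : {M | IsLineOn g M ∧ M ≠ L' ∧ M ⊓ L' ≠ ⊥} =
      φ ⁻¹' {M | IsLineOn f M ∧ M ≠ φ L' ∧ M ⊓ φ L' ≠ ⊥} := by
    ext M
    simp only [Set.mem_preimage, Set.mem_ofPred_eq, hφ, φ.injective.ne_iff, ← map_inf, ne_eq,
      map_eq_bot_iff]
  have hH : {H : Submodule k (Fin 4 → k) | Module.finrank k H = 3 ∧ L' ≤ H ∧ 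
        ∃ M, IsLineOn g M ∧ M ≠ L' ∧ M ≤ H} =
      φ ⁻¹' {H : Submodule k (Fin 4 → k) | Module.finrank k H = 3 ∧ φ L' ≤ H ∧
        ∃ M, IsLineOn f M ∧ M ≠ φ L' ∧ M ≤ H} := by
    ext H
    refine and_congr (Eq.congr_left (LinearEquiv.finrank_map_eq T H).symm)
      (and_congr φ.le_iff_le.symm (Iff.trans ?_ φ.surjective.exists.symm))
    simp only [hφ, φ.injective.ne_iff, φ.le_iff_le]
  have hL' : ∀ v, v ∈ L' ↔ v 0 = 0 ∧ v 1 = 0 := by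
    have hle : ∀ v, v 0 = 0 ∧ v 1 = 0 → v ∈ L' := fun v hv ↦ by
      rw [← hmem, ← hpair, hT, Submodule.mem_span_pair]
      exact ⟨v 2, v 3, by simp [hv.1, hv.2]⟩
    refine fun v ↦ ⟨fun hv ↦ ?_, hle v⟩
    rw [← hmem, ← hpair, Submodule.mem_span_pair] at hv
    obtain ⟨a, b, hab⟩ := hv
    have : T v = T ![0, 0, a, b] := by rw [← hab, hT]; simp
    simp [T.injective this]
  have key := hg.ncard_lines_lt_or_ncard_planes_le_of_coordinates hd hL' ((hφ L').1 hL)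
    (hX ▸ hfin.preimage φ.injective.injOn) fun M hM hML hmemM ↦ by
      have hTe : T ![0, 0, 1, 0] = e₃ := by rw [hT]; simp
      have h3 : e₃ ∈ φ M := by rwa [← hTe, hmem]
      refine he₃ (φ M) (Or.inr ⟨(hφ M).2 hM, φ.injective.ne hML, fun h ↦ ?_⟩) h3
      exact he₃0 ((Submodule.eq_bot_iff _).1 h e₃ ⟨h3, he₃L⟩)
  rwa [hX, hH, Set.ncard_preimage_of_injective_subset_range φ.injective
    (by simp [φ.surjective.range_eq]), Set.ncard_preimage_of_injective_subset_range φ.injective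
    (by simp [φ.surjective.range_eq])] at key

end
section

variable {k : Type*} [Field k]

namespace MvPolynomial

lemma exists_mem_ne_zero_of_mem_support [Infinite k] {σ : Type*} {g : MvPolynomial σ k}
    {s : Set σ} (h : ∀ v : σ → k, (∀ i ∈ s, v i = 0) → eval v g = 0) {m : σ →₀ ℕ}
    (hm : m ∈ g.support) : ∃ i ∈ s, m i ≠ 0 := by
  classical
  let θ : MvPolynomial σ k →ₐ[k] MvPolynomial σ k := bind₁ fun i ↦ if i ∈ s then 0 else X i
  have hθ : θ g = 0 := MvPolynomial.funext fun v ↦ by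
    rw [map_zero, ← aeval_eq_eval, aeval_bind₁, aeval_eq_eval]
    exact h _ fun i hi ↦ by simp [hi]
  let I : Ideal (MvPolynomial σ k) := Ideal.span (X '' s)
  have hI : (Ideal.Quotient.mkₐ k I).comp θ = Ideal.Quotient.mkₐ k I := by
    refine algHom_ext fun i ↦ ?_
    by_cases hi : i ∈ s
    · have : Ideal.Quotient.mk I (X i) = 0 :=
        Ideal.Quotient.eq_zero_iff_mem.2 (Ideal.subset_span ⟨i, hi, rfl⟩)
      simp [θ, hi, this]
    · simp [θ, hi]
  have hg := DFunLike.congr_fun hI g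
  rw [AlgHom.comp_apply, hθ, map_zero, Ideal.Quotient.mkₐ_eq_mk] at hg
  exact mem_ideal_span_X_image.1 (Ideal.Quotient.eq_zero_iff_mem.1 hg.symm) m hm

end MvPolynomial

variable {g : MvPolynomial (Fin 4) k} {d : ℕ}

lemma MvPolynomial.IsHomogeneous.exists_eval_eq_of_cubic [Infinite k] (hg : g.IsHomogeneous 3)
    (h₁ : ∀ v : Fin 4 → k, v 0 = 0 → v 1 = 0 → eval v g = 0)
    (h₂ : ∀ v : Fin 4 → k, v 0 = 0 → v 2 = 0 → eval v g = 0) :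
    ∃ a b c : k, ∀ v : Fin 4 → k, v 0 = 0 →
      eval v g = v 1 * v 2 * (a * v 1 + b * v 2 + c * v 3) := by
  classical
  let m : ℕ → ℕ → ℕ → ℕ → Fin 4 →₀ ℕ := fun x y z w ↦
    Finsupp.equivFunOnFinite.symm ![x, y, z, w]
  let S : Finset (Fin 4 →₀ ℕ) := {m 0 2 1 0, m 0 1 2 0, m 0 1 1 1}
  refine ⟨coeff (m 0 2 1 0) g, coeff (m 0 1 2 0) g, coeff (m 0 1 1 1) g, fun v hv ↦ ?_⟩
  have hsum : eval v g = ∑ n ∈ S, coeff n g * ∏ i, v i ^ n i := by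
    rw [eval_eq']
    refine (Finset.sum_subset (Finset.subset_union_left (s₂ := S)) ?_).trans
      (Finset.sum_subset (Finset.subset_union_right (s₁ := g.support)) ?_).symm
    · intro n _ hn
      rw [notMem_support_iff.1 hn, zero_mul]
    · intro n hn hnS
      have hn : n ∈ g.support := (Finset.mem_union.1 hn).resolve_right hnS
      by_cases hn0 : n 0 = 0
      · obtain ⟨i, hi, hi0⟩ := exists_mem_ne_zero_of_mem_support (s := {0, 1})
          (fun v hv ↦ h₁ v (hv 0 (by simp)) (hv 1 (by simp))) hn
        obtain ⟨j, hj, hj0⟩ := exists_mem_ne_zero_of_mem_support (s := {0, 2})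
          (fun v hv ↦ h₂ v (hv 0 (by simp)) (hv 2 (by simp))) hn
        have hi1 : n 1 ≠ 0 := by rcases hi with rfl | rfl <;> [exact absurd hn0 hi0; exact hi0]
        have hj2 : n 2 ≠ 0 := by rcases hj with rfl | rfl <;> [exact absurd hn0 hj0; exact hj0]
        have hn3 := hg.sum_fin_four hn
        refine absurd ?_ hnS
        have hm : ∀ x y z w, n 0 = x → n 1 = y → n 2 = z → n 3 = w → n = m x y z w := by
          rintro x y z w rfl rfl rfl rfl
          ext i
          fin_cases i <;> rfl
        have h3 : (n 1 = 2 ∧ n 2 = 1 ∧ n 3 = 0) ∨ (n 1 = 1 ∧ n 2 = 2 ∧ n 3 = 0) ∨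
            (n 1 = 1 ∧ n 2 = 1 ∧ n 3 = 1) := by omega
        simp only [S, Finset.mem_insert, Finset.mem_singleton]
        exact h3.imp (fun h ↦ hm _ _ _ _ hn0 h.1 h.2.1 h.2.2) (Or.imp
          (fun h ↦ hm _ _ _ _ hn0 h.1 h.2.1 h.2.2) fun h ↦ hm _ _ _ _ hn0 h.1 h.2.1 h.2.2)
      · rw [Fin.prod_univ_four, hv, zero_pow hn0]
        ring
  have hne : ∀ x y z w x' y' z' w', (y ≠ y' ∨ z ≠ z') → m x y z w ≠ m x' y' z' w' := by
    intro x y z w x' y' z' w' h he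
    exact h.elim (· (by simpa [m] using DFunLike.congr_fun he 1))
      (· (by simpa [m] using DFunLike.congr_fun he 2))
  rw [hsum, Finset.sum_insert (by simp [hne]), Finset.sum_pair (hne _ _ _ _ _ _ _ _ (by simp))]
  simp [Fin.prod_univ_four, m]
  ring

lemma IsSmoothSurface.exists_eval_ne_mul_sq_mul [IsAlgClosed k] (hd : 2 ≤ d)
    (hg : IsSmoothSurface g d) (h : ∀ v : Fin 4 → k, v 0 = 0 → v 1 = 0 → eval v g = 0) (a : k) :
    ∃ v : Fin 4 → k, v 0 = 0 ∧ eval v g ≠ a * v 1 ^ 2 * v 2 := by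
  have : Infinite k := IsAlgClosed.instInfinite
  by_contra! ha
  have hB : chartCoeff g 0 1 = 0 := Polynomial.funext fun z ↦ by
    have h1 := sum_mul_eval_pderiv g ![0, 1, 0, 0] ![0, 0, z, 1]
    have h2 : g.restrictLine ![0, 1, 0, 0] ![0, 0, z, 1] =
        Polynomial.C (a * z) * Polynomial.X ^ 2 := Polynomial.funext fun t ↦ by
      rw [eval_restrictLine, ha _ (by simp)]
      simp
      ring
    rw [h2] at h1
    simpa [Fin.sum_univ_four, eval_pderiv_one_one] using h1
  have h1 := hg.isCoprime_chartCoeff h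
  have h2 := hg.max_natDegree_chartCoeff h
  rw [hB, isCoprime_zero_right] at h1
  rw [hB, Polynomial.natDegree_zero, Polynomial.natDegree_eq_zero_of_isUnit h1] at h2
  omega

end
section

variable {k : Type*} [Field k] [IsAlgClosed k] {f : MvPolynomial (Fin 4) k}

lemma IsSmoothSurface.exists_third_line_of_coordinates {g : MvPolynomial (Fin 4) k}
    (hg : IsSmoothSurface g 3)
    (h₁ : ∀ v : Fin 4 → k, v 0 = 0 → v 1 = 0 → eval v g = 0)
    (h₂ : ∀ v : Fin 4 → k, v 0 = 0 → v 2 = 0 → eval v g = 0) :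
    ∃ N : Submodule k (Fin 4 → k), IsLineOn g N ∧ (∀ v ∈ N, v 0 = 0) ∧
      (∃ v ∈ N, v 1 ≠ 0) ∧ ∃ v ∈ N, v 2 ≠ 0 := by
  have : Infinite k := IsAlgClosed.instInfinite
  obtain ⟨a, b, c, habc⟩ := hg.2.1.exists_eval_eq_of_cubic h₁ h₂
  have hbc : c = 0 → b ≠ 0 := by
    rintro rfl rfl
    obtain ⟨v, hv, hne⟩ := hg.exists_eval_ne_mul_sq_mul (by omega) h₁ a
    exact hne (by rw [habc v hv]; ring)
  have hac : c = 0 → a ≠ 0 := by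
    rintro rfl rfl
    obtain ⟨g', hg', h⟩ := hg.exists_comp (LinearEquiv.funCongrLeft k k (Equiv.swap 1 2))
    have h0 : ∀ v : Fin 4 → k, LinearEquiv.funCongrLeft k k (Equiv.swap 1 2) v 0 = v 0 :=
      fun v ↦ congrArg v (Equiv.swap_apply_of_ne_of_ne (by decide) (by decide))
    have h1 : ∀ v : Fin 4 → k, LinearEquiv.funCongrLeft k k (Equiv.swap 1 2) v 1 = v 2 :=
      fun v ↦ congrArg v (Equiv.swap_apply_left _ _)
    have h2 : ∀ v : Fin 4 → k, LinearEquiv.funCongrLeft k k (Equiv.swap 1 2) v 2 = v 1 :=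
      fun v ↦ congrArg v (Equiv.swap_apply_right _ _)
    obtain ⟨v, hv, hne⟩ := hg'.exists_eval_ne_mul_sq_mul (by omega)
      (fun v hv hv' ↦ by rw [h, h₂ _ ((h0 v).trans hv) ((h2 v).trans hv')]) b
    refine hne ?_
    rw [h, habc _ ((h0 v).trans hv), h1, h2]
    ring
  have key : ∀ p q : Fin 4 → k, q ≠ 0 → p ∉ Submodule.span k {q} → p 0 = 0 → q 0 = 0 →
      a * p 1 + b * p 2 + c * p 3 = 0 → a * q 1 + b * q 2 + c * q 3 = 0 →
      IsLineOn g (Submodule.span k {p, q}) ∧ ∀ v ∈ Submodule.span k {p, q}, v 0 = 0 := by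
    intro p q hq0 hp hp0 hq0 hpN hqN
    have h0 : ∀ v ∈ Submodule.span k {p, q}, v 0 = 0 := fun v hv ↦ by
      obtain ⟨s, t, rfl⟩ := Submodule.mem_span_pair.1 hv
      simp [hp0, hq0]
    refine ⟨⟨Submodule.finrank_span_pair_eq_two ‹_› hp, fun v hv ↦ ?_⟩, h0⟩
    rw [habc v (h0 v hv)]
    obtain ⟨s, t, rfl⟩ := Submodule.mem_span_pair.1 hv
    simp only [Pi.add_apply, Pi.smul_apply, smul_eq_mul]
    linear_combination (s * p 1 + t * q 1) * (s * p 2 + t * q 2) * (s * hpN + t * hqN)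
  by_cases hc : c = 0
  · obtain ⟨h1, h0⟩ := key ![0, b, -a, 0] ![0, 0, 0, 1] (fun h ↦ by simpa using congrFun h 3)
      (fun h ↦ by
        obtain ⟨t, ht⟩ := Submodule.mem_span_singleton.1 h
        exact hbc hc (by simpa using (congrFun ht 1).symm))
      (by simp) (by simp) (by simp; ring) (by simp [hc])
    refine ⟨_, h1, h0, ⟨_, Submodule.subset_span (Set.mem_insert _ _), ?_⟩,
      ⟨_, Submodule.subset_span (Set.mem_insert _ _), ?_⟩⟩
    · simpa using hbc hc
    · simpa using hac hc
  · obtain ⟨h1, h0⟩ := key ![0, c, 0, -a] ![0, 0, c, -b]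
      (fun h ↦ hc (by simpa using congrFun h 2))
      (fun h ↦ by
        obtain ⟨t, ht⟩ := Submodule.mem_span_singleton.1 h
        exact hc (by simpa using (congrFun ht 1).symm))
      (by simp) (by simp) (by simp; ring) (by simp; ring)
    refine ⟨_, h1, h0, ⟨_, Submodule.subset_span (Set.mem_insert _ _), ?_⟩,
      ⟨_, Submodule.subset_span (Set.mem_insert_of_mem _ rfl), ?_⟩⟩
    · simpa using hc
    · simpa using hc

/-- Two distinct coplanar lines on a smooth cubic surface are part of a triangle. -/
lemma IsSmoothSurface.exists_third_line (hf : IsSmoothSurface f 3)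
    {L M H : Submodule k (Fin 4 → k)} (hL : IsLineOn f L) (hM : IsLineOn f M) (hML : M ≠ L)
    (hH : Module.finrank k H = 3) (hLH : L ≤ H) (hMH : M ≤ H) :
    ∃ N, IsLineOn f N ∧ N ≤ H ∧ N ≠ L ∧ N ≠ M := by
  have : Infinite k := IsAlgClosed.instInfinite
  obtain ⟨e₄, ⟨he₄L, he₄M⟩, he₄⟩ := Submodule.exists_mem_ne_zero_of_ne_bot
    (Submodule.inf_ne_bot_of_le hL.1 hM.1 hH hLH hMH)
  obtain ⟨e₃, he₃L, he₃M⟩ : ∃ v ∈ L, v ∉ M := SetLike.not_le_iff_exists.1 fun hle ↦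
    hML (Submodule.eq_of_le_of_finrank_le hle (by rw [hM.1, hL.1])).symm
  obtain ⟨e₂, he₂M, he₂L⟩ : ∃ v ∈ M, v ∉ L := SetLike.not_le_iff_exists.1 fun hle ↦
    hML (Submodule.eq_of_le_of_finrank_le hle (by rw [hM.1, hL.1]))
  obtain ⟨e₁, -, he₁⟩ := SetLike.not_le_iff_exists.1
    (Submodule.not_le_of_finrank_lt (p := H) (q := ⊤) (by rw [hH]; simp))
  have hspan₃ : Submodule.span k {e₃, e₄} ≤ L := Submodule.span_le.2 (by
    rintro v (rfl | rfl)
    exacts [he₃L, he₄L])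
  have hspan₂ : Submodule.span k {e₂, e₃, e₄} ≤ H := Submodule.span_le.2 (by
    rintro v (rfl | rfl | rfl)
    exacts [hMH he₂M, hLH he₃L, hLH he₄L])
  obtain ⟨T, hT⟩ := exists_linearEquiv_of_notMem_span he₄
    (fun h ↦ he₃M ((Submodule.span_singleton_le_iff_mem e₄ M).2 he₄M h))
    (fun h ↦ he₂L (hspan₃ h)) (fun h ↦ he₁ (hspan₂ h))
  obtain ⟨g, hg, hgf⟩ := hf.exists_comp T
  obtain ⟨N, hN, hN0, ⟨v, hv, hv1⟩, ⟨w, hw, hw2⟩⟩ := hg.exists_third_line_of_coordinates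
    (fun v hv0 hv1 ↦ by
      rw [hgf, hT, hv0, hv1]
      exact hL.2 _ (L.add_mem (L.add_mem (by simp) (L.smul_mem _ he₃L)) (L.smul_mem _ he₄L)))
    (fun v hv0 hv2 ↦ by
      rw [hgf, hT, hv0, hv2]
      exact hM.2 _ (M.add_mem (M.add_mem (M.add_mem (by simp) (M.smul_mem _ he₂M)) (by simp))
        (M.smul_mem _ he₄M)))
  refine ⟨Submodule.orderIsoMapComap T N, (isLineOn_map_iff hgf N).2 hN, ?_, ?_, ?_⟩
  · rintro _ ⟨u, hu, rfl⟩
    have : T u = u 0 • e₁ + u 1 • e₂ + u 2 • e₃ + u 3 • e₄ := hT u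
    rw [hN0 u hu, zero_smul, zero_add] at this
    change T u ∈ H
    rw [this]
    exact H.add_mem (H.add_mem (H.smul_mem _ (hMH he₂M)) (H.smul_mem _ (hLH he₃L)))
      (H.smul_mem _ (hLH he₄L))
  · rintro rfl
    have h : T v ∈ Submodule.orderIsoMapComap T N := ⟨v, hv, rfl⟩
    rw [hT, hN0 v hv, zero_smul, zero_add,
      Submodule.add_mem_iff_left _ (Submodule.smul_mem _ _ he₄L),
      Submodule.add_mem_iff_left _ (Submodule.smul_mem _ _ he₃L), Submodule.smul_mem_iff _ hv1] at h
    exact he₂L h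
  · rintro rfl
    have h : T w ∈ Submodule.orderIsoMapComap T N := ⟨w, hw, rfl⟩
    rw [hT, hN0 w hw, zero_smul, zero_add,
      Submodule.add_mem_iff_left _ (Submodule.smul_mem _ _ he₄M),
      Submodule.add_mem_iff_right _ (Submodule.smul_mem _ _ he₂M),
      Submodule.smul_mem_iff _ hw2] at h
    exact he₃M h

end
section

variable {k : Type*} [Field k] {f : MvPolynomial (Fin 4) k} {d : ℕ}
  {L : Submodule k (Fin 4 → k)}

lemma setOf_sup_eq_eq_diff (hL : IsLineOn f L) {H : Submodule k (Fin 4 → k)}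
    (hH : Module.finrank k H = 3) (hLH : L ≤ H) :
    {M | (IsLineOn f M ∧ M ≠ L ∧ M ⊓ L ≠ ⊥) ∧ L ⊔ M = H} =
      {M | IsLineOn f M ∧ M ≤ H} \ {L} := by
  ext M
  constructor
  · rintro ⟨⟨hM, hML, -⟩, rfl⟩
    exact ⟨⟨hM, le_sup_right⟩, hML⟩
  · rintro ⟨⟨hM, hMH⟩, hML⟩
    have hinf := Submodule.inf_ne_bot_of_le hM.1 hL.1 hH hMH hLH
    refine ⟨⟨hM, hML, hinf⟩, Submodule.eq_of_le_of_finrank_le (sup_le hLH hMH) ?_⟩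
    rw [hH, Submodule.finrank_sup_eq_three hL.1 hM.1 (Ne.symm hML) (by rwa [inf_comm])]

lemma ncard_lines_meeting_eq_sum (hL : IsLineOn f L)
    (hX : {M : Submodule k (Fin 4 → k) | IsLineOn f M ∧ M ≠ L ∧ M ⊓ L ≠ ⊥}.Finite)
    (hP : {H : Submodule k (Fin 4 → k) | Module.finrank k H = 3 ∧ L ≤ H ∧
      ∃ M : Submodule k (Fin 4 → k), IsLineOn f M ∧ M ≠ L ∧ M ≤ H}.Finite) :
    {M : Submodule k (Fin 4 → k) | IsLineOn f M ∧ M ≠ L ∧ M ⊓ L ≠ ⊥}.ncard =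
      ∑ H ∈ hP.toFinset, ({M : Submodule k (Fin 4 → k) | IsLineOn f M ∧ M ≤ H} \ {L}).ncard := by
  classical
  rw [Set.ncard_eq_toFinset_card _ hX, Finset.card_eq_sum_card_fiberwise (f := (L ⊔ ·))
    (t := hP.toFinset)]
  · refine Finset.sum_congr rfl fun H hH ↦ ?_
    obtain ⟨hH, hLH, -⟩ := (Set.Finite.mem_toFinset hP).1 hH
    rw [← setOf_sup_eq_eq_diff hL hH hLH, ← Set.ncard_coe_finset]
    congr 1
    ext M
    simp
  · intro M hM
    obtain ⟨hM, hML, hinf⟩ := (Set.Finite.mem_toFinset hX).1 hM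
    exact (Set.Finite.mem_toFinset hP).2 ⟨Submodule.finrank_sup_eq_three hL.1 hM.1 hML.symm
      (by rwa [inf_comm]), le_sup_left, M, hM, hML, le_sup_right⟩

lemma finite_planes_of_finite_lines (hL : IsLineOn f L)
    (hX : {M : Submodule k (Fin 4 → k) | IsLineOn f M ∧ M ≠ L ∧ M ⊓ L ≠ ⊥}.Finite) :
    {H : Submodule k (Fin 4 → k) | Module.finrank k H = 3 ∧ L ≤ H ∧
      ∃ M : Submodule k (Fin 4 → k), IsLineOn f M ∧ M ≠ L ∧ M ≤ H}.Finite := by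
  refine (hX.image (L ⊔ ·)).subset ?_
  rintro H ⟨hH, hLH, M, hM, hML, hMH⟩
  have : M ∈ {M | IsLineOn f M ∧ M ≤ H} \ {L} := ⟨⟨hM, hMH⟩, hML⟩
  rw [← setOf_sup_eq_eq_diff hL hH hLH] at this
  exact ⟨M, this⟩

lemma finite_lines_le_of_finite_lines (hL : IsLineOn f L)
    (hX : {M : Submodule k (Fin 4 → k) | IsLineOn f M ∧ M ≠ L ∧ M ⊓ L ≠ ⊥}.Finite)
    {H : Submodule k (Fin 4 → k)} (hH : Module.finrank k H = 3) (hLH : L ≤ H) :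
    ({M : Submodule k (Fin 4 → k) | IsLineOn f M ∧ M ≤ H} \ {L}).Finite := by
  rw [← setOf_sup_eq_eq_diff hL hH hLH]
  exact hX.subset fun M hM ↦ hM.1

lemma finite_lines_of_finite_planes (hL : IsLineOn f L)
    (hP : {H : Submodule k (Fin 4 → k) | Module.finrank k H = 3 ∧ L ≤ H ∧
      ∃ M : Submodule k (Fin 4 → k), IsLineOn f M ∧ M ≠ L ∧ M ≤ H}.Finite)
    (hH : ∀ H : Submodule k (Fin 4 → k), Module.finrank k H = 3 → L ≤ H →
      (∃ M : Submodule k (Fin 4 → k), IsLineOn f M ∧ M ≠ L ∧ M ≤ H) →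
      {M : Submodule k (Fin 4 → k) | IsLineOn f M ∧ M ≤ H}.Finite) :
    {M : Submodule k (Fin 4 → k) | IsLineOn f M ∧ M ≠ L ∧ M ⊓ L ≠ ⊥}.Finite := by
  refine (hP.biUnion fun H h ↦ hH H h.1 h.2.1 h.2.2).subset ?_
  rintro M ⟨hM, hML, hinf⟩
  exact Set.mem_biUnion (x := L ⊔ M) ⟨Submodule.finrank_sup_eq_three hL.1 hM.1 hML.symm
    (by rwa [inf_comm]), le_sup_left, M, hM, hML, le_sup_right⟩ ⟨hM, le_sup_right⟩

lemma IsSmoothSurface.ncard_planes_le [IsAlgClosed k] (hd : 3 ≤ d) (hf : IsSmoothSurface f d)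
    (hL : IsLineOn f L)
    (hX : {M : Submodule k (Fin 4 → k) | IsLineOn f M ∧ M ≠ L ∧ M ⊓ L ≠ ⊥}.Finite)
    (hcard : {M : Submodule k (Fin 4 → k) | IsLineOn f M ∧ M ≠ L ∧ M ⊓ L ≠ ⊥}.ncard =
      (d - 1) * ((d - 1) ^ 2 + 1)) :
    {H : Submodule k (Fin 4 → k) | Module.finrank k H = 3 ∧ L ≤ H ∧
      ∃ M : Submodule k (Fin 4 → k), IsLineOn f M ∧ M ≠ L ∧ M ≤ H}.ncard ≤ (d - 1) ^ 2 + 1 := by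
  obtain rfl | hd := hd.eq_or_lt
  · have hP := finite_planes_of_finite_lines hL hX
    rw [ncard_lines_meeting_eq_sum hL hX hP] at hcard
    rw [Set.ncard_eq_toFinset_card _ hP]
    have := Finset.card_nsmul_le_sum hP.toFinset
      (fun H ↦ ({M : Submodule k (Fin 4 → k) | IsLineOn f M ∧ M ≤ H} \ {L}).ncard) 2
      fun H hH ↦ by
        obtain ⟨hH, hLH, M, hM, hML, hMH⟩ := (Set.Finite.mem_toFinset hP).1 hH
        obtain ⟨N, hN, hNH, hNL, hNM⟩ := hf.exists_third_line hL hM hML hH hLH hMH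
        exact (Set.one_lt_ncard (finite_lines_le_of_finite_lines hL hX hH hLH)).2
          ⟨M, ⟨⟨hM, hMH⟩, hML⟩, N, ⟨⟨hN, hNH⟩, hNL⟩, hNM.symm⟩
    rw [hcard, smul_eq_mul] at this
    omega
  · exact (hf.ncard_lines_lt_or_ncard_planes_le hd hL hX).resolve_left hcard.not_lt

end

theorem max_lines_meeting_iff_plane_configuration {k : Type*} [Field k] [IsAlgClosed k]
    (d : ℕ) (hd : 3 ≤ d)
    (f : MvPolynomial (Fin 4) k) (hf : IsSmoothSurface f d)
    (L : Submodule k (Fin 4 → k)) (hL : IsLineOn f L) :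
    {M : Submodule k (Fin 4 → k) | IsLineOn f M ∧ M ≠ L ∧ M ⊓ L ≠ ⊥}.ncard =
        d ^ 3 - 3 * d ^ 2 + 4 * d - 2 ↔
      ({H : Submodule k (Fin 4 → k) | Module.finrank k H = 3 ∧ L ≤ H ∧
          ∃ M : Submodule k (Fin 4 → k), IsLineOn f M ∧ M ≠ L ∧ M ≤ H}.ncard =
        d ^ 2 - 2 * d + 2) ∧
      ∀ H : Submodule k (Fin 4 → k), Module.finrank k H = 3 → L ≤ H →
        (∃ M : Submodule k (Fin 4 → k), IsLineOn f M ∧ M ≠ L ∧ M ≤ H) →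
        {M : Submodule k (Fin 4 → k) | IsLineOn f M ∧ M ≤ H}.ncard = d := by
  have : Infinite k := IsAlgClosed.instInfinite
  have hC : d ^ 3 - 3 * d ^ 2 + 4 * d - 2 = (d - 1) * ((d - 1) ^ 2 + 1) := by
    obtain ⟨e, rfl⟩ := Nat.exists_eq_add_of_le' hd
    rw [show (e + 3) ^ 3 = e * (e + 3) ^ 2 + 3 * (e + 3) ^ 2 by ring, Nat.add_sub_cancel,
      show e * (e + 3) ^ 2 + 4 * (e + 3) = (e + 2) * ((e + 2) ^ 2 + 1) + 2 by ring,
      Nat.add_sub_cancel, show e + 3 - 1 = e + 2 by omega]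
  have hN : d ^ 2 - 2 * d + 2 = (d - 1) ^ 2 + 1 := by
    obtain ⟨e, rfl⟩ := Nat.exists_eq_add_of_le' hd
    rw [show (e + 3) ^ 2 = e ^ 2 + 4 * e + 3 + 2 * (e + 3) by ring, Nat.add_sub_cancel,
      show e + 3 - 1 = e + 2 by omega]
    ring
  rw [hC, hN]
  constructor
  · intro hcard
    have hX := Set.finite_of_ncard_pos (hcard ▸ Nat.mul_pos (by omega) (Nat.succ_pos _))
    have hP := finite_planes_of_finite_lines hL hX
    have hle := hf.ncard_planes_le hd hL hX hcard
    have hfiber : ∀ H ∈ hP.toFinset,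
        ({M : Submodule k (Fin 4 → k) | IsLineOn f M ∧ M ≤ H} \ {L}).ncard ≤ d - 1 := by
      intro H hH
      obtain ⟨hH, hLH, -⟩ := (Set.Finite.mem_toFinset hP).1 hH
      have hfin := (finite_lines_le_of_finite_lines hL hX hH hLH).of_sdiff (Set.finite_singleton L)
      have hmem : L ∈ {M : Submodule k (Fin 4 → k) | IsLineOn f M ∧ M ≤ H} := ⟨hL, hLH⟩
      rw [Set.ncard_sdiff_singleton_of_mem hmem, Set.ncard_eq_toFinset_card _ hfin]
      refine Nat.sub_le_sub_right (IsLineOn.card_le hf.2.1 hH ?_ _ fun M hM ↦ by simpa using hM) 1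
      by_contra! h
      exact infinite_of_forall_mem_eval_eq_zero hL.1 hH h hLH hX
    rw [ncard_lines_meeting_eq_sum hL hX hP] at hcard
    have hsum := Finset.sum_le_card_nsmul _ _ _ hfiber
    rw [hcard, ← Set.ncard_eq_toFinset_card _ hP, smul_eq_mul, mul_comm] at hsum
    have heq := hle.antisymm (Nat.le_of_mul_le_mul_right hsum (by omega))
    refine ⟨heq, fun H hH hLH hM ↦ ?_⟩
    have hmem : L ∈ {M : Submodule k (Fin 4 → k) | IsLineOn f M ∧ M ≤ H} := ⟨hL, hLH⟩
    have hfin := (finite_lines_le_of_finite_lines hL hX hH hLH).of_sdiff (Set.finite_singleton L)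
    have h1 := (Finset.sum_eq_sum_iff_of_le hfiber).1 (by
      rw [hcard, Finset.sum_const, ← Set.ncard_eq_toFinset_card _ hP, heq, smul_eq_mul, mul_comm])
      H ((Set.Finite.mem_toFinset hP).2 ⟨hH, hLH, hM⟩)
    rw [Set.ncard_sdiff_singleton_of_mem hmem] at h1
    have h2 := (Set.ncard_pos hfin).2 ⟨L, hmem⟩
    omega
  · rintro ⟨hcard, hlines⟩
    have hP := Set.finite_of_ncard_pos (by rw [hcard]; exact Nat.succ_pos _)
    have hX := finite_lines_of_finite_planes hL hP fun H h1 h2 h3 ↦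
      Set.finite_of_ncard_pos (by rw [hlines H h1 h2 h3]; omega)
    rw [ncard_lines_meeting_eq_sum hL hX hP, Finset.sum_congr rfl (g := fun _ ↦ d - 1),
      Finset.sum_const, ← Set.ncard_eq_toFinset_card _ hP, hcard, smul_eq_mul, mul_comm]
    intro H hH
    obtain ⟨h1, h2, h3⟩ := (Set.Finite.mem_toFinset hP).1 hH
    rw [Set.ncard_sdiff_singleton_of_mem (show L ∈ {M | IsLineOn f M ∧ M ≤ H} from ⟨hL, h2⟩),
      hlines H h1 h2 h3]
end
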